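/- Let Γ and Λ be finite connected simplicial graphs containing cut vertices v ∈ VΓ and w ∈ VΛ respectively, and suppose Γ is not equal to star(u) for any vertex u of Γ and Λ is not equal to star(u) for any vertex u of Λ. Then the cylindrical vertex groups (A(star(v)), 𝒫_v) and (A(star(w)), 𝒫_w) are relatively quasi-isometric if and only if: (i) for every peripheral factor of A(star(v)) there is a peripheral factor of A(star(w)) quasi-isometric to it, and vice versa; and (ii) for every one-ended non-peripheral factor of A(star(v)) there is a one-ended non-peripheral factor of A(star(w)) quasi-isometric to it, and vice versa. -/

import Mathlib

noncomputable section

universe u v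

/-- Word metric (distance function) on a group with respect to a generating set `S`. -/
def wordDist {G : Type*} [Group G] (S : Set G) (g h : G) : ℝ :=
  sInf ((fun l : List G => (l.length : ℝ)) ''
    {l : List G | (∀ x ∈ l, x ∈ S ∨ x⁻¹ ∈ S) ∧ g * l.prod = h})

/-- `f` is `(K, A)`-coarse Lipschitz. -/
def CoarseLipschitzWith {X Y : Type*} (K A : ℝ) (dX : X → X → ℝ) (dY : Y → Y → ℝ)
    (f : X → Y) : Prop :=
  ∀ x x', dY (f x) (f x') ≤ K * dX x x' + A

/-- `f` is a `(K, A)`-quasi-isometry. -/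
def IsQIWith {X Y : Type*} (K A : ℝ) (dX : X → X → ℝ) (dY : Y → Y → ℝ) (f : X → Y) : Prop :=
  1 ≤ K ∧ 0 ≤ A ∧
  (∀ x x', dX x x' / K - A ≤ dY (f x) (f x') ∧ dY (f x) (f x') ≤ K * dX x x' + A) ∧
  (∀ y, ∃ x, dY (f x) y ≤ A)

/-- `f` is a quasi-isometry. -/
def IsQI {X Y : Type*} (dX : X → X → ℝ) (dY : Y → Y → ℝ) (f : X → Y) : Prop :=
  ∃ K A : ℝ, IsQIWith K A dX dY f

/-- The Hausdorff distance between `S` and `T` (w.r.t. the distance `d`) is at most `r`. -/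
def HausLE {X : Type*} (d : X → X → ℝ) (S T : Set X) (r : ℝ) : Prop :=
  (∀ s ∈ S, ∃ t ∈ T, d s t ≤ r) ∧ (∀ t ∈ T, ∃ s ∈ S, d s t ≤ r)

/-- `S` and `T` are at finite Hausdorff distance. -/
def FinHaus {X : Type*} (d : X → X → ℝ) (S T : Set X) : Prop :=
  ∃ r : ℝ, 0 ≤ r ∧ HausLE d S T r

/-- The commutator relations of a right-angled Artin group. -/
def raagRels {V : Type} (Γ : SimpleGraph V) : Set (FreeGroup V) :=
  {r | ∃ x y : V, Γ.Adj x y ∧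
    r = FreeGroup.of x * FreeGroup.of y * (FreeGroup.of x)⁻¹ * (FreeGroup.of y)⁻¹}

/-- The right-angled Artin group `A(Γ)` of a simplicial graph `Γ`. -/
abbrev Raag {V : Type} (Γ : SimpleGraph V) : Type := PresentedGroup (raagRels Γ)

/-- The generator of `Raag Γ` corresponding to a vertex. -/
def raagGen {V : Type} (Γ : SimpleGraph V) (x : V) : Raag Γ :=
  PresentedGroup.of (rels := raagRels Γ) x

/-- The word metric on `Raag Γ` with respect to the vertex generators. -/
def raagDist {V : Type} (Γ : SimpleGraph V) : Raag Γ → Raag Γ → ℝ :=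
  wordDist (Set.range (raagGen Γ))

/-- `A(Γ)` and `A(Λ)` are quasi-isometric (w.r.t. the vertex word metrics). -/
def RaagQI {V W : Type} (Γ : SimpleGraph V) (Λ : SimpleGraph W) : Prop :=
  ∃ f : Raag Γ → Raag Λ, IsQI (raagDist Γ) (raagDist Λ) f

/-- A standard geodesic: the coset `g⟨v⟩`, recorded by a basepoint `g` and a label `v`. -/
structure StdGeod {V : Type} (Γ : SimpleGraph V) where
  base : Raag Γ
  label : V

/-- The parametrization `n ↦ g vⁿ` of a standard geodesic, identifying it with `ℤ`. -/
def StdGeod.param {V : Type} {Γ : SimpleGraph V} (l : StdGeod Γ) : ℤ → Raag Γ :=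
  fun n => l.base * raagGen Γ l.label ^ n

/-- The underlying subset of a standard geodesic. -/
def StdGeod.carrier {V : Type} {Γ : SimpleGraph V} (l : StdGeod Γ) : Set (Raag Γ) :=
  Set.range l.param

/-- Two standard geodesics are parallel if they are at finite Hausdorff distance. -/
def Parallel {V : Type} {Γ : SimpleGraph V} (l k : StdGeod Γ) : Prop :=
  FinHaus (raagDist Γ) l.carrier k.carrier

/-- A based quasi-isometry `(A(Γ), l) → (A(Λ), l')`. -/
def IsBasedQI {V W : Type} {Γ : SimpleGraph V} {Λ : SimpleGraph W}
    (f : Raag Γ → Raag Λ) (l : StdGeod Γ) (l' : StdGeod Λ) : Prop :=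
  IsQI (raagDist Γ) (raagDist Λ) f ∧ FinHaus (raagDist Λ) (f '' l.carrier) l'.carrier

/-- `str(f, l, C) = r`: on `l`, the map `f` is `C`-close to `n ↦ ±⌊r n⌋ + b`
(read through the identifications of `l` and `l'` with `ℤ`). -/
def StrWith {V W : Type} {Γ : SimpleGraph V} {Λ : SimpleGraph W}
    (f : Raag Γ → Raag Λ) (l : StdGeod Γ) (l' : StdGeod Λ) (C : ℝ) (r : ℚ) : Prop :=
  ∃ ε : ℤ, (ε = 1 ∨ ε = -1) ∧ ∃ b : ℤ,
    ∀ n : ℤ, raagDist Λ (f (l.param n)) (l'.param (ε * ⌊r * (n : ℚ)⌋ + b)) ≤ C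

/-- The stretch factor `str(f, l)` (computed with respect to `l'`) is well-defined
and equals `r`. -/
def HasStr {V W : Type} {Γ : SimpleGraph V} {Λ : SimpleGraph W}
    (f : Raag Γ → Raag Λ) (l : StdGeod Γ) (l' : StdGeod Λ) (r : ℚ) : Prop :=
  ∃ C : ℝ, 0 ≤ C ∧ StrWith f l l' C r

/-- `l` is an `𝓡`-geodesic. -/
def IsRGeod {V : Type} {Γ : SimpleGraph V} (l : StdGeod Γ) : Prop :=
  ∀ (W : Type) [Fintype W] (Λ : SimpleGraph W) (l' : StdGeod Λ)
    (f g : Raag Γ → Raag Λ),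
    IsBasedQI f l l' → IsBasedQI g l l' →
    ∃ r : ℚ, HasStr f l l' r ∧ HasStr g l l' r

/-- The parallelism class `𝒮_l` of a standard geodesic (as a family of subsets). -/
def parClass {V : Type} {Γ : SimpleGraph V} (l : StdGeod Γ) : Set (Set (Raag Γ)) :=
  {S | ∃ k : StdGeod Γ, S = k.carrier ∧ Parallel l k}

/-- The peripheral structure `𝒫_B` on `Raag Γ` determined by a set `B` of vertices. -/
def periph {V : Type} (Γ : SimpleGraph V) (B : Set V) : Set (Set (Set (Raag Γ))) :=
  {F | ∃ l : StdGeod Γ, l.label ∈ B ∧ F = parClass l}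

/-- A `(K, A)`-relative quasi-isometry between spaces with peripheral structures. -/
def IsRelQIWith {X Y : Type*} (K A : ℝ) (dX : X → X → ℝ) (dY : Y → Y → ℝ)
    (PX : Set (Set (Set X))) (PY : Set (Set (Set Y)))
    (f : X → Y) (fs : Set (Set X) → Set (Set Y)) : Prop :=
  IsQIWith K A dX dY f ∧
  Set.BijOn fs PX PY ∧
  ∀ F ∈ PX, (∀ a ∈ F, ∃ b ∈ fs F, HausLE dY (f '' a) b A) ∧
            (∀ b ∈ fs F, ∃ a ∈ F, HausLE dY (f '' a) b A)

/-- The two spaces with peripheral structures are relatively quasi-isometric. -/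
def IsRelQI {X Y : Type*} (dX : X → X → ℝ) (dY : Y → Y → ℝ)
    (PX : Set (Set (Set X))) (PY : Set (Set (Set Y))) : Prop :=
  ∃ (K A : ℝ) (f : X → Y) (fs : Set (Set X) → Set (Set Y)),
    IsRelQIWith K A dX dY PX PY f fs

/-- Left translation of a family of subsets of `Raag Γ`. -/
def translateFam {V : Type} {Γ : SimpleGraph V} (g : Raag Γ) (F : Set (Set (Raag Γ))) :
    Set (Set (Raag Γ)) :=
  (fun a => (fun x => g * x) '' a) '' F

/-- A decoration on `𝒫_B` that is invariant under the left translation action. -/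
def DecorInvariant {V : Type} (Γ : SimpleGraph V) (B : Set V) {O : Type}
    (δ : Set (Set (Raag Γ)) → O) : Prop :=
  ∀ g : Raag Γ, ∀ F ∈ periph Γ B, δ (translateFam g F) = δ F

/-- A decoration-preserving based relative quasi-isometry
`(A(Γ), 𝒫_{BΓ}, δΓ, l) → (A(Λ), 𝒫_{BΛ}, δΛ, l')`. -/
def IsDecorBasedRelQI {V W : Type} (Γ : SimpleGraph V) (Λ : SimpleGraph W)
    (BΓ : Set V) (BΛ : Set W) {O : Type}
    (δΓ : Set (Set (Raag Γ)) → O) (δΛ : Set (Set (Raag Λ)) → O)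
    (l : StdGeod Γ) (l' : StdGeod Λ)
    (f : Raag Γ → Raag Λ) (fs : Set (Set (Raag Γ)) → Set (Set (Raag Λ))) : Prop :=
  (∃ K A : ℝ, IsRelQIWith K A (raagDist Γ) (raagDist Λ) (periph Γ BΓ) (periph Λ BΛ) f fs) ∧
  (∀ F ∈ periph Γ BΓ, δΛ (fs F) = δΓ F) ∧
  FinHaus (raagDist Λ) (f '' l.carrier) l'.carrier

/-- `A(Γ)` is a dovetail RAAG. -/
def Dovetail {V : Type} (Γ : SimpleGraph V) : Prop :=
  ∀ (W : Type) [Fintype W] (Λ : SimpleGraph W) (BΓ : Set V) (BΛ : Set W)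
    (O : Type) (δΓ : Set (Set (Raag Γ)) → O) (δΛ : Set (Set (Raag Λ)) → O),
    DecorInvariant Γ BΓ δΓ → DecorInvariant Λ BΛ δΛ →
    ∀ (l : StdGeod Γ) (l' : StdGeod Λ) (f : Raag Γ → Raag Λ)
      (fs : Set (Set (Raag Γ)) → Set (Set (Raag Λ))),
      IsDecorBasedRelQI Γ Λ BΓ BΛ δΓ δΛ l l' f fs →
      ∀ lam : Set (Set (Raag Γ)) → ℚ,
        (∀ F ∈ periph Γ BΓ, 0 < lam F) →
        (∃ M : ℚ, 1 ≤ M ∧ ∀ F ∈ periph Γ BΓ, 1 / M ≤ lam F ∧ lam F ≤ M) →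
        (∀ F ∈ periph Γ BΓ, ∀ F' ∈ periph Γ BΓ, δΓ F = δΓ F' → lam F = lam F') →
        ∃ C : ℝ, 0 ≤ C ∧
          ∃ (g : Raag Γ → Raag Λ) (gs : Set (Set (Raag Γ)) → Set (Set (Raag Λ))),
            IsDecorBasedRelQI Γ Λ BΓ BΛ δΓ δΛ l l' g gs ∧
            (∀ l2 : StdGeod Γ, l2.label ∈ BΓ → ¬ IsRGeod l2 →
              ∀ l3 : StdGeod Λ, FinHaus (raagDist Λ) (g '' l2.carrier) l3.carrier →
                StrWith g l2 l3 C (lam (parClass l2))) ∧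
            (∀ l2 : StdGeod Γ, l2.label ∈ BΓ → IsRGeod l2 →
              ∀ l3 : StdGeod Λ, FinHaus (raagDist Λ) (g '' l2.carrier) l3.carrier →
                ∃ r : ℚ, StrWith g l2 l3 C r)

/-- The closed star of a vertex, as a vertex set. -/
def starSet {V : Type} (Γ : SimpleGraph V) (x : V) : Set V :=
  insert x {u | Γ.Adj x u}

/-- The link of a vertex, as a vertex set. -/
def lkSet {V : Type} (Γ : SimpleGraph V) (x : V) : Set V := {u | Γ.Adj x u}

/-- The link of `x` inside the induced subgraph on `S`. -/
def lkIn {V : Type} (Γ : SimpleGraph V) (S : Set V) (x : V) : Set V :=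
  {u | u ∈ S ∧ Γ.Adj x u}

/-- `x` is a cut vertex: deleting it (and incident edges) disconnects the graph. -/
def CutVertex {V : Type} (Γ : SimpleGraph V) (x : V) : Prop :=
  ¬ (Γ.induce {u : V | u ≠ x}).Preconnected

/-- The vertex set `S` spans a biconnected subgraph: connected with no cut vertex. -/
def Biconn {V : Type} (Γ : SimpleGraph V) (S : Set V) : Prop :=
  (Γ.induce S).Connected ∧ ∀ x ∈ S, (Γ.induce (S \ {x})).Preconnected

/-- `S` spans a maximal biconnected subgraph. -/
def MaxBiconn {V : Type} (Γ : SimpleGraph V) (S : Set V) : Prop :=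
  Biconn Γ S ∧ ∀ T : Set V, Biconn Γ T → S ⊆ T → S = T

/-- The collection `C₁` of maximal biconnected subgraphs: those containing at least
two cut vertices, or not contained in the star of any cut vertex. -/
def C1 {V : Type} (Γ : SimpleGraph V) : Set (Set V) :=
  {S | MaxBiconn Γ S ∧
    ((∃ x ∈ S, ∃ y ∈ S, x ≠ y ∧ CutVertex Γ x ∧ CutVertex Γ y) ∨
     (∀ x : V, CutVertex Γ x → ¬ S ⊆ starSet Γ x))}

/-- `Γ` is an `n`-clique tree-graded graph. -/
def NCliqueTreeGraded {V : Type} (Γ : SimpleGraph V) (n : ℕ) : Prop :=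
  Γ.Connected ∧
  (∀ x : V, CutVertex Γ x ∨ (∃! u : V, Γ.Adj x u)) ∧
  (∃ x y : V, 3 ≤ Γ.dist x y) ∧
  (∀ S : Set V, MaxBiconn Γ S →
    ((Γ.IsClique S ∧ S.ncard = n ∧ ∀ x ∈ S, CutVertex Γ x) ∨
     (Γ.IsClique S ∧ S.ncard = 2 ∧ ∃! x : V, x ∈ S ∧ CutVertex Γ x)))

/-- The subgroup of `Raag Γ` generated by the vertices in `T`. -/
def subRaag {V : Type} (Γ : SimpleGraph V) (T : Set V) : Subgroup (Raag Γ) :=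
  Subgroup.closure (raagGen Γ '' T)

/-- The word metric on the subgroup generated by `T`, w.r.t. the generators from `T`. -/
def subDist {V : Type} (Γ : SimpleGraph V) (T : Set V) :
    ↥(subRaag Γ T) → ↥(subRaag Γ T) → ℝ :=
  wordDist {x : ↥(subRaag Γ T) | ∃ u ∈ T, (x : Raag Γ) = raagGen Γ u}

/-- The cylinder group `A(star(x))`. -/
def cylGroup {V : Type} (Γ : SimpleGraph V) (x : V) : Subgroup (Raag Γ) :=
  subRaag Γ (starSet Γ x)

/-- The word metric on the cylinder `A(star(x))` w.r.t. the vertices of `star(x)`. -/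
def cylDist {V : Type} (Γ : SimpleGraph V) (x : V) :
    ↥(cylGroup Γ x) → ↥(cylGroup Γ x) → ℝ :=
  subDist Γ (starSet Γ x)

/-- The coset `a⟨x⟩`, as a subset of the cylinder `A(star(x))`. -/
def cylCoset {V : Type} (Γ : SimpleGraph V) (x : V) (a : Raag Γ) :
    Set ↥(cylGroup Γ x) :=
  {g | ∃ n : ℤ, (g : Raag Γ) = a * raagGen Γ x ^ n}

/-- The peripheral structure `𝒫_x` on the cylinder `A(star(x))`: one element for each
coset `g·A(star_{Γ'}(x))` with `Γ' ∈ C₁` containing `x`, namely the family of cosets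
`{g·h·⟨x⟩ : h ∈ A(lk_{Γ'}(x))}`. -/
def cylPeriph {V : Type} (Γ : SimpleGraph V) (x : V) :
    Set (Set (Set ↥(cylGroup Γ x))) :=
  {F | ∃ S ∈ C1 Γ, x ∈ S ∧ ∃ g : Raag Γ, g ∈ cylGroup Γ x ∧
    F = {c | ∃ h ∈ subRaag Γ (lkIn Γ S x), c = cylCoset Γ x (g * h)}}

/-- The factors `A(T) ≤ A(Γ)` and `A(T') ≤ A(Λ)` are quasi-isometric. -/
def FactorQI {V W : Type} (Γ : SimpleGraph V) (Λ : SimpleGraph W)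
    (T : Set V) (T' : Set W) : Prop :=
  ∃ φ : ↥(subRaag Γ T) → ↥(subRaag Λ T'), IsQI (subDist Γ T) (subDist Λ T') φ

/-! ### Coarse geometry of groups through finite sets -/

noncomputable section

open scoped Pointwise

/-- Two functions into a group are near if `f x * (f' x)⁻¹` takes finitely many values. -/
def Near {X G : Type*} [Group G] (f f' : X → G) : Prop :=
  ∃ E : Set G, E.Finite ∧ ∀ x, f x * (f' x)⁻¹ ∈ E

/-- Coarse maps between groups. -/
def CMap {G H : Type*} [Group G] [Group H] (f : G → H) : Prop :=
  ∀ s : G, Near (fun g => f (s * g)) f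

/-- `f` and `f'` are mutually inverse coarse equivalences. -/
structure CInv {G H : Type*} [Group G] [Group H] (f : G → H) (f' : H → G) : Prop where
  map : CMap f
  map' : CMap f'
  left : Near (fun g => f' (f g)) (fun g => g)
  right : Near (fun h => f (f' h)) (fun h => h)

/-- `f` maps `C` to within `E` of `D` and conversely. -/
def Matched {G H : Type*} [Group H] (f : G → H) (E : Set H) (C : Set G) (D : Set H) : Prop :=
  (∀ x ∈ C, ∃ y ∈ D, f x * y⁻¹ ∈ E) ∧ (∀ y ∈ D, ∃ x ∈ C, f x * y⁻¹ ∈ E)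

/-- The coarse equivalence `f` matches the families `𝒞` and `𝒟`. -/
def MatchesFam {G H : Type*} [Group H] (f : G → H) (𝒞 : Set (Set G)) (𝒟 : Set (Set H)) : Prop :=
  ∃ E : Set H, E.Finite ∧ (∀ C ∈ 𝒞, ∃ D ∈ 𝒟, Matched f E C D) ∧
    (∀ D ∈ 𝒟, ∃ C ∈ 𝒞, Matched f E C D)

/-- Coarse equivalence of pairs (group, family of subsets). -/
def PairEq {G H : Type*} [Group G] [Group H] (𝒞 : Set (Set G)) (𝒟 : Set (Set H)) : Prop :=
  ∃ (f : G → H) (f' : H → G), CInv f f' ∧ MatchesFam f 𝒞 𝒟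

section Near
variable {X Y G H : Type*} [Group G] [Group H]

theorem Near.refl (f : X → G) : Near f f := ⟨{1}, Set.finite_singleton 1, fun x => by simp⟩

theorem Near.of_eq {f f' : X → G} (h : ∀ x, f x = f' x) : Near f f' :=
  ⟨{1}, Set.finite_singleton 1, fun x => by simp [h]⟩

theorem Near.symm {f f' : X → G} (h : Near f f') : Near f' f := by
  obtain ⟨E, hE, h⟩ := h
  refine ⟨E⁻¹, hE.inv, fun x => ?_⟩
  simpa using h x

theorem Near.trans {f f' f'' : X → G} (h : Near f f') (h' : Near f' f'') : Near f f'' := by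
  obtain ⟨E, hE, h⟩ := h
  obtain ⟨E', hE', h'⟩ := h'
  refine ⟨E * E', hE.mul hE', fun x => ?_⟩
  have := Set.mul_mem_mul (h x) (h' x)
  simpa using this

theorem Near.comp {f f' : X → G} (h : Near f f') (k : Y → X) :
    Near (fun y => f (k y)) (fun y => f' (k y)) := by
  obtain ⟨E, hE, h⟩ := h
  exact ⟨E, hE, fun y => h (k y)⟩

theorem Near.mul_right {f f' : X → G} (h : Near f f') (k : X → G) :
    Near (fun x => f x * k x) (fun x => f' x * k x) := by
  obtain ⟨E, hE, h⟩ := h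
  exact ⟨E, hE, fun x => by simpa using h x⟩

/-- Left multiplication by an element varying in a finite set moves points to near points. -/
theorem Near.mul_left_finite {a f : X → G} {E : Set G} (hE : E.Finite) (h : ∀ x, a x ∈ E) :
    Near (fun x => a x * f x) f := ⟨E, hE, fun x => by simpa using h x⟩

/-- Nearness may be checked on finitely many pieces. -/
theorem Near.of_cover {ι : Type*} [Finite ι] {f f' : X → G} (p : ι → X → Prop)
    (hp : ∀ x, ∃ i, p i x)
    (h : ∀ i, Near (fun x : {x // p i x} => f x) (fun x => f' x)) : Near f f' := by
  choose E hE h using h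
  refine ⟨⋃ i, E i, Set.finite_iUnion hE, fun x => ?_⟩
  obtain ⟨i, hi⟩ := hp x
  exact Set.mem_iUnion.mpr ⟨i, h i ⟨x, hi⟩⟩

theorem CMap.near {f : G → H} (hf : CMap f) {a b : X → G} (h : Near a b) :
    Near (fun x => f (a x)) (fun x => f (b x)) := by
  obtain ⟨E, hE, h⟩ := h
  choose E' hE' h' using hf
  refine ⟨⋃ s ∈ E, E' s, hE.biUnion fun s _ => hE' s, fun x => ?_⟩
  refine Set.mem_biUnion (h x) ?_
  have := h' (a x * (b x)⁻¹) (b x)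
  simpa using this

/-- The version of `CMap.near` with explicit finite sets. -/
theorem CMap.exists_finite {f : G → H} (hf : CMap f) {E : Set G} (hE : E.Finite) :
    ∃ E' : Set H, E'.Finite ∧ ∀ g h, g * h⁻¹ ∈ E → f g * (f h)⁻¹ ∈ E' := by
  have := hf.near (X := {q : G × G // q.1 * q.2⁻¹ ∈ E}) (a := fun q => q.1.1)
    (b := fun q => q.1.2) ⟨E, hE, fun q => q.2⟩
  obtain ⟨E', hE', h⟩ := this
  exact ⟨E', hE', fun g k hgk => h ⟨(g, k), hgk⟩⟩

theorem CMap.comp {K : Type*} [Group K] {f : G → H} {k : H → K} (hk : CMap k) (hf : CMap f) :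
    CMap (fun g => k (f g)) := fun s => hk.near (hf s)

theorem CMap.id : CMap (fun g : G => g) := fun s =>
  Near.mul_left_finite (Set.finite_singleton s) (fun _ => rfl)

/-- Coarseness only has to be checked on a generating set. -/
theorem CMap.of_closure {f : G → H} {S : Set G} (hS : Subgroup.closure S = ⊤)
    (h : ∀ s ∈ S, Near (fun g => f (s * g)) f) : CMap f := by
  intro s
  have hs : s ∈ Subgroup.closure S := by rw [hS]; trivial
  induction hs using Subgroup.closure_induction with
  | mem x hx => exact h x hx
  | one => exact Near.of_eq (by simp)
  | mul x y _ _ hx hy =>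
    refine Near.trans ?_ hy
    refine Near.trans (Near.of_eq fun g => ?_) (hx.comp fun g => y * g)
    simp [mul_assoc]
  | inv x _ hx =>
    refine (Near.trans (Near.of_eq fun g => ?_) (hx.comp fun g => x⁻¹ * g)).symm
    simp

theorem CMap.of_hom (f : G →* H) : CMap f := fun s =>
  ⟨{f s}, Set.finite_singleton _, fun g => by simp⟩

theorem CInv.symm {f : G → H} {f' : H → G} (h : CInv f f') : CInv f' f :=
  ⟨h.map', h.map, h.right, h.left⟩

theorem CInv.trans {K : Type*} [Group K] {f : G → H} {f' : H → G} {k : H → K} {k' : K → H}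
    (h : CInv f f') (hk : CInv k k') : CInv (fun g => k (f g)) (fun x => f' (k' x)) :=
  ⟨hk.map.comp h.map, h.map'.comp hk.map',
    (h.map'.near (hk.left.comp f)).trans h.left,
    (hk.map.near (h.right.comp k')).trans hk.right⟩

theorem CInv.of_mulEquiv (e : G ≃* H) : CInv e e.symm :=
  ⟨CMap.of_hom e.toMonoidHom, CMap.of_hom e.symm.toMonoidHom,
    Near.of_eq (by simp), Near.of_eq (by simp)⟩

theorem CInv.id : CInv (fun g : G => g) (fun g : G => g) :=
  ⟨CMap.id, CMap.id, Near.refl _, Near.refl _⟩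

/-- A coarse equivalence reflects nearness. -/
theorem CInv.reflect {f : G → H} {f' : H → G} (h : CInv f f') {a b : X → G}
    (hab : Near (fun x => f (a x)) (fun x => f (b x))) : Near a b :=
  ((h.left.comp a).symm.trans (h.map'.near hab)).trans (h.left.comp b)

theorem Matched.mono {G : Type*} {f : G → H} {E E' : Set H} {C : Set G} {D : Set H} (hE : E ⊆ E')
    (h : Matched f E C D) : Matched f E' C D :=
  ⟨fun x hx => let ⟨y, hy, h⟩ := h.1 x hx; ⟨y, hy, hE h⟩,
    fun x hx => let ⟨y, hy, h⟩ := h.2 x hx; ⟨y, hy, hE h⟩⟩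

theorem CInv.exists_matched_symm {f : G → H} {f' : H → G} (h : CInv f f') {E : Set H}
    (hE : E.Finite) : ∃ E' : Set G, E'.Finite ∧
      ∀ C D, Matched f E C D → Matched f' E' D C := by
  obtain ⟨E₁, hE₁, h₁⟩ := h.map'.exists_finite hE
  obtain ⟨E₂, hE₂, h₂⟩ := h.left
  have key : ∀ x y, f x * y⁻¹ ∈ E → f' y * x⁻¹ ∈ E₁⁻¹ * E₂ := by
    intro x y hxy
    refine ⟨_, Set.inv_mem_inv.mpr (h₁ _ _ hxy), _, h₂ x, ?_⟩
    simp
  refine ⟨E₁⁻¹ * E₂, hE₁.inv.mul hE₂, fun C D hCD => ⟨fun y hy => ?_, fun x hx => ?_⟩⟩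
  · obtain ⟨x, hx, hxy⟩ := hCD.2 y hy
    exact ⟨x, hx, key x y hxy⟩
  · obtain ⟨y, hy, hxy⟩ := hCD.1 x hx
    exact ⟨y, hy, key x y hxy⟩

theorem CMap.exists_matched_trans {K : Type*} [Group K] {f : G → H} {k : H → K} (hk : CMap k)
    {E : Set H} (hE : E.Finite) {E' : Set K} (hE' : E'.Finite) : ∃ E'' : Set K, E''.Finite ∧
      ∀ C D D', Matched f E C D → Matched k E' D D' → Matched (fun x => k (f x)) E'' C D' := by
  obtain ⟨E₁, hE₁, h₁⟩ := hk.exists_finite hE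
  have key : ∀ x y z, f x * y⁻¹ ∈ E → k y * z⁻¹ ∈ E' → k (f x) * z⁻¹ ∈ E₁ * E' := by
    intro x y z hxy hyz
    refine ⟨_, h₁ _ _ hxy, _, hyz, ?_⟩
    simp
  refine ⟨E₁ * E', hE₁.mul hE', fun C D D' h h' => ⟨fun x hx => ?_, fun z hz => ?_⟩⟩
  · obtain ⟨y, hy, hxy⟩ := h.1 x hx
    obtain ⟨z, hz, hyz⟩ := h'.1 y hy
    exact ⟨z, hz, key _ _ _ hxy hyz⟩
  · obtain ⟨y, hy, hyz⟩ := h'.2 z hz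
    obtain ⟨x, hx, hxy⟩ := h.2 y hy
    exact ⟨x, hx, key _ _ _ hxy hyz⟩

theorem MatchesFam.symm {f : G → H} {f' : H → G} (h : CInv f f') {𝒞 : Set (Set G)}
    {𝒟 : Set (Set H)} (hm : MatchesFam f 𝒞 𝒟) : MatchesFam f' 𝒟 𝒞 := by
  obtain ⟨E, hE, h1, h2⟩ := hm
  obtain ⟨E', hE', h'⟩ := h.exists_matched_symm hE
  refine ⟨E', hE', fun D hD => ?_, fun C hC => ?_⟩
  · obtain ⟨C, hC, hm⟩ := h2 D hD
    exact ⟨C, hC, h' _ _ hm⟩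
  · obtain ⟨C, hC, hm⟩ := h1 C hC
    exact ⟨C, hC, h' _ _ hm⟩

theorem PairEq.symm {𝒞 : Set (Set G)} {𝒟 : Set (Set H)} (h : PairEq 𝒞 𝒟) : PairEq 𝒟 𝒞 := by
  obtain ⟨f, f', hf, hm⟩ := h
  exact ⟨f', f, hf.symm, hm.symm hf⟩

theorem PairEq.trans {K : Type*} [Group K] {𝒞 : Set (Set G)} {𝒟 : Set (Set H)}
    {ℰ : Set (Set K)} (h : PairEq 𝒞 𝒟) (h' : PairEq 𝒟 ℰ) : PairEq 𝒞 ℰ := by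
  obtain ⟨f, f', hf, E, hE, h1, h2⟩ := h
  obtain ⟨k, k', hk, E', hE', h1', h2'⟩ := h'
  obtain ⟨E'', hE'', hm⟩ := hk.map.exists_matched_trans (f := f) hE hE'
  refine ⟨_, _, hf.trans hk, E'', hE'', fun C hC => ?_, fun D' hD' => ?_⟩
  · obtain ⟨D, hD, hCD⟩ := h1 C hC
    obtain ⟨D', hD', hDD⟩ := h1' D hD
    exact ⟨D', hD', hm _ _ _ hCD hDD⟩
  · obtain ⟨D, hD, hDD⟩ := h2' D' hD'
    obtain ⟨C, hC, hCD⟩ := h2 D hD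
    exact ⟨C, hC, hm _ _ _ hCD hDD⟩

end Near

end

/-! ### Matching slots of binary trees -/

noncomputable section

/-- Words `leafCode f 0, …, leafCode f (f - 1)` forming a complete suffix code. -/
def leafCode : ℕ → ℕ → List Bool
  | 0, _ => []
  | 1, _ => []
  | _ + 2, 0 => [false]
  | f + 2, i + 1 => leafCode (f + 1) i ++ [true]

theorem leafCode_length_le (f i : ℕ) : (leafCode f i).length ≤ f := by
  induction f, i using leafCode.induct with
  | case1 => simp [leafCode]
  | case2 => simp [leafCode]
  | case3 => simp [leafCode]
  | case4 f i ih => simp only [leafCode, List.length_append, List.length_singleton]; omega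

theorem exists_leafCode {k : ℕ} (hk : 0 < k) (l : List Bool) (hl : k ≤ l.length) :
    ∃ i < k, ∃ b, l = b ++ leafCode k i := by
  obtain ⟨f, rfl⟩ := Nat.exists_eq_succ_of_ne_zero hk.ne'
  replace hl : f ≤ l.length := by omega
  clear hk
  induction f generalizing l with
  | zero => exact ⟨0, by simp, l, by simp [leafCode]⟩
  | succ f ih =>
    rcases List.eq_nil_or_concat l with rfl | ⟨l, c, rfl⟩
    · simp at hl
    · cases c with
      | false => exact ⟨0, by simp, l, by simp [leafCode]⟩
      | true =>
        obtain ⟨i, hi, b, rfl⟩ := ih l (by simpa using hl)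
        exact ⟨i + 1, by omega, b, by simp [leafCode]⟩

theorem leafCode_unique {k i i' : ℕ} (b b' : List Bool) (hi : i < k) (hi' : i' < k)
    (h : b ++ leafCode k i = b' ++ leafCode k i') : i = i' ∧ b = b' := by
  obtain ⟨f, rfl⟩ := Nat.exists_eq_succ_of_ne_zero (Nat.ne_zero_of_lt hi)
  induction f generalizing i i' with
  | zero =>
    obtain rfl : i = 0 := by omega
    obtain rfl : i' = 0 := by omega
    simpa [leafCode] using h
  | succ f ih =>
    cases i with
    | zero =>
      cases i' with
      | zero => simpa [leafCode] using h
      | succ i' =>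
        simp only [leafCode, ← List.append_assoc] at h
        have := (List.append_inj' h rfl).2
        simp at this
    | succ i =>
      cases i' with
      | zero =>
        simp only [leafCode, ← List.append_assoc] at h
        have := (List.append_inj' h rfl).2
        simp at this
      | succ i' =>
        simp only [leafCode, ← List.append_assoc] at h
        have := ih (i := i) (i' := i') (by omega) (by omega) (List.append_inj' h rfl).1
        exact ⟨by omega, this.2⟩

/-- The words `cd x`, for `x` in a fibre of `ψ`, form a complete suffix code of bounded length:
in this way `X × List Bool` is identified with `N × List Bool` up to a bounded amount. -/
structure Coding {X N : Type*} (ψ : X → N) (cd : X → List Bool) (M : ℕ) : Prop where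
  length_le : ∀ x, (cd x).length ≤ M
  parse : ∀ n l, M ≤ l.length → ∃ x b, ψ x = n ∧ l = b ++ cd x
  unique : ∀ x y b b', ψ x = ψ y → b ++ cd x = b' ++ cd y → x = y ∧ b = b'

theorem exists_coding {X N : Type*} (ψ : X → N) (hψ : Function.Surjective ψ) (M : ℕ)
    (hfin : ∀ n, Finite {x // ψ x = n}) (hcard : ∀ n, Nat.card {x // ψ x = n} ≤ M) :
    ∃ cd, Coding ψ cd M := by
  let e : ∀ n, {x // ψ x = n} ≃ Fin (Nat.card {x // ψ x = n}) := fun n => Finite.equivFin _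
  let cd : X → List Bool := fun x => leafCode (Nat.card {y // ψ y = ψ x}) (e (ψ x) ⟨x, rfl⟩)
  have hcd : ∀ n (x : {x // ψ x = n}), cd x = leafCode (Nat.card {y // ψ y = n}) (e n x) := by
    rintro n ⟨x, rfl⟩
    rfl
  have hpos : ∀ n, 0 < Nat.card {x // ψ x = n} := by
    intro n
    obtain ⟨x, hx⟩ := hψ n
    have : Nonempty {x // ψ x = n} := ⟨⟨x, hx⟩⟩
    exact Nat.card_pos
  refine ⟨cd, ⟨fun x => (leafCode_length_le _ _).trans (hcard _), fun n l hl => ?_, ?_⟩⟩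
  · obtain ⟨i, hi, b, hb⟩ := exists_leafCode (hpos n) l ((hcard n).trans hl)
    refine ⟨(e n).symm ⟨i, hi⟩, b, ((e n).symm ⟨i, hi⟩).2, ?_⟩
    rw [hcd, Equiv.apply_symm_apply, hb]
  · intro x y b b' hxy h
    have h1 := hcd (ψ y) ⟨x, hxy⟩
    have h2 := hcd (ψ y) ⟨y, rfl⟩
    simp only at h1 h2
    rw [h1, h2] at h
    obtain ⟨hi, hb⟩ := leafCode_unique _ _ (e (ψ y) ⟨x, hxy⟩).2 (e (ψ y) ⟨y, rfl⟩).2 h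
    have := (e (ψ y)).injective (Fin.ext hi)
    exact ⟨congrArg Subtype.val this, hb⟩

/-- Two words agree up to changing at most `C` letters at the head. -/
def TreeNear (C : ℕ) (p q : List Bool) : Prop :=
  ∃ u u' c, p = u ++ c ∧ q = u' ++ c ∧ u.length ≤ C ∧ u'.length ≤ C

theorem TreeNear.symm {C : ℕ} {p q : List Bool} (h : TreeNear C p q) : TreeNear C q p := by
  obtain ⟨u, u', c, h1, h2, h3, h4⟩ := h
  exact ⟨u', u, c, h2, h1, h4, h3⟩

theorem TreeNear.of_append {C : ℕ} (u l : List Bool) (h : u.length ≤ C) :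
    TreeNear C (u ++ l) l := ⟨u, [], l, rfl, rfl, h, by simp⟩

theorem TreeNear.trans {C C' : ℕ} {p q r : List Bool} (h : TreeNear C p q)
    (h' : TreeNear C' q r) : TreeNear (C + C') p r := by
  obtain ⟨u, u', c, rfl, rfl, h3, h4⟩ := h
  obtain ⟨v, v', d, h5, rfl, h7, h8⟩ := h'
  rcases List.append_eq_append_iff.mp h5 with ⟨a, rfl, rfl⟩ | ⟨a, rfl, rfl⟩
  · refine ⟨u ++ a, v', d, by simp, rfl, ?_, by omega⟩
    simp only [List.length_append] at *; omega
  · refine ⟨u, v' ++ a, c, rfl, by simp, by omega, ?_⟩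
    simp only [List.length_append] at *; omega

/-- A valid slot: a position `(x, b)` and a label different from the one at the position. -/
abbrev Slots (X J : Type) (e : X → List Bool → Option J) : Type :=
  {s : X × List Bool × J // some s.2.2 ≠ e s.1 s.2.1}

theorem exists_slot_equiv_pool {X N J I : Type} [Finite J] {ψ : X → N} {cd : X → List Bool}
    {M : ℕ} (hc : Coding ψ cd M) (t : J → I) {T : Set I} (hT : Set.range t = T)
    (e : X → List Bool → Option J) (ν : Option J → J)
    (hν : ∀ o, some (ν o) ≠ o) (he : ∀ x c b, e x (c :: b) = some (ν (e x b))) :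
    ∃ (C : ℕ) (h : Slots X J e ≃ N × List Bool × T), ∀ s,
      ψ s.1.1 = (h s).1 ∧ TreeNear C (s.1.2.1 ++ cd s.1.1) (h s).2.1 ∧
        t s.1.2.2 = (h s).2.2.1 := by
  classical
  subst hT
  have : Fintype J := Fintype.ofFinite J
  let w : J → List Bool := fun j => (Finset.univ : Finset J).toList.map fun k => decide (k = j)
  have wlen : ∀ j, (w j).length = Fintype.card J := by simp [w]
  have winj : Function.Injective w := by
    intro j j' h
    have := List.map_inj_left.mp h j (by simp)
    simpa using this.symm
  have hjr : ∀ τ : Set.range t, ∃ j, t j = τ.1 := fun τ => τ.2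
  choose jr hjr using hjr
  have hparse : ∀ y : N × List Bool × Set.range t, ∃ (x : X) (b : List Bool),
      ψ x = y.1 ∧ List.replicate M false ++ y.2.1 = b ++ cd x :=
    fun y => hc.parse _ _ (by simp)
  choose px pb hpx hpb using hparse
  let wd : N × List Bool × Set.range t → List Bool := fun y =>
    if some (jr y.2.2) ≠ some (ν (e (px y) (pb y))) then [false] else [true, false]
  have hwd : ∀ y, some (jr y.2.2) ≠ e (px y) (wd y ++ pb y) := by
    intro y
    by_cases h : some (jr y.2.2) ≠ some (ν (e (px y) (pb y)))
    · simp only [wd, if_pos h, List.cons_append, List.nil_append, he]; exact h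
    · have h' : some (jr y.2.2) = some (ν (e (px y) (pb y))) := not_not.mp h
      simp only [wd, h, if_false, List.cons_append, List.nil_append, he]
      rw [← h']
      exact fun hh => hν _ hh.symm
  let fw : Slots X J e → N × List Bool × Set.range t := fun s =>
    (ψ s.1.1, w s.1.2.2 ++ (s.1.2.1 ++ cd s.1.1), ⟨t s.1.2.2, _, rfl⟩)
  let bw : N × List Bool × Set.range t → Slots X J e := fun y =>
    ⟨(px y, wd y ++ pb y, jr y.2.2), hwd y⟩
  have hfw : Function.Injective fw := by
    rintro ⟨⟨x, b, j⟩, h⟩ ⟨⟨x', b', j'⟩, h'⟩ heq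
    simp only [fw, Prod.mk.injEq] at heq
    obtain ⟨h1, h2, -⟩ := heq
    obtain ⟨h3, h4⟩ := List.append_inj h2 (by simp [wlen])
    obtain ⟨rfl, rfl⟩ := hc.unique _ _ _ _ h1 h4
    obtain rfl := winj h3
    rfl
  have hbw : Function.Injective bw := by
    intro y y' heq
    simp only [bw, Subtype.mk.injEq, Prod.mk.injEq] at heq
    obtain ⟨h1, h2, h3⟩ := heq
    have h4 : pb y = pb y' := by
      simp only [wd] at h2
      split_ifs at h2 <;> simp_all
    have h5 : y.2.1 = y'.2.1 := by
      have := (hpb y).trans ((congrArg₂ (fun b x => b ++ cd x) h4 h1).trans (hpb y').symm)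
      simpa using this
    have h6 : y.1 = y'.1 := by rw [← hpx, ← hpx, h1]
    have h7 : y.2.2 = y'.2.2 := Subtype.ext (by rw [← hjr, ← hjr, h3])
    exact Prod.ext h6 (Prod.ext h5 h7)
  let C := Fintype.card J + M + 2
  have hnear : ∀ y, TreeNear C ((wd y ++ pb y) ++ cd (px y)) y.2.1 := by
    intro y
    rw [List.append_assoc, ← hpb y, ← List.append_assoc]
    refine TreeNear.of_append _ _ ?_
    have : (wd y).length ≤ 2 := by
      simp only [wd]; split_ifs <;> simp
    simp only [List.length_append, List.length_replicate, C]; omega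
  obtain ⟨h, hb, hR⟩ := Function.Embedding.schroeder_bernstein_of_rel hfw hbw
    (fun s y => ψ s.1.1 = y.1 ∧ TreeNear C (s.1.2.1 ++ cd s.1.1) y.2.1 ∧ t s.1.2.2 = y.2.2.1)
    (fun s => ⟨rfl, (TreeNear.of_append _ _ (by rw [wlen]; omega)).symm, rfl⟩)
    (fun y => ⟨hpx y, hnear y, hjr _⟩)
  exact ⟨C, Equiv.ofBijective h hb, hR⟩

theorem exists_slot_equiv {X X' N J J' I : Type} [Finite J] [Finite J'] {ψ : X → N} {ψ' : X' → N}
    {cd : X → List Bool} {cd' : X' → List Bool} {M M' : ℕ} (hc : Coding ψ cd M)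
    (hc' : Coding ψ' cd' M') (t : J → I) (t' : J' → I) (htt : Set.range t = Set.range t')
    (e : X → List Bool → Option J) (ν : Option J → J)
    (hν : ∀ o, some (ν o) ≠ o) (he : ∀ x c b, e x (c :: b) = some (ν (e x b)))
    (e' : X' → List Bool → Option J') (ν' : Option J' → J')
    (hν' : ∀ o, some (ν' o) ≠ o) (he' : ∀ x c b, e' x (c :: b) = some (ν' (e' x b))) :
    ∃ (C : ℕ) (h : Slots X J e ≃ Slots X' J' e'), ∀ s, ψ s.1.1 = ψ' (h s).1.1 ∧
      TreeNear C (s.1.2.1 ++ cd s.1.1) ((h s).1.2.1 ++ cd' (h s).1.1) ∧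
      t s.1.2.2 = t' (h s).1.2.2 := by
  obtain ⟨C, h, hh⟩ := exists_slot_equiv_pool hc t rfl e ν hν he
  obtain ⟨C', h', hh'⟩ := exists_slot_equiv_pool hc' t' htt.symm e' ν' hν' he'
  refine ⟨C + C', h.trans h'.symm, fun s => ?_⟩
  obtain ⟨h1, h2, h3⟩ := hh s
  obtain ⟨k1, k2, k3⟩ := hh' (h'.symm (h s))
  rw [Equiv.apply_symm_apply] at k1 k2 k3
  exact ⟨h1.trans k1.symm, h2.trans k2.symm, h3.trans k3.symm⟩

end

/-! ### Reduced words in free products -/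

noncomputable section

open Monoid

section FreeProduct
variable {J : Type} {P : J → Type} [∀ j, Group (P j)]

/-- Reduced words. -/
def Red (w : List (Σ j, P j)) : Prop :=
  (∀ l ∈ w, l.2 ≠ 1) ∧ w.IsChain fun l l' => l.1 ≠ l'.1

/-- The label of the first letter. -/
def headLab (w : List (Σ j, P j)) : Option J := w.head?.map Sigma.fst

/-- The product of a word. -/
def wprod (w : List (Σ j, P j)) : CoprodI P := (w.map fun l => CoprodI.of l.2).prod

@[simp] theorem wprod_nil : wprod ([] : List (Σ j, P j)) = 1 := rfl

@[simp] theorem wprod_cons (l : Σ j, P j) (w : List (Σ j, P j)) :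
    wprod (l :: w) = CoprodI.of l.2 * wprod w := by simp [wprod]

@[simp] theorem wprod_append (w w' : List (Σ j, P j)) :
    wprod (w ++ w') = wprod w * wprod w' := by simp [wprod]

theorem Red.nil : Red ([] : List (Σ j, P j)) := ⟨by simp, by simp⟩

theorem red_cons {l : Σ j, P j} {w : List (Σ j, P j)} :
    Red (l :: w) ↔ l.2 ≠ 1 ∧ headLab w ≠ some l.1 ∧ Red w := by
  unfold Red headLab
  rw [List.isChain_cons]
  constructor
  · rintro ⟨h1, h2, h3⟩
    refine ⟨h1 l (by simp), fun h => ?_, fun k hk => h1 k (by simp [hk]), h3⟩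
    obtain ⟨k, hk, hkl⟩ := Option.map_eq_some_iff.mp h
    exact h2 k hk hkl.symm
  · rintro ⟨h1, h2, h3, h4⟩
    refine ⟨fun k hk => ?_, fun k hk hkl => h2 ?_, h4⟩
    · rcases List.mem_cons.mp hk with rfl | hk
      · exact h1
      · exact h3 k hk
    · rw [Option.map_eq_some_iff]
      exact ⟨k, hk, hkl.symm⟩

open Classical in
/-- The reduced word representing an element. -/
def gword (g : CoprodI P) : List (Σ j, P j) := (CoprodI.Word.equiv g).toList

open Classical in
@[simp] theorem wprod_gword (g : CoprodI P) : wprod (gword g) = g :=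
  CoprodI.Word.equiv.symm_apply_apply g

open Classical in
theorem red_gword (g : CoprodI P) : Red (gword g) :=
  ⟨(CoprodI.Word.equiv g).ne_one, (CoprodI.Word.equiv g).chain_ne⟩

open Classical in
theorem gword_wprod {w : List (Σ j, P j)} (h : Red w) : gword (wprod w) = w :=
  congrArg CoprodI.Word.toList
    (CoprodI.Word.equiv.apply_symm_apply (⟨w, h.1, h.2⟩ : CoprodI.Word P))

/-- Every element is `p * g₀` where the reduced word of `g₀` does not start with label `j`. -/
theorem exists_tail (j : J) (g : CoprodI P) : ∃ (p : P j) (w : List (Σ j, P j)),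
    Red w ∧ headLab w ≠ some j ∧ g = CoprodI.of p * wprod w := by
  classical
  rw [← wprod_gword g]
  have hr := red_gword g
  generalize gword g = w at hr
  cases w with
  | nil => exact ⟨1, [], Red.nil, by simp [headLab], by simp⟩
  | cons l w =>
    obtain ⟨h1, h2, h3⟩ := red_cons.mp hr
    obtain ⟨i, p⟩ := l
    by_cases hij : i = j
    · subst hij
      exact ⟨p, w, h3, h2, by simp⟩
    · exact ⟨1, _, hr, by simpa [headLab] using hij, by simp⟩

theorem coprodI_closure : Subgroup.closure (⋃ j, Set.range (CoprodI.of : P j →* CoprodI P)) = ⊤ := by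
  rw [eq_top_iff]
  intro g _
  induction g using CoprodI.induction_on with
  | one => exact one_mem _
  | of i m => exact Subgroup.subset_closure (Set.mem_iUnion.mpr ⟨i, m, rfl⟩)
  | mul x y hx hy => exact mul_mem (hx trivial) (hy trivial)

end FreeProduct

end

/-! ### Transporting reduced words along a pairing of slots -/

noncomputable section

open Monoid

/-- Choices of a next label and of two special elements of each factor. -/
structure Special {J : Type} (P : J → Type) [∀ j, Group (P j)] where
  nu : Option J → J
  nu_ne : ∀ o, some (nu o) ≠ o
  sp : ∀ j, Bool → P j
  sp_inj : ∀ j, Function.Injective (sp j)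
  sp_ne : ∀ j c, sp j c ≠ 1

/-- A letter, or the root. -/
abbrev Syl {J : Type} (P : J → Type) : Type := Option (Σ j, P j)

/-- A kind of piece: the root, or the label of a piece together with the label of its
entry point. -/
abbrev Kind (J : Type) : Type := Option (Option J × J)

/-- A slot: a letter, a path of special letters, and a label. -/
abbrev Slot {J : Type} (P : J → Type) : Type := Syl P × List Bool × J

/-- Compatible kinds. -/
def Compat {J J' I : Type} (t : J → I) (t' : J' → I) : Kind J → Kind J' → Prop
  | none, none => True
  | some a, some a' => t a.2 = t' a'.2
  | _, _ => False

theorem Compat.symm {J J' I : Type} {t : J → I} {t' : J' → I} {κ : Kind J} {κ' : Kind J'}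
    (h : Compat t t' κ κ') : Compat t' t κ' κ := by
  cases κ <;> cases κ' <;> simp_all [Compat]

/-- The label of the entry point of a kind. -/
def Kind.entry {J : Type} : Kind J → Option J
  | none => none
  | some a => a.1

/-- The label of a piece differs from the label of its entry point. -/
def Kind.Ok {J : Type} : Kind J → Prop
  | none => True
  | some a => some a.2 ≠ a.1

theorem sigma_eq_of_fst_eq {J : Type} {P : J → Type} {l : Σ j, P j} {k : J} (h : l.1 = k)
    (f : ∀ j, P j) (hf : l.2 = f l.1) : l = ⟨k, f k⟩ := by
  obtain ⟨j, p⟩ := l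
  subst h
  exact congrArg _ hf

theorem eq_of_sigma_eq {J : Type} {P : J → Type} {j k : J} {p : P j} {q : P k}
    (h : (⟨j, p⟩ : Σ j, P j) = ⟨k, q⟩) (f : ∀ j, P j) (hf : q = f k) : p = f j := by
  obtain rfl := congrArg Sigma.fst h
  simpa [hf] using h

namespace Special

section
variable {J : Type} {P : J → Type} [∀ j, Group (P j)] (s : Special P)

/-- The label at the end of a path. -/
def endl (x : Syl P) : List Bool → Option J
  | [] => x.map Sigma.fst
  | _ :: b => some (s.nu (endl x b))

/-- The word spelled by a path. -/
def lst (x : Syl P) : List Bool → List (Σ j, P j)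
  | [] => x.toList
  | c :: b => ⟨s.nu (s.endl x b), s.sp _ c⟩ :: lst x b

/-- The value of a path. -/
def val (x : Syl P) (b : List Bool) : CoprodI P := wprod (s.lst x b)

/-- The value of the position of a slot. -/
def posVal (σ : Slot P) : CoprodI P := s.val σ.1 σ.2.1

/-- The letters that may start a path in a piece of the given kind. -/
def pool : Kind J → Set (Syl P)
  | none => {none}
  | some a => {x | ∃ p : P a.2, x = some ⟨a.2, p⟩ ∧ p ≠ 1 ∧
      ¬ (a.2 = s.nu a.1 ∧ ∃ c, p = s.sp a.2 c)}

/-- Valid slots in a piece of the given kind. -/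
def Valid (κ : Kind J) (σ : Slot P) : Prop :=
  σ.1 ∈ s.pool κ ∧ some σ.2.2 ≠ s.endl σ.1 σ.2.1

theorem red_lst {κ : Kind J} {x : Syl P} {w : List (Σ j, P j)} (hx : x ∈ s.pool κ) (hκ : κ.Ok)
    (hw : Red w) (hwκ : headLab w = κ.entry) (b : List Bool) :
    Red (s.lst x b ++ w) ∧ headLab (s.lst x b ++ w) = s.endl x b := by
  induction b with
  | nil =>
    cases κ with
    | none =>
      obtain rfl : x = none := hx
      exact ⟨hw, hwκ⟩
    | some a =>
      obtain ⟨p, rfl, hp, -⟩ := hx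
      refine ⟨red_cons.mpr ⟨hp, ?_, hw⟩, rfl⟩
      change headLab w ≠ _
      rw [hwκ]
      exact fun h => hκ h.symm
  | cons c b ih =>
    refine ⟨red_cons.mpr ⟨s.sp_ne _ _, ?_, ih.1⟩, rfl⟩
    change headLab (s.lst x b ++ w) ≠ _
    rw [ih.2]
    exact fun h => s.nu_ne _ h.symm

end

end Special

/-- The properties of one half of a pairing of slots. -/
structure HalfPairing {J J' I : Type} {P : J → Type} {Q : J' → Type} [∀ j, Group (P j)]
    [∀ j, Group (Q j)] (s : Special P) (s' : Special Q) (t : J → I) (t' : J' → I)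
    (β : Kind J → Kind J' → Slot P → Slot Q) : Prop where
  valid : ∀ κ κ' σ, Compat t t' κ κ' → s.Valid κ σ → s'.Valid κ' (β κ κ' σ)
  type_eq : ∀ κ κ' σ, Compat t t' κ κ' → s.Valid κ σ → t σ.2.2 = t' (β κ κ' σ).2.2
  near_step : ∃ E : Set (CoprodI Q), E.Finite ∧ ∀ κ κ' x b b₂ j k, Compat t t' κ κ' →
    s.Valid κ (x, b, j) → s.Valid κ (x, b₂, k) → (b₂ = b ∨ ∃ c, b₂ = c :: b) →
    s'.posVal (β κ κ' (x, b₂, k)) * (s'.posVal (β κ κ' (x, b, j)))⁻¹ ∈ E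
  near_root : ∃ E : Set (CoprodI Q), E.Finite ∧ ∀ κ κ' x j, Compat t t' κ κ' →
    s.Valid κ (x, [], j) →
    s'.posVal (β κ κ' (x, [], j)) * (s'.val (β κ κ' (x, [], j)).1 [])⁻¹ ∈ E
  near_mul : ∀ j (r : P j), ∃ E : Set (CoprodI Q), E.Finite ∧ ∀ e κ' p k k₂,
    Compat t t' (some (e, j)) κ' → s.Valid (some (e, j)) (some ⟨j, p⟩, [], k) →
    s.Valid (some (e, j)) (some ⟨j, r * p⟩, [], k₂) →
    s'.posVal (β (some (e, j)) κ' (some ⟨j, r * p⟩, [], k₂)) *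
      (s'.posVal (β (some (e, j)) κ' (some ⟨j, p⟩, [], k)))⁻¹ ∈ E

/-- A pairing of the slots of two free products. -/
structure Pairing {J J' I : Type} {P : J → Type} {Q : J' → Type} [∀ j, Group (P j)]
    [∀ j, Group (Q j)] (s : Special P) (s' : Special Q) (t : J → I) (t' : J' → I) where
  β : Kind J → Kind J' → Slot P → Slot Q
  β' : Kind J' → Kind J → Slot Q → Slot P
  half : HalfPairing s s' t t' β
  half' : HalfPairing s' s t' t β'
  inv : ∀ κ κ' σ, Compat t t' κ κ' → s.Valid κ σ → β' κ' κ (β κ κ' σ) = σ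
  inv' : ∀ κ κ' σ, Compat t t' κ κ' → s'.Valid κ' σ → β κ κ' (β' κ' κ σ) = σ

namespace Pairing

section
variable {J J' I : Type} {P : J → Type} {Q : J' → Type} [∀ j, Group (P j)]
  [∀ j, Group (Q j)] {s : Special P} {s' : Special Q} {t : J → I} {t' : J' → I}

/-- The reversed pairing. -/
def symm (pr : Pairing s s' t t') : Pairing s' s t' t :=
  ⟨pr.β', pr.β, pr.half', pr.half, fun _ _ _ h hv => pr.inv' _ _ _ h.symm hv,
    fun _ _ _ h hv => pr.inv _ _ _ h.symm hv⟩

end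

end Pairing

/-- The state reached after reading a word: the words leading to the current piece on both
sides, the kinds of the piece on both sides, and the current position in the piece. -/
structure PState {J J' : Type} (P : J → Type) (Q : J' → Type) where
  src : List (Σ j, P j)
  tgt : List (Σ j, Q j)
  kind : Kind J
  kind' : Kind J'
  pos : Syl P
  path : List Bool

namespace Pairing

section
variable {J J' I : Type} {P : J → Type} {Q : J' → Type} [∀ j, Group (P j)]
  [∀ j, Group (Q j)] {s : Special P} {s' : Special Q} {t : J → I} {t' : J' → I}
  (pr : Pairing s s' t t')

/-- The word of the target position matched with the current position, seen from slot `j`. -/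
def outAt (S : PState P Q) (j : J) : List (Σ j, Q j) :=
  s'.lst (pr.β S.kind S.kind' (S.pos, S.path, j)).1
    (pr.β S.kind S.kind' (S.pos, S.path, j)).2.1 ++ S.tgt

/-- The label at the current position. -/
def curLab (_pr : Pairing s s' t t') (S : PState P Q) : Option J := s.endl S.pos S.path

/-- The output word of a state. -/
def out (S : PState P Q) : List (Σ j, Q j) := pr.outAt S (s.nu (pr.curLab S))

open Classical in
/-- Reading one letter. -/
def step (S : PState P Q) (l : Σ j, P j) : PState P Q :=
  if h : ∃ c, l = ⟨s.nu (pr.curLab S), s.sp _ c⟩ then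
    { S with path := h.choose :: S.path }
  else
    { src := s.lst S.pos S.path ++ S.src
      tgt := pr.outAt S l.1
      kind := some (pr.curLab S, l.1)
      kind' := some (s'.endl (pr.β S.kind S.kind' (S.pos, S.path, l.1)).1
        (pr.β S.kind S.kind' (S.pos, S.path, l.1)).2.1,
        (pr.β S.kind S.kind' (S.pos, S.path, l.1)).2.2)
      pos := some l
      path := [] }

/-- Reading a word, starting from its last letter. -/
def st : List (Σ j, P j) → PState P Q
  | [] => ⟨[], [], none, none, none, []⟩
  | l :: w => pr.step (st w) l

theorem step_special (S : PState P Q) (c : Bool) :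
    pr.step S ⟨s.nu (pr.curLab S), s.sp _ c⟩ = { S with path := c :: S.path } := by
  have h : ∃ c', (⟨s.nu (pr.curLab S), s.sp _ c⟩ : Σ j, P j) =
      ⟨s.nu (pr.curLab S), s.sp _ c'⟩ := ⟨c, rfl⟩
  rw [step, dif_pos h]
  have h2 := h.choose_spec
  have h3 : s.sp (s.nu (pr.curLab S)) c = s.sp _ h.choose := by
    simpa using h2
  rw [← s.sp_inj _ h3]

theorem step_enter (S : PState P Q) (l : Σ j, P j)
    (h : ¬ ∃ c, l = ⟨s.nu (pr.curLab S), s.sp _ c⟩) :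
    pr.step S l =
    { src := s.lst S.pos S.path ++ S.src
      tgt := pr.outAt S l.1
      kind := some (pr.curLab S, l.1)
      kind' := some (s'.endl (pr.β S.kind S.kind' (S.pos, S.path, l.1)).1
        (pr.β S.kind S.kind' (S.pos, S.path, l.1)).2.1,
        (pr.β S.kind S.kind' (S.pos, S.path, l.1)).2.2)
      pos := some l
      path := [] } := by
  rw [step, dif_neg h]

/-- The invariants of the states reached by reading reduced words. -/
structure Inv (_pr : Pairing s s' t t') (S : PState P Q) : Prop where
  compat : Compat t t' S.kind S.kind'
  mem : S.pos ∈ s.pool S.kind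
  ok : S.kind.Ok
  ok' : S.kind'.Ok
  red : Red S.src
  red' : Red S.tgt
  head : headLab S.src = S.kind.entry
  head' : headLab S.tgt = S.kind'.entry

variable {pr}

theorem Inv.valid {S : PState P Q} (h : pr.Inv S) {j : J} (hj : some j ≠ pr.curLab S) :
    s.Valid S.kind (S.pos, S.path, j) := ⟨h.mem, hj⟩

theorem Inv.valid_nu {S : PState P Q} (h : pr.Inv S) :
    s.Valid S.kind (S.pos, S.path, s.nu (pr.curLab S)) := h.valid (s.nu_ne _)

theorem Inv.red_outAt {S : PState P Q} (h : pr.Inv S) {j : J} (hj : some j ≠ pr.curLab S) :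
    Red (pr.outAt S j) :=
  (s'.red_lst (pr.half.valid _ _ _ h.compat (h.valid hj)).1 h.ok' h.red' h.head' _).1

theorem Inv.red_out {S : PState P Q} (h : pr.Inv S) : Red (pr.out S) := h.red_outAt (s.nu_ne _)

variable (pr)

theorem inv_st (w : List (Σ j, P j)) (hw : Red w) :
    pr.Inv (pr.st w) ∧ w = s.lst (pr.st w).pos (pr.st w).path ++ (pr.st w).src ∧
      headLab w = pr.curLab (pr.st w) := by
  induction w with
  | nil => exact ⟨⟨trivial, rfl, trivial, trivial, Red.nil, Red.nil, rfl, rfl⟩, rfl, rfl⟩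
  | cons l w ih =>
    obtain ⟨h1, h2, h3⟩ := red_cons.mp hw
    obtain ⟨hi, hw', hl⟩ := ih h3
    by_cases h : ∃ c, l = ⟨s.nu (pr.curLab (pr.st w)), s.sp _ c⟩
    · obtain ⟨c, rfl⟩ := h
      rw [st, step_special]
      refine ⟨⟨hi.compat, hi.mem, hi.ok, hi.ok', hi.red, hi.red', hi.head, hi.head'⟩, ?_, ?_⟩
      · exact congrArg _ hw'
      · rfl
    · rw [st, step_enter _ _ _ h]
      rw [hl] at h2
      have hv := hi.valid h2.symm
      have hv' := pr.half.valid _ _ _ hi.compat hv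
      refine ⟨⟨pr.half.type_eq _ _ _ hi.compat hv, ⟨l.2, rfl, h1, ?_⟩, h2.symm, hv'.2,
        ?_, hi.red_outAt h2.symm, ?_, ?_⟩, ?_, rfl⟩
      · rintro ⟨h4, c, h5⟩
        exact h ⟨c, sigma_eq_of_fst_eq h4 (s.sp · c) h5⟩
      · exact hw' ▸ h3
      · exact (congrArg headLab hw').symm.trans hl
      · exact (s'.red_lst hv'.1 hi.ok' hi.red' hi.head' _).2
      · exact congrArg _ hw'

theorem st_symm_path {w : List (Σ j, Q j)} {S : PState Q P} {x : Syl Q}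
    (h : pr.symm.st (s'.lst x [] ++ w) = { S with pos := x, path := [] }) (b : List Bool) :
    pr.symm.st (s'.lst x b ++ w) = { S with pos := x, path := b } := by
  induction b with
  | nil => exact h
  | cons c b ih =>
    change pr.symm.step (pr.symm.st (s'.lst x b ++ w)) _ = _
    rw [ih]
    exact pr.symm.step_special { S with pos := x, path := b } c

/-- Reading back the target word with the reversed pairing. -/
theorem st_symm (w : List (Σ j, P j)) (hw : Red w) (x : Syl Q) (b : List Bool)
    (hx : x ∈ s'.pool (pr.st w).kind') :
    pr.symm.st (s'.lst x b ++ (pr.st w).tgt) =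
      ⟨(pr.st w).tgt, (pr.st w).src, (pr.st w).kind', (pr.st w).kind, x, b⟩ := by
  induction w generalizing x b with
  | nil =>
    obtain rfl : x = none := hx
    exact pr.st_symm_path (S := ⟨[], [], none, none, none, []⟩) rfl b
  | cons l w ih =>
    obtain ⟨h1, h2, h3⟩ := red_cons.mp hw
    obtain ⟨hi, hw', hl⟩ := pr.inv_st w h3
    by_cases h : ∃ c, l = ⟨s.nu (pr.curLab (pr.st w)), s.sp _ c⟩
    · obtain ⟨c, rfl⟩ := h
      rw [st, step_special] at hx ⊢
      exact ih h3 x b hx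
    · rw [st, step_enter _ _ _ h] at hx ⊢
      rw [hl] at h2
      have hv := hi.valid h2.symm
      have hv' := pr.half.valid _ _ _ hi.compat hv
      have hinv := pr.inv _ _ _ hi.compat hv
      obtain ⟨q, rfl, hq1, hq⟩ := hx
      refine pr.st_symm_path (S := ⟨_, _, _, _, none, []⟩) ?_ b
      have hih := ih h3 _ (pr.β (pr.st w).kind (pr.st w).kind'
        ((pr.st w).pos, (pr.st w).path, l.1)).2.1 hv'.1
      change pr.symm.step (pr.symm.st (pr.outAt (pr.st w) l.1)) _ = _
      rw [outAt, hih, step_enter]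
      · simp only [outAt, curLab, symm]
        simp only [Prod.mk.eta, hinv]
      · rintro ⟨c, hc⟩
        refine hq ⟨congrArg Sigma.fst hc, c, ?_⟩
        exact eq_of_sigma_eq hc (s'.sp · c) rfl

end

end Pairing

end

/-! ### The coarse equivalence of free products defined by a pairing -/

noncomputable section

open Monoid

/-- A right coset of a factor of a free product. -/
def fcoset {J : Type} {P : J → Type} [∀ j, Group (P j)] (j : J) (g : CoprodI P) :
    Set (CoprodI P) := {x | ∃ p : P j, x = CoprodI.of p * g}

theorem fcoset_of_mul {J : Type} {P : J → Type} [∀ j, Group (P j)] {j : J} (p : P j)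
    (g : CoprodI P) : fcoset j (CoprodI.of p * g) = fcoset j g := by
  ext x
  constructor
  · rintro ⟨q, rfl⟩
    exact ⟨q * p, by simp [mul_assoc]⟩
  · rintro ⟨q, rfl⟩
    exact ⟨q * p⁻¹, by simp [mul_assoc]⟩

namespace Pairing

section
variable {J J' I : Type} {P : J → Type} {Q : J' → Type} [∀ j, Group (P j)]
  [∀ j, Group (Q j)] {s : Special P} {s' : Special Q} {t : J → I} {t' : J' → I}
  (pr : Pairing s s' t t')

/-- The map of free products defined by a pairing, on words. -/
def wmap (w : List (Σ j, P j)) : CoprodI Q := wprod (pr.out (pr.st w))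

/-- The map of free products defined by a pairing. -/
def tmap (g : CoprodI P) : CoprodI Q := pr.wmap (gword g)

theorem tmap_wprod {w : List (Σ j, P j)} (hw : Red w) : pr.tmap (wprod w) = pr.wmap w := by
  rw [tmap, gword_wprod hw]

theorem wprod_outAt (S : PState P Q) (j : J) :
    wprod (pr.outAt S j) = s'.posVal (pr.β S.kind S.kind' (S.pos, S.path, j)) * wprod S.tgt :=
  wprod_append _ _

theorem exists_near_outAt : ∃ E : Set (CoprodI Q), E.Finite ∧ ∀ S, pr.Inv S → ∀ j k,
    some j ≠ pr.curLab S → some k ≠ pr.curLab S →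
      wprod (pr.outAt S j) * (wprod (pr.outAt S k))⁻¹ ∈ E := by
  obtain ⟨E, hE, h⟩ := pr.half.near_step
  refine ⟨E, hE, fun S hS j k hj hk => ?_⟩
  have := h _ _ _ _ _ k j hS.compat (hS.valid hk) (hS.valid hj) (Or.inl rfl)
  rw [wprod_outAt, wprod_outAt]
  simpa [mul_assoc] using this

theorem exists_near_special : ∃ E : Set (CoprodI Q), E.Finite ∧ ∀ l w,
    Red (l :: w) → (∃ c, l = ⟨s.nu (pr.curLab (pr.st w)), s.sp _ c⟩) →
      pr.wmap (l :: w) * (pr.wmap w)⁻¹ ∈ E := by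
  obtain ⟨E, hE, h⟩ := pr.half.near_step
  refine ⟨E, hE, ?_⟩
  rintro l w hw ⟨c, rfl⟩
  have hi := (pr.inv_st w (red_cons.mp hw).2.2).1
  have hi2 := (pr.inv_st _ hw).1
  rw [wmap, wmap, out, out, st, step_special]
  rw [st, step_special] at hi2
  rw [wprod_outAt, wprod_outAt]
  have := h _ _ _ _ _ _ _ hi.compat hi.valid_nu hi2.valid_nu (Or.inr ⟨c, rfl⟩)
  simpa [mul_assoc] using this

theorem wmap_enter {l : Σ j, P j} {w : List (Σ j, P j)}
    (h : ¬ ∃ c, l = ⟨s.nu (pr.curLab (pr.st w)), s.sp _ c⟩) :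
    ∃ κ κ' k, κ = some (pr.curLab (pr.st w), l.1) ∧ κ' = some (s'.endl
        (pr.β (pr.st w).kind (pr.st w).kind' ((pr.st w).pos, (pr.st w).path, l.1)).1
        (pr.β (pr.st w).kind (pr.st w).kind' ((pr.st w).pos, (pr.st w).path, l.1)).2.1,
        (pr.β (pr.st w).kind (pr.st w).kind' ((pr.st w).pos, (pr.st w).path, l.1)).2.2) ∧
      k = s.nu (some l.1) ∧
      pr.wmap (l :: w) = s'.posVal (pr.β κ κ' (some l, [], k)) *
        wprod (pr.outAt (pr.st w) l.1) := by
  refine ⟨_, _, _, rfl, rfl, rfl, ?_⟩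
  rw [wmap, out, st, step_enter _ _ _ h, wprod_outAt]
  rfl

theorem near_cons [Finite J] [Finite J'] (l : Σ j, P j) :
    Near (fun w : {w // Red (l :: w)} => pr.wmap (l :: w.1)) (fun w => pr.wmap w.1) := by
  obtain ⟨E₁, hE₁, h₁⟩ := pr.exists_near_special
  obtain ⟨E₂, hE₂, h₂⟩ := pr.exists_near_outAt
  let X : Set (CoprodI Q) := Set.range fun q : Kind J × Kind J' =>
    s'.posVal (pr.β q.1 q.2 (some l, [], s.nu (some l.1)))
  refine ⟨E₁ ∪ Set.image2 (· * ·) X E₂,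
    hE₁.union (Set.Finite.image2 _ (Set.finite_range _) hE₂), ?_⟩
  rintro ⟨w, hw⟩
  by_cases h : ∃ c, l = ⟨s.nu (pr.curLab (pr.st w)), s.sp _ c⟩
  · exact Or.inl (h₁ _ _ hw h)
  · right
    obtain ⟨hi, -, hl⟩ := pr.inv_st w (red_cons.mp hw).2.2
    obtain ⟨κ, κ', k, -, -, rfl, h3⟩ := pr.wmap_enter h
    refine ⟨_, ⟨(κ, κ'), rfl⟩, _, h₂ _ hi l.1 _ ?_ (s.nu_ne _), ?_⟩
    · exact hl ▸ (red_cons.mp hw).2.1.symm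
    · simp only [h3, mul_assoc]
      rfl

/-- Pairs of a letter of the given label and a word it may be put in front of. -/
abbrev Tail (P : J → Type) [∀ j, Group (P j)] (j : J) : Type :=
  {w : List (Σ j, P j) // Red w ∧ headLab w ≠ some j}

theorem near_of_mul [Finite J] [Finite J'] (j : J) (p : P j) :
    Near (fun w : Tail P j => pr.tmap (CoprodI.of p * wprod w.1))
      (fun w => pr.tmap (wprod w.1)) := by
  by_cases hp : p = 1
  · exact Near.of_eq (by simp [hp])
  · obtain ⟨E, hE, h⟩ := pr.near_cons ⟨j, p⟩
    refine ⟨E, hE, ?_⟩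
    rintro ⟨w, hw, hj⟩
    have hr : Red (⟨j, p⟩ :: w) := red_cons.mpr ⟨hp, hj, hw⟩
    have := h ⟨w, hr⟩
    beta_reduce at this
    rw [← pr.tmap_wprod hr, ← pr.tmap_wprod hw] at this
    simpa using this

/-- The letters that never start a piece. -/
def bad (s : Special P) (j : J) : Set (P j) := insert 1 (Set.range (s.sp j))

theorem bad_finite (j : J) : (bad s j).Finite := (Set.finite_range _).insert 1

theorem exists_near_bad [Finite J] [Finite J'] : ∃ E : Set (CoprodI Q), E.Finite ∧
    ∀ j, ∀ p ∈ bad s j, ∀ w : Tail P j,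
      pr.tmap (CoprodI.of p * wprod w.1) * (pr.tmap (wprod w.1))⁻¹ ∈ E := by
  choose E hE h using pr.near_of_mul
  exact ⟨⋃ j, ⋃ p ∈ bad s j, E j p,
    Set.finite_iUnion fun j => (bad_finite j).biUnion fun p _ => hE j p,
    fun j p hp w => Set.mem_iUnion.mpr ⟨j, Set.mem_biUnion hp (h j p w)⟩⟩

theorem not_special {j : J} {p : P j} (hp : p ∉ bad s j) {o : Option J} :
    ¬ ∃ c, (⟨j, p⟩ : Σ j, P j) = ⟨s.nu o, s.sp _ c⟩ := by
  rintro ⟨c, hc⟩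
  exact hp (Or.inr ⟨c, (eq_of_sigma_eq hc (s.sp · c) rfl).symm⟩)

theorem valid_of_not_bad {j : J} {p : P j} (hp : p ∉ bad s j) (e : Option J) :
    s.Valid (some (e, j)) (some ⟨j, p⟩, [], s.nu (some j)) :=
  ⟨⟨p, rfl, fun h => hp (Or.inl h), fun ⟨_, c, hc⟩ => hp (Or.inr ⟨c, hc.symm⟩)⟩, s.nu_ne _⟩

theorem cmap_tmap [Finite J] [Finite J'] : CMap pr.tmap := by
  refine CMap.of_closure coprodI_closure ?_
  intro x hx
  obtain ⟨j, r, rfl⟩ := Set.mem_iUnion.mp hx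
  obtain ⟨E₁, hE₁, h₁⟩ := pr.half.near_mul j r
  choose E hE h using pr.near_of_mul j
  let B : Set (P j) := bad s j ∪ (fun p => r⁻¹ * p) '' bad s j
  have hB : B.Finite := (bad_finite j).union ((bad_finite j).image _)
  refine ⟨E₁ ∪ ⋃ p ∈ B, Set.image2 (fun a b => a * b⁻¹) (E (r * p)) (E p),
    hE₁.union (hB.biUnion fun p _ => Set.Finite.image2 _ (hE _) (hE _)), fun g => ?_⟩
  obtain ⟨p, w, hw, hj, rfl⟩ := exists_tail j g
  by_cases hp : p ∈ B
  · refine Or.inr (Set.mem_biUnion hp ⟨_, h (r * p) ⟨w, hw, hj⟩, _, h p ⟨w, hw, hj⟩, ?_⟩)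
    simp [mul_assoc]
  · left
    have hp1 : p ∉ bad s j := fun h => hp (Or.inl h)
    have hp2 : r * p ∉ bad s j := fun h => hp (Or.inr ⟨_, h, by simp⟩)
    have hr1 : Red (⟨j, p⟩ :: w) := red_cons.mpr ⟨fun h => hp1 (Or.inl h), hj, hw⟩
    have hr2 : Red (⟨j, r * p⟩ :: w) := red_cons.mpr ⟨fun h => hp2 (Or.inl h), hj, hw⟩
    have e1 := pr.tmap_wprod hr1
    have e2 := pr.tmap_wprod hr2
    rw [wprod_cons] at e1 e2
    obtain ⟨κ, κ', k, rfl, rfl, rfl, h4⟩ := pr.wmap_enter (w := w) (not_special hp1)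
    obtain ⟨κ, κ', k, rfl, rfl, rfl, h5⟩ := pr.wmap_enter (w := w) (not_special hp2)
    have hi := (pr.inv_st _ hr1).1.compat
    rw [st, step_enter _ _ _ (not_special hp1)] at hi
    have := h₁ _ _ _ _ _ hi (valid_of_not_bad hp1 _) (valid_of_not_bad hp2 _)
    beta_reduce
    rw [← mul_assoc, ← map_mul]
    simp only at e1 e2
    rw [e1, e2, h4, h5]
    simpa [mul_assoc] using this

theorem left_tmap : Near (fun g => pr.symm.tmap (pr.tmap g)) (fun g => g) := by
  obtain ⟨E, hE, h⟩ := pr.symm.exists_near_outAt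
  refine ⟨E, hE, fun g => ?_⟩
  obtain ⟨hi, hw, -⟩ := pr.inv_st (gword g) (red_gword g)
  have hv := pr.half.valid _ _ _ hi.compat hi.valid_nu
  have hinv := pr.inv _ _ _ hi.compat hi.valid_nu
  have hs := pr.st_symm (gword g) (red_gword g) _ (pr.β (pr.st (gword g)).kind
    (pr.st (gword g)).kind' ((pr.st (gword g)).pos, (pr.st (gword g)).path,
      s.nu (pr.curLab (pr.st (gword g))))).2.1 hv.1
  have hi' := (pr.symm.inv_st _ hi.red_out).1
  have h1 : pr.symm.tmap (pr.tmap g) = pr.symm.wmap (pr.out (pr.st (gword g))) :=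
    pr.symm.tmap_wprod hi.red_out
  change pr.symm.st (pr.out (pr.st (gword g))) = _ at hs
  rw [hs] at hi'
  have h2 := h _ hi' _ _ (s'.nu_ne _) hv.2
  simp only [outAt] at h2
  beta_reduce
  rw [h1, wmap, hs]
  refine Eq.mp (congrArg (fun x => _ * x⁻¹ ∈ E) ?_) h2
  simp only [symm, Prod.mk.eta]
  rw [hinv, ← hw, wprod_gword]

theorem cinv_tmap [Finite J] [Finite J'] : CInv pr.tmap pr.symm.tmap :=
  ⟨pr.cmap_tmap, pr.symm.cmap_tmap, pr.left_tmap, pr.symm.left_tmap⟩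

theorem exists_near_coset [Finite J] [Finite J'] : ∃ E : Set (CoprodI Q), E.Finite ∧
    ∀ j (w : Tail P j) (p : P j), ∃ x ∈ fcoset (pr.β (pr.st w.1).kind (pr.st w.1).kind'
        ((pr.st w.1).pos, (pr.st w.1).path, j)).2.2 (wprod (pr.outAt (pr.st w.1) j)),
      pr.tmap (CoprodI.of p * wprod w.1) * x⁻¹ ∈ E := by
  obtain ⟨E₁, hE₁, h₁⟩ := pr.half.near_root
  obtain ⟨E₂, hE₂, h₂⟩ := pr.exists_near_bad
  obtain ⟨E₃, hE₃, h₃⟩ := pr.exists_near_outAt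
  refine ⟨E₁ ∪ Set.image2 (· * ·) E₂ E₃, hE₁.union (Set.Finite.image2 _ hE₂ hE₃), ?_⟩
  rintro j ⟨w, hw, hj⟩ p
  obtain ⟨hi, -, hl⟩ := pr.inv_st w hw
  rw [hl] at hj
  by_cases hp : p ∈ bad s j
  · refine ⟨_, ⟨1, rfl⟩, Or.inr ⟨_, h₂ j p hp ⟨w, hw, hl ▸ hj⟩, _, h₃ _ hi _ j (s.nu_ne _) hj.symm, ?_⟩⟩
    simp [pr.tmap_wprod hw, wmap, out, mul_assoc]
  · have hr : Red (⟨j, p⟩ :: w) := red_cons.mpr ⟨fun h => hp (Or.inl h), hl ▸ hj, hw⟩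
    have e := pr.tmap_wprod hr
    rw [wprod_cons] at e
    obtain ⟨κ, κ', k, rfl, rfl, rfl, h4⟩ := pr.wmap_enter (w := w) (not_special hp)
    have hi := (pr.inv_st _ hr).1.compat
    rw [st, step_enter _ _ _ (not_special hp)] at hi
    have hv := valid_of_not_bad hp (pr.curLab (pr.st w))
    have hv' := pr.half.valid _ _ _ hi hv
    have := h₁ _ _ _ _ hi hv
    obtain ⟨⟨q, hq, -⟩, -⟩ := hv'
    refine ⟨_, ⟨q, rfl⟩, Or.inl ?_⟩
    simp only at e h4 ⊢
    rw [hq] at this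
    rw [e, h4]
    simpa [Special.val, Special.lst, mul_assoc] using this

theorem exists_matched [Finite J] [Finite J'] : ∃ E : Set (CoprodI Q), E.Finite ∧
    ∀ j g, ∃ j' g', t j = t' j' ∧ Matched pr.tmap E (fcoset j g) (fcoset j' g') := by
  obtain ⟨E₁, hE₁, h₁⟩ := pr.exists_near_coset
  obtain ⟨E₂, hE₂, h₂⟩ := pr.symm.exists_near_coset
  obtain ⟨E₃, hE₃, h₃⟩ := pr.cmap_tmap.exists_finite hE₂
  obtain ⟨E₄, hE₄, h₄⟩ := pr.symm.left_tmap
  refine ⟨E₁ ∪ Set.image2 (fun a b => a⁻¹ * b) E₃ E₄,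
    hE₁.union (Set.Finite.image2 _ hE₃ hE₄), fun j g => ?_⟩
  obtain ⟨p, w, hw, hj, rfl⟩ := exists_tail j g
  obtain ⟨hi, hw', hl⟩ := pr.inv_st w hw
  have hv := hi.valid (hl ▸ hj.symm)
  have hv' := pr.half.valid _ _ _ hi.compat hv
  have hinv := pr.inv _ _ _ hi.compat hv
  have hs := pr.st_symm w hw _ (pr.β (pr.st w).kind
    (pr.st w).kind' ((pr.st w).pos, (pr.st w).path, j)).2.1 hv'.1
  change pr.symm.st (pr.outAt (pr.st w) j) = _ at hs
  have hr := hi.red_outAt (hl ▸ hj.symm)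
  have hl' := (pr.symm.inv_st _ hr).2.2
  have hj' : headLab (pr.outAt (pr.st w) j) ≠ some (pr.β (pr.st w).kind
      (pr.st w).kind' ((pr.st w).pos, (pr.st w).path, j)).2.2 := by
    rw [hl', hs]
    exact hv'.2.symm
  rw [fcoset_of_mul]
  refine ⟨_, wprod (pr.outAt (pr.st w) j), pr.half.type_eq _ _ _ hi.compat hv, ?_, ?_⟩
  · rintro _ ⟨p, rfl⟩
    obtain ⟨x, hx, hq⟩ := h₁ j ⟨w, hw, hj⟩ p
    exact ⟨x, hx, Or.inl hq⟩
  · rintro _ ⟨q, rfl⟩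
    have h5 := h₂ _ ⟨_, hr, hj'⟩ q
    simp only [hs] at h5
    simp only [outAt, symm, Prod.mk.eta] at h5
    rw [hinv] at h5
    rw [← hw'] at h5
    obtain ⟨x, hx, hp⟩ := h5
    refine ⟨x, hx, Or.inr ⟨_, h₃ _ _ hp, _,
      h₄ (CoprodI.of q * wprod (pr.outAt (pr.st w) j)), ?_⟩⟩
    simp [outAt, symm]

end

end Pairing

end

/-! ### Constructing pairings -/

noncomputable section

open Monoid

/-- `ψ` and `ψ'` match the points `a x` and `a' x'` in a coarse way. -/
def Aligned {X X' N G G' : Type*} [Group G] [Group G'] (a : X → G) (a' : X' → G') (ψ : X → N)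
    (ψ' : X' → N) : Prop :=
  ∀ E : Set G, E.Finite → ∃ E' : Set G', E'.Finite ∧ ∀ x y x' y', ψ x = ψ' x' → ψ y = ψ' y' →
    a x * (a y)⁻¹ ∈ E → a' x' * (a' y')⁻¹ ∈ E'

theorem Aligned.map {X X' N G G' H H' : Type*} [Group G] [Group G'] [Group H] [Group H']
    {a : X → G} {a' : X' → G'} {ψ : X → N} {ψ' : X' → N} (h : Aligned a a' ψ ψ') (f : G →* H)
    (hf : Function.Injective f) (f' : G' →* H') {b : X → H} {b' : X' → H'}
    (hb : ∀ x, b x = f (a x)) (hb' : ∀ x, b' x = f' (a' x)) : Aligned b b' ψ ψ' := by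
  intro E hE
  obtain ⟨E', hE', h'⟩ := h (f ⁻¹' E) (hE.preimage hf.injOn)
  refine ⟨f' '' E', hE'.image _, fun x y x' y' h1 h2 h3 => ⟨_, h' x y x' y' h1 h2 ?_, ?_⟩⟩
  · simpa [hb] using h3
  · simp [hb']

theorem exists_aligned {X X' G G' : Type} [Group G] [Group G'] (a : X → G) (a' : X' → G')
    [Nonempty X] [Nonempty X'] (ha : (Set.range a)ᶜ.Finite) (ha' : (Set.range a')ᶜ.Finite)
    {φ : G → G'} {φ' : G' → G} (hφ : CInv φ φ') :
    ∃ (N : Type) (ψ : X → N) (ψ' : X' → N), Function.Surjective ψ ∧ Function.Surjective ψ' ∧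
      Aligned a a' ψ ψ' ∧ Aligned a' a ψ' ψ := by
  classical
  have key : ∀ {Y : Type} {Y' H : Type} [Group H] (k : Y → H) (c : Y' → H) [Nonempty Y],
      (Set.range k)ᶜ.Finite → ∃ m : Y' → Y, Near (fun y => k (m y)) c := by
    intro Y Y' H _ k c _ hk
    refine ⟨fun y => if h : ∃ z, k z = c y then h.choose else Classical.arbitrary Y,
      insert 1 ((fun q => k (Classical.arbitrary Y) * q⁻¹) '' (Set.range k)ᶜ),
      (hk.image _).insert 1, fun y => ?_⟩
    by_cases h : ∃ z, k z = c y
    · left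
      simp only [dif_pos h, h.choose_spec, mul_inv_cancel]
    · right
      exact ⟨c y, h, by simp only [dif_neg h]⟩
  obtain ⟨m, hm⟩ := key a' (fun x => φ (a x)) ha'
  obtain ⟨r, hr⟩ := key a (fun x => φ' (a' x)) ha
  let ψ : X → Set.range m := fun x => ⟨m x, x, rfl⟩
  let ψ' : X' → Set.range m := fun x' => if h : x' ∈ Set.range m then ⟨x', h⟩ else ψ (r x')
  have hψ' : Near (fun x' => a' (ψ' x')) a' := by
    refine Near.of_cover (ι := Bool) (fun i x' => (x' ∈ Set.range m) ↔ i = true) ?_ ?_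
    · intro x'
      by_cases h : x' ∈ Set.range m
      · exact ⟨true, by simpa using h⟩
      · exact ⟨false, by simpa using h⟩
    · rintro (_ | _)
      · refine Near.trans (f' := fun x' => a' (m (r x'.1))) ?_ ?_
        · refine Near.of_eq ?_
          rintro ⟨x', hx'⟩
          have hx' : x' ∉ Set.range m := by simpa using hx'
          simp only [ψ', dif_neg hx', ψ]
        · exact (((hm.comp r).trans (hφ.map.near hr)).trans (hφ.right.comp a')).comp Subtype.val
      · refine Near.of_eq ?_
        rintro ⟨x', hx'⟩
        have hx' : x' ∈ Set.range m := by simpa using hx'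
        simp only [ψ', dif_pos hx']
  refine ⟨Set.range m, ψ, ψ', ?_, ?_, fun E hE => ?_, fun E hE => ?_⟩
  · rintro ⟨_, x, rfl⟩
    exact ⟨x, rfl⟩
  · rintro ⟨x', hx'⟩
    exact ⟨x', by simp only [ψ', dif_pos hx']⟩
  · let Z := {z : (X × X) × X' × X' // ψ z.1.1 = ψ' z.2.1 ∧ ψ z.1.2 = ψ' z.2.2 ∧
      a z.1.1 * (a z.1.2)⁻¹ ∈ E}
    have h1 : Near (fun z : Z => a' z.1.2.1) (fun z => φ (a z.1.1.1)) :=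
      (hψ'.comp (fun z : Z => z.1.2.1)).symm.trans
        ((Near.of_eq fun z => by rw [← z.2.1]).trans (hm.comp fun z : Z => z.1.1.1))
    have h2 : Near (fun z : Z => a' z.1.2.2) (fun z => φ (a z.1.1.2)) :=
      (hψ'.comp (fun z : Z => z.1.2.2)).symm.trans
        ((Near.of_eq fun z => by rw [← z.2.2.1]).trans (hm.comp fun z : Z => z.1.1.2))
    have h3 : Near (fun z : Z => a z.1.1.1) (fun z => a z.1.1.2) := ⟨E, hE, fun z => z.2.2.2⟩
    obtain ⟨E', hE', h⟩ := (h1.trans (hφ.map.near h3)).trans h2.symm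
    exact ⟨E', hE', fun x y x' y' hx hy hxy => h ⟨((x, y), x', y'), hx, hy, hxy⟩⟩
  · let Z := {z : (X × X) × X' × X' // ψ z.1.1 = ψ' z.2.1 ∧ ψ z.1.2 = ψ' z.2.2 ∧
      a' z.2.1 * (a' z.2.2)⁻¹ ∈ E}
    have h1 : Near (fun z : Z => a' z.1.2.1) (fun z => φ (a z.1.1.1)) :=
      (hψ'.comp (fun z : Z => z.1.2.1)).symm.trans
        ((Near.of_eq fun z => by rw [← z.2.1]).trans (hm.comp fun z : Z => z.1.1.1))
    have h2 : Near (fun z : Z => a' z.1.2.2) (fun z => φ (a z.1.1.2)) :=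
      (hψ'.comp (fun z : Z => z.1.2.2)).symm.trans
        ((Near.of_eq fun z => by rw [← z.2.2.1]).trans (hm.comp fun z : Z => z.1.1.2))
    have h3 : Near (fun z : Z => a' z.1.2.1) (fun z => a' z.1.2.2) := ⟨E, hE, fun z => z.2.2.2⟩
    obtain ⟨E', hE', h⟩ := hφ.reflect ((h1.symm.trans h3).trans h2)
    exact ⟨E', hE', fun x' y' x y hx hy hxy => h ⟨((x, y), x', y'), hx.symm, hy.symm, hxy⟩⟩

/-- Points in the same fibre are near. -/
theorem Aligned.exists_fibre {X X' N G G' : Type*} [Group G] [Group G'] {a : X → G}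
    {a' : X' → G'} {ψ : X → N} {ψ' : X' → N} (h : Aligned a a' ψ ψ')
    (hψ : Function.Surjective ψ) : ∃ E : Set G', E.Finite ∧
      ∀ x' y', ψ' x' = ψ' y' → a' x' * (a' y')⁻¹ ∈ E := by
  obtain ⟨E, hE, h⟩ := h {1} (Set.finite_singleton 1)
  refine ⟨E, hE, fun x' y' hxy => ?_⟩
  obtain ⟨x, hx⟩ := hψ (ψ' x')
  exact h x x x' y' hx (hx.trans hxy) (by simp)

theorem exists_coding_of_near {X N G : Type*} [Group G] {a : X → G}
    (ha : Function.Injective a) {ψ : X → N} (hψ : Function.Surjective ψ) {E : Set G}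
    (hE : E.Finite) (h : ∀ x y, ψ x = ψ y → a x * (a y)⁻¹ ∈ E) :
    ∃ M cd, Coding ψ cd M := by
  refine ⟨E.ncard, exists_coding ψ hψ _ ?_ ?_⟩
  · intro n
    obtain ⟨x₀, rfl⟩ := hψ n
    have := hE.to_subtype
    refine Finite.of_injective (fun x : {x // ψ x = ψ x₀} => (⟨_, h x.1 x₀ x.2⟩ : E)) ?_
    intro x y hxy
    exact Subtype.ext (ha (mul_right_cancel (congrArg Subtype.val hxy)))
  · intro n
    obtain ⟨x₀, rfl⟩ := hψ n
    have := hE.to_subtype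
    refine Nat.card_le_card_of_injective
      (fun x : {x // ψ x = ψ x₀} => (⟨_, h x.1 x₀ x.2⟩ : E)) ?_
    intro x y hxy
    exact Subtype.ext (ha (mul_right_cancel (congrArg Subtype.val hxy)))

namespace Special

section
variable {J : Type} {P : J → Type} [∀ j, Group (P j)] (s : Special P)

theorem exists_near_val [Finite J] (L : ℕ) : ∃ E : Set (CoprodI P), E.Finite ∧
    ∀ x b u, u.length ≤ L → s.val x (u ++ b) * (s.val x b)⁻¹ ∈ E := by
  induction L with
  | zero =>
    refine ⟨{1}, Set.finite_singleton 1, fun x b u hu => ?_⟩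
    obtain rfl : u = [] := List.eq_nil_of_length_eq_zero (by omega)
    simp
  | succ L ih =>
    obtain ⟨E, hE, h⟩ := ih
    let X : Set (CoprodI P) := Set.range fun q : J × Bool => CoprodI.of (s.sp q.1 q.2)
    refine ⟨E ∪ Set.image2 (· * ·) X E,
      hE.union (Set.Finite.image2 _ (Set.finite_range _) hE), fun x b u hu => ?_⟩
    cases u with
    | nil => exact Or.inl (h x b [] (by simp))
    | cons c u =>
      refine Or.inr ⟨_, ⟨(s.nu (s.endl x (u ++ b)), c), rfl⟩, _,
        h x b u (by simpa using hu), ?_⟩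
      simp [val, lst, mul_assoc]

/-- Positions that are close in the tree of a piece have close values. -/
theorem exists_near_of_treeNear [Finite J] {κ : Kind J} {N : Type*}
    {ψ : {x // x ∈ s.pool κ} → N} {cd : {x // x ∈ s.pool κ} → List Bool} {M : ℕ}
    (hc : Coding ψ cd M) {E₀ : Set (CoprodI P)} (hE₀ : E₀.Finite)
    (h₀ : ∀ x y, ψ x = ψ y → s.val x.1 [] * (s.val y.1 [])⁻¹ ∈ E₀) (C : ℕ) :
    ∃ E : Set (CoprodI P), E.Finite ∧ ∀ x y b d, ψ x = ψ y →
      TreeNear C (b ++ cd x) (d ++ cd y) → s.val x.1 b * (s.val y.1 d)⁻¹ ∈ E := by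
  obtain ⟨E, hE, h⟩ := s.exists_near_val (C + M)
  let f : CoprodI P → CoprodI P → CoprodI P := fun g k => g * k⁻¹
  refine ⟨Set.image2 f E E ∪ Set.image2 f (Set.image2 (· * ·) E E₀) E,
    (Set.Finite.image2 _ hE hE).union (Set.Finite.image2 _ (Set.Finite.image2 _ hE hE₀) hE), ?_⟩
  rintro x y b d hxy ⟨u, u', c, h1, h2, h3, h4⟩
  by_cases hM : M ≤ c.length
  · left
    obtain ⟨z, a, hz, rfl⟩ := hc.parse (ψ x) c hM
    rw [← List.append_assoc] at h1 h2
    obtain ⟨rfl, rfl⟩ := hc.unique _ _ _ _ hz.symm h1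
    obtain ⟨rfl, rfl⟩ := hc.unique _ _ _ _ (hz.trans hxy).symm h2
    exact ⟨_, h y.1 a u (by omega), _, h y.1 a u' (by omega), by simp [f, mul_assoc]⟩
  · right
    have hb : b.length ≤ C + M := by
      have := congrArg List.length h1
      simp only [List.length_append] at this
      omega
    have hd : d.length ≤ C + M := by
      have := congrArg List.length h2
      simp only [List.length_append] at this
      omega
    refine ⟨_, ⟨_, h x.1 [] b hb, _, h₀ x y hxy, rfl⟩, _, h y.1 [] d hd, ?_⟩
    simp [f, mul_assoc]

/-- The element of the factor given by a letter of a pool. -/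
def poolElt {e : Option J} {j : J} (x : {x // x ∈ s.pool (some (e, j))}) : P j := x.2.choose

theorem poolElt_spec {e : Option J} {j : J} (x : {x // x ∈ s.pool (some (e, j))}) :
    x.1 = some ⟨j, s.poolElt x⟩ := x.2.choose_spec.1

theorem finite_compl_range_poolElt (e : Option J) (j : J) :
    (Set.range fun x : {x // x ∈ s.pool (some (e, j))} => s.poolElt x)ᶜ.Finite := by
  refine ((Set.finite_range (s.sp j)).insert 1).subset fun p hp => ?_
  by_contra hp'
  have hx : (some ⟨j, p⟩ : Syl P) ∈ s.pool (some (e, j)) :=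
    ⟨p, rfl, fun h => hp' (Or.inl h), fun ⟨_, c, hc⟩ => hp' (Or.inr ⟨c, hc.symm⟩)⟩
  refine hp ⟨⟨_, hx⟩, ?_⟩
  simpa using (s.poolElt_spec ⟨_, hx⟩).symm

theorem val_poolElt {e : Option J} {j : J} (x : {x // x ∈ s.pool (some (e, j))}) :
    s.val x.1 [] = CoprodI.of (s.poolElt x) := by
  rw [s.poolElt_spec x]
  simp [val, lst]

theorem val_injective (κ : Kind J) :
    Function.Injective fun x : {x // x ∈ s.pool κ} => s.val x.1 [] := by
  cases κ with
  | none =>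
    rintro ⟨x, hx⟩ ⟨y, hy⟩ -
    exact Subtype.ext (hx.trans hy.symm)
  | some a =>
    obtain ⟨e, j⟩ := a
    intro x y hxy
    simp only [val_poolElt] at hxy
    apply Subtype.ext
    rw [s.poolElt_spec x, s.poolElt_spec y, CoprodI.of_injective j hxy]

end

end Special

section
variable {J J' I : Type} {P : J → Type} {Q : J' → Type} [∀ j, Group (P j)]
  [∀ j, Group (Q j)]

theorem exists_aligned_pool (s : Special P) (s' : Special Q) {t : J → I} {t' : J' → I}
    [∀ j, Infinite (P j)] [∀ j, Infinite (Q j)]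
    (hφ : ∀ j j', t j = t' j' → ∃ (φ : P j → Q j') (φ' : Q j' → P j), CInv φ φ')
    {κ : Kind J} {κ' : Kind J'} (hκ : Compat t t' κ κ') :
    ∃ (N : Type) (ψ : {x // x ∈ s.pool κ} → N) (ψ' : {x // x ∈ s'.pool κ'} → N),
      Function.Surjective ψ ∧ Function.Surjective ψ' ∧
      Aligned (fun x => s.val x.1 []) (fun x => s'.val x.1 []) ψ ψ' ∧
      Aligned (fun x => s'.val x.1 []) (fun x => s.val x.1 []) ψ' ψ := by
  match κ, κ', hκ with
  | none, none, _ =>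
    refine ⟨Unit, fun _ => (), fun _ => (), fun _ => ⟨⟨none, rfl⟩, rfl⟩,
      fun _ => ⟨⟨none, rfl⟩, rfl⟩, fun E hE => ⟨{1}, Set.finite_singleton 1, ?_⟩,
      fun E hE => ⟨{1}, Set.finite_singleton 1, ?_⟩⟩
    · rintro - - ⟨x, rfl⟩ ⟨y, rfl⟩ - - -
      simp
    · rintro - - ⟨x, rfl⟩ ⟨y, rfl⟩ - - -
      simp
  | some (e, j), some (e', j'), hκ =>
    obtain ⟨φ, φ', hφ⟩ := hφ j j' hκ
    have hf := s.finite_compl_range_poolElt e j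
    have hf' := s'.finite_compl_range_poolElt e' j'
    have hne : Nonempty {x // x ∈ s.pool (some (e, j))} := by
      obtain ⟨p, hp⟩ := hf.exists_notMem
      obtain ⟨x, -⟩ := not_not.mp hp
      exact ⟨x⟩
    have hne' : Nonempty {x // x ∈ s'.pool (some (e', j'))} := by
      obtain ⟨p, hp⟩ := hf'.exists_notMem
      obtain ⟨x, -⟩ := not_not.mp hp
      exact ⟨x⟩
    obtain ⟨N, ψ, ψ', h1, h2, h3, h4⟩ := exists_aligned _ _ hf hf' hφ
    exact ⟨N, ψ, ψ', h1, h2,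
      h3.map CoprodI.of (CoprodI.of_injective j) CoprodI.of s.val_poolElt s'.val_poolElt,
      h4.map CoprodI.of (CoprodI.of_injective j') CoprodI.of s'.val_poolElt s.val_poolElt⟩

/-- The slots of the pieces of one kind. -/
abbrev KSlots (s : Special P) (κ : Kind J) : Type :=
  Slots {x // x ∈ s.pool κ} J (fun x => s.endl x.1)

/-- The slot underlying an element of `KSlots`. -/
def KSlots.slot {s : Special P} {κ : Kind J} (σ : KSlots s κ) : Slot P :=
  (σ.1.1.1, σ.1.2.1, σ.1.2.2)

theorem KSlots.slot_valid {s : Special P} {κ : Kind J} (σ : KSlots s κ) : s.Valid κ σ.slot :=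
  ⟨σ.1.1.2, σ.2⟩

/-- The element of `KSlots` given by a valid slot. -/
def KSlots.mk {s : Special P} {κ : Kind J} (σ : Slot P) (h : s.Valid κ σ) : KSlots s κ :=
  ⟨(⟨σ.1, h.1⟩, σ.2), h.2⟩

theorem KSlots.mk_slot {s : Special P} {κ : Kind J} (σ : KSlots s κ) :
    KSlots.mk σ.slot σ.slot_valid = σ := rfl

/-- The properties of one half of a pairing, for fixed kinds. -/
structure HalfK (s : Special P) (s' : Special Q) (t : J → I) (t' : J' → I) {κ : Kind J}
    {κ' : Kind J'} (h : KSlots s κ → KSlots s' κ') : Prop where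
  type_eq : ∀ σ, t σ.1.2.2 = t' (h σ).1.2.2
  near_step : ∃ E : Set (CoprodI Q), E.Finite ∧ ∀ σ τ : KSlots s κ, σ.1.1 = τ.1.1 →
    (σ.1.2.1 = τ.1.2.1 ∨ ∃ c, σ.1.2.1 = c :: τ.1.2.1) →
    s'.posVal (h σ).slot * (s'.posVal (h τ).slot)⁻¹ ∈ E
  near_root : ∃ E : Set (CoprodI Q), E.Finite ∧ ∀ σ : KSlots s κ, σ.1.2.1 = [] →
    s'.posVal (h σ).slot * (s'.val (h σ).slot.1 [])⁻¹ ∈ E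
  near_mul : ∀ F : Set (CoprodI P), F.Finite → ∃ E : Set (CoprodI Q), E.Finite ∧
    ∀ σ τ : KSlots s κ, σ.1.2.1 = [] → τ.1.2.1 = [] →
    s.val σ.1.1.1 [] * (s.val τ.1.1.1 [])⁻¹ ∈ F →
    s'.posVal (h σ).slot * (s'.posVal (h τ).slot)⁻¹ ∈ E

theorem halfK_of [Finite J'] {s : Special P} {s' : Special Q} {t : J → I} {t' : J' → I}
    {κ : Kind J} {κ' : Kind J'} {N : Type} {ψ : {x // x ∈ s.pool κ} → N}
    {ψ' : {x // x ∈ s'.pool κ'} → N} {cd : {x // x ∈ s.pool κ} → List Bool}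
    {cd' : {x // x ∈ s'.pool κ'} → List Bool} {M M' : ℕ} (hψ : Function.Surjective ψ)
    (ha : Aligned (fun x => s.val x.1 []) (fun x => s'.val x.1 []) ψ ψ')
    (hc : Coding ψ cd M) (hc' : Coding ψ' cd' M') {C : ℕ} (h : KSlots s κ → KSlots s' κ')
    (hh : ∀ σ, ψ σ.1.1 = ψ' (h σ).1.1 ∧
      TreeNear C (σ.1.2.1 ++ cd σ.1.1) ((h σ).1.2.1 ++ cd' (h σ).1.1) ∧
      t σ.1.2.2 = t' (h σ).1.2.2) : HalfK s s' t t' h := by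
  obtain ⟨E₀, hE₀, h₀⟩ := ha.exists_fibre hψ
  have root : ∃ E : Set (CoprodI Q), E.Finite ∧ ∀ σ : KSlots s κ, σ.1.2.1 = [] →
      s'.posVal (h σ).slot * (s'.val (h σ).slot.1 [])⁻¹ ∈ E := by
    obtain ⟨E, hE, h'⟩ := s'.exists_near_val (C + M)
    refine ⟨E, hE, fun σ hσ => ?_⟩
    obtain ⟨u, u', c, h1, h2, h3, h4⟩ := (hh σ).2.1
    have hl := hc.length_le σ.1.1
    have := congrArg List.length h1
    have := congrArg List.length h2
    simp only [List.length_append, hσ, List.length_nil] at *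
    have h5 := h' (h σ).slot.1 [] (h σ).1.2.1 (by omega)
    rwa [List.append_nil] at h5
  refine ⟨fun σ => (hh σ).2.2, ?_, root, fun F hF => ?_⟩
  · obtain ⟨E, hE, h'⟩ := s'.exists_near_of_treeNear hc' hE₀ h₀ (C + 1 + C)
    refine ⟨E, hE, fun σ τ h1 h2 => h' _ _ _ _ ?_ ?_⟩
    · rw [← (hh σ).1, ← (hh τ).1, h1]
    · refine ((hh σ).2.1.symm.trans (C' := 1) ?_).trans (hh τ).2.1
      rw [h1]
      rcases h2 with h2 | ⟨c, h2⟩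
      · rw [h2]
        exact ⟨[], [], _, rfl, rfl, by simp, by simp⟩
      · rw [h2]
        exact TreeNear.of_append [c] _ (by simp)
  · obtain ⟨E₁, hE₁, h₁⟩ := root
    obtain ⟨E₂, hE₂, h₂⟩ := ha F hF
    refine ⟨Set.image2 (fun g k => g * k⁻¹) (Set.image2 (· * ·) E₁ E₂) E₁,
      Set.Finite.image2 _ (Set.Finite.image2 _ hE₁ hE₂) hE₁, fun σ τ h1 h2 h3 => ?_⟩
    refine ⟨_, ⟨_, h₁ σ h1, _, h₂ _ _ _ _ (hh σ).1 (hh τ).1 h3, rfl⟩, _, h₁ τ h2, ?_⟩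
    simp [mul_assoc, KSlots.slot]

theorem exists_halfK [Finite J] [Finite J'] (s : Special P) (s' : Special Q) {t : J → I}
    {t' : J' → I} (htt : Set.range t = Set.range t')
    [∀ j, Infinite (P j)] [∀ j, Infinite (Q j)]
    (hφ : ∀ j j', t j = t' j' → ∃ (φ : P j → Q j') (φ' : Q j' → P j), CInv φ φ')
    {κ : Kind J} {κ' : Kind J'} (hκ : Compat t t' κ κ') :
    ∃ h : KSlots s κ ≃ KSlots s' κ', HalfK s s' t t' h ∧ HalfK s' s t' t h.symm := by
  obtain ⟨N, ψ, ψ', h1, h2, h3, h4⟩ := exists_aligned_pool s s' hφ hκ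
  obtain ⟨E, hE, hE'⟩ := h4.exists_fibre h2
  obtain ⟨M, cd, hc⟩ := exists_coding_of_near (s.val_injective κ) h1 hE hE'
  obtain ⟨E', hE', hE''⟩ := h3.exists_fibre h1
  obtain ⟨M', cd', hc'⟩ := exists_coding_of_near (s'.val_injective κ') h2 hE' hE''
  obtain ⟨C, h, hh⟩ := exists_slot_equiv hc hc' t t' htt (fun x => s.endl x.1) s.nu s.nu_ne
    (fun _ _ _ => rfl) (fun x => s'.endl x.1) s'.nu s'.nu_ne (fun _ _ _ => rfl)
  refine ⟨h, halfK_of h1 h3 hc hc' h hh, halfK_of h2 h4 hc' hc h.symm (C := C) fun σ => ?_⟩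
  have := hh (h.symm σ)
  rw [h.apply_symm_apply] at this
  exact ⟨this.1.symm, this.2.1.symm, this.2.2.symm⟩


open Classical in
/-- Extend maps between the slots of one kind to all slots. -/
def extendSlots (s : Special P) (s' : Special Q) (t : J → I) (t' : J' → I)
    (h : ∀ κ κ', Compat t t' κ κ' → KSlots s κ → KSlots s' κ') (κ : Kind J) (κ' : Kind J')
    (σ : Slot P) : Slot Q :=
  if hσ : Compat t t' κ κ' ∧ s.Valid κ σ then (h κ κ' hσ.1 (KSlots.mk σ hσ.2)).slot
  else (none, [], s'.nu none)

theorem extendSlots_eq {s : Special P} {s' : Special Q} {t : J → I} {t' : J' → I}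
    {h : ∀ κ κ', Compat t t' κ κ' → KSlots s κ → KSlots s' κ'} {κ : Kind J} {κ' : Kind J'}
    {σ : Slot P} (hκ : Compat t t' κ κ') (hσ : s.Valid κ σ) :
    extendSlots s s' t t' h κ κ' σ = (h κ κ' hκ (KSlots.mk σ hσ)).slot := dif_pos ⟨hκ, hσ⟩

theorem halfPairing_of [Finite J] [Finite J'] {s : Special P} {s' : Special Q} {t : J → I}
    {t' : J' → I} {h : ∀ κ κ', Compat t t' κ κ' → KSlots s κ → KSlots s' κ'}
    (hh : ∀ κ κ' hκ, HalfK s s' t t' (h κ κ' hκ)) :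
    HalfPairing s s' t t' (extendSlots s s' t t' h) := by
  let ι := {q : Kind J × Kind J' // Compat t t' q.1 q.2}
  refine ⟨fun κ κ' σ hκ hσ => ?_, fun κ κ' σ hκ hσ => ?_, ?_, ?_, fun j r => ?_⟩
  · rw [extendSlots_eq hκ hσ]
    exact KSlots.slot_valid _
  · rw [extendSlots_eq hκ hσ]
    exact (hh κ κ' hκ).type_eq (KSlots.mk σ hσ)
  · choose E hE h' using fun q : ι => (hh _ _ q.2).near_step
    refine ⟨⋃ q, E q, Set.finite_iUnion hE, fun κ κ' x b b₂ j k hκ h1 h2 h3 => ?_⟩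
    rw [extendSlots_eq hκ h1, extendSlots_eq hκ h2]
    exact Set.mem_iUnion.mpr ⟨⟨(κ, κ'), hκ⟩,
      h' ⟨(κ, κ'), hκ⟩ (KSlots.mk _ h2) (KSlots.mk _ h1) rfl h3⟩
  · choose E hE h' using fun q : ι => (hh _ _ q.2).near_root
    refine ⟨⋃ q, E q, Set.finite_iUnion hE, fun κ κ' x j hκ h1 => ?_⟩
    rw [extendSlots_eq hκ h1]
    exact Set.mem_iUnion.mpr ⟨⟨(κ, κ'), hκ⟩, h' ⟨(κ, κ'), hκ⟩ (KSlots.mk _ h1) rfl⟩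
  · choose E hE h' using fun q : ι =>
      (hh _ _ q.2).near_mul {CoprodI.of r} (Set.finite_singleton _)
    refine ⟨⋃ q, E q, Set.finite_iUnion hE, fun e κ' p k k₂ hκ h1 h2 => ?_⟩
    rw [extendSlots_eq hκ h1, extendSlots_eq hκ h2]
    refine Set.mem_iUnion.mpr ⟨⟨(_, κ'), hκ⟩,
      h' ⟨(_, κ'), hκ⟩ (KSlots.mk _ h2) (KSlots.mk _ h1) rfl rfl ?_⟩
    simp [KSlots.mk, Special.val, Special.lst]

theorem exists_pairing [Finite J] [Finite J'] (s : Special P) (s' : Special Q) {t : J → I}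
    {t' : J' → I} (htt : Set.range t = Set.range t')
    [∀ j, Infinite (P j)] [∀ j, Infinite (Q j)]
    (hφ : ∀ j j', t j = t' j' → ∃ (φ : P j → Q j') (φ' : Q j' → P j), CInv φ φ') :
    Nonempty (Pairing s s' t t') := by
  choose h h1 h2 using fun (κ : Kind J) (κ' : Kind J') (hκ : Compat t t' κ κ') =>
    exists_halfK s s' htt hφ hκ
  refine ⟨⟨extendSlots s s' t t' fun κ κ' hκ => h κ κ' hκ,
    extendSlots s' s t' t fun κ' κ hκ => (h κ κ' hκ.symm).symm,
    halfPairing_of h1, halfPairing_of fun κ' κ hκ => h2 κ κ' hκ.symm, ?_, ?_⟩⟩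
  · intro κ κ' σ hκ hσ
    rw [extendSlots_eq hκ hσ, extendSlots_eq hκ.symm (KSlots.slot_valid _), KSlots.mk_slot,
      Equiv.symm_apply_apply]
    rfl
  · intro κ κ' σ hκ hσ
    rw [extendSlots_eq hκ.symm hσ, extendSlots_eq hκ (KSlots.slot_valid _), KSlots.mk_slot,
      Equiv.apply_symm_apply]
    rfl

theorem nonempty_special [Nontrivial J] [∀ j, Infinite (P j)] : Nonempty (Special P) := by
  choose nu hnu using fun o : Option J => show ∃ j, some j ≠ o by
    cases o with
    | none => exact ⟨Classical.arbitrary J, by simp⟩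
    | some k =>
      obtain ⟨j, hj⟩ := exists_ne k
      exact ⟨j, by simpa using hj⟩
  have hsp : ∀ j, ∃ f : Bool → P j, Function.Injective f ∧ ∀ c, f c ≠ 1 := by
    intro j
    obtain ⟨a, ha⟩ := exists_ne (1 : P j)
    obtain ⟨b, hb⟩ := ({1, a} : Set (P j)).toFinite.exists_notMem
    simp only [Set.mem_insert_iff, Set.mem_singleton_iff, not_or] at hb
    refine ⟨fun c => cond c a b, ?_, ?_⟩
    · rintro (_ | _) (_ | _) h
      · rfl
      · exact absurd h hb.2
      · exact absurd h.symm hb.2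
      · rfl
    · rintro (_ | _)
      · exact hb.1
      · exact ha
  choose sp h1 h2 using hsp
  exact ⟨⟨nu, hnu, sp, h1, h2⟩⟩

/-- Free products of two or more infinite groups are coarsely equivalent, respecting the types
of the cosets of factors, as soon as the same types occur on both sides and factors of the same
type are coarsely equivalent. -/
theorem exists_cinv_coprodI [Finite J] [Finite J'] [Nontrivial J] [Nontrivial J']
    [∀ j, Infinite (P j)] [∀ j, Infinite (Q j)] (t : J → I) (t' : J' → I)
    (htt : Set.range t = Set.range t')
    (hφ : ∀ j j', t j = t' j' → ∃ (φ : P j → Q j') (φ' : Q j' → P j), CInv φ φ') :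
    ∃ (f : CoprodI P → CoprodI Q) (f' : CoprodI Q → CoprodI P) (E : Set (CoprodI Q)),
      CInv f f' ∧ E.Finite ∧
      (∀ j g, ∃ j' g', t j = t' j' ∧ Matched f E (fcoset j g) (fcoset j' g')) ∧
      (∀ j' g', ∃ j g, t j = t' j' ∧ Matched f E (fcoset j g) (fcoset j' g')) := by
  obtain ⟨s⟩ := nonempty_special (P := P)
  obtain ⟨s'⟩ := nonempty_special (P := Q)
  obtain ⟨pr⟩ := exists_pairing s s' htt hφ
  obtain ⟨E₁, hE₁, h₁⟩ := pr.exists_matched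
  obtain ⟨E₂, hE₂, h₂⟩ := pr.symm.exists_matched
  obtain ⟨E₃, hE₃, h₃⟩ := pr.symm.cinv_tmap.exists_matched_symm hE₂
  refine ⟨_, _, E₁ ∪ E₃, pr.cinv_tmap, hE₁.union hE₃, fun j g => ?_, fun j' g' => ?_⟩
  · obtain ⟨j', g', hj, hm⟩ := h₁ j g
    exact ⟨j', g', hj, hm.mono Set.subset_union_left⟩
  · obtain ⟨j, g, hj, hm⟩ := h₂ j' g'
    exact ⟨j, g, hj.symm, (h₃ _ _ hm).mono Set.subset_union_right⟩

end

end

/-! ### Passing to kernels of maps from the factors of a free product onto `ℤˣ` -/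

noncomputable section

open Monoid

/-- A family of groups with epimorphisms onto `ℤˣ`, given with preimages of `-1`. -/
structure SignData {J : Type} (P : J → Type) [∀ j, Group (P j)] where
  sgn : ∀ j, P j →* ℤˣ
  elt : ∀ j, P j
  sgn_elt : ∀ j, sgn j (elt j) = -1
  base : J

namespace SignData

section
variable {J : Type} {P : J → Type} [∀ j, Group (P j)] (D : SignData P)

/-- The factors of the kernel of a free product. -/
def Fac : J ⊕ {j : J // j ≠ D.base} → Type
  | .inl j => (D.sgn j).ker
  | .inr _ => Multiplicative ℤ

instance instGroupFac : ∀ i, Group (D.Fac i)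
  | .inl j => inferInstanceAs (Group (D.sgn j).ker)
  | .inr _ => inferInstanceAs (Group (Multiplicative ℤ))

/-- The chosen preimages of the elements of `ℤˣ`. -/
def tr (j : J) (r : ℤˣ) : P j := if r = 1 then 1 else D.elt j

@[simp] theorem tr_one (j : J) : D.tr j 1 = 1 := by simp [tr]

@[simp] theorem tr_neg_one (j : J) : D.tr j (-1) = D.elt j := by
  simp [tr]

@[simp] theorem sgn_tr (j : J) (r : ℤˣ) : D.sgn j (D.tr j r) = r := by
  rcases Int.units_eq_one_or r with rfl | rfl
  · simp
  · simp [D.sgn_elt]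

/-- The inclusion of a kernel as a factor. -/
def inc (j : J) : (D.sgn j).ker →* CoprodI D.Fac := CoprodI.of (M := D.Fac) (i := .inl j)

/-- The inclusion of an infinite cyclic factor. -/
def zinc (j : {j : J // j ≠ D.base}) : Multiplicative ℤ →* CoprodI D.Fac :=
  CoprodI.of (M := D.Fac) (i := .inr j)

open Classical in
/-- The extra free generators. -/
def gen (j : J) : CoprodI D.Fac :=
  if h : j = D.base then 1 else D.zinc ⟨j, h⟩ (Multiplicative.ofAdd 1)

/-- The extra free generators, as functions on `ℤˣ`. -/
def Y (j : J) (r : ℤˣ) : CoprodI D.Fac := if r = 1 then 1 else D.gen j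

@[simp] theorem Y_one (j : J) : D.Y j 1 = 1 := by simp [Y]

@[simp] theorem Y_neg_one (j : J) : D.Y j (-1) = D.gen j := by
  simp [Y]

@[simp] theorem gen_base : D.gen D.base = 1 := by simp [gen]

/-- The component in the kernel. -/
def kpart (j : J) (p : P j) (r : ℤˣ) : (D.sgn j).ker :=
  ⟨(D.tr j (r * D.sgn j p))⁻¹ * p * D.tr j r, by
    simp only [MonoidHom.mem_ker, map_mul, map_inv, sgn_tr]
    rw [mul_assoc, mul_comm (D.sgn j p), inv_mul_cancel]⟩

/-- The cocycle of the action. -/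
def coc (j : J) (p : P j) (r : ℤˣ) : CoprodI D.Fac :=
  D.Y j (r * D.sgn j p) * D.inc j (D.kpart j p r) * (D.Y j r)⁻¹

/-- The action of a factor. -/
def facAct (j : J) : P j →* Function.End (CoprodI D.Fac × ℤˣ) where
  toFun p := fun x => (D.coc j p x.2 * x.1, x.2 * D.sgn j p)
  map_one' := by
    funext x
    have : D.kpart j 1 x.2 = 1 := by
      ext
      simp [kpart]
    refine Prod.ext ?_ ?_
    · simp [coc, this]
      rfl
    · simp
      rfl
  map_mul' p q := by
    funext x
    have : D.kpart j (p * q) x.2 = D.kpart j p (x.2 * D.sgn j q) * D.kpart j q x.2 := by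
      ext
      simp only [kpart, map_mul, Subgroup.coe_mul]
      rw [mul_assoc x.2, mul_comm (D.sgn j q)]
      group
    have h2 : x.2 * (D.sgn j p * D.sgn j q) = x.2 * D.sgn j q * D.sgn j p := by
      rw [mul_assoc, mul_comm (D.sgn j p)]
    show (_, _) = (_, _)
    ext
    · simp only [coc, this, map_mul, h2]
      group
    · simp [h2]

/-- The action of the free product. -/
def act : CoprodI P →* Equiv.Perm (CoprodI D.Fac × ℤˣ) :=
  CoprodI.lift fun j => (D.facAct j).toHomPerm

theorem act_of (j : J) (p : P j) (x : CoprodI D.Fac × ℤˣ) :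
    D.act (CoprodI.of p) x = (D.coc j p x.2 * x.1, x.2 * D.sgn j p) := by
  simp only [act, CoprodI.lift_of]
  rfl

/-- The map from the kernel to the free product, on factors. -/
def theta : CoprodI D.Fac →* CoprodI P :=
  CoprodI.lift fun i => match i with
    | .inl j => CoprodI.of.comp (D.sgn j).ker.subtype
    | .inr j => zpowersHom _ ((CoprodI.of (D.elt D.base))⁻¹ * CoprodI.of (D.elt j.1))

theorem theta_inc (j : J) (k : (D.sgn j).ker) : D.theta (D.inc j k) = CoprodI.of (k : P j) := by
  simp only [theta, inc]
  exact CoprodI.lift_of _ _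

theorem theta_zinc (j : {j : J // j ≠ D.base}) (m : Multiplicative ℤ) : D.theta (D.zinc j m) =
    ((CoprodI.of (D.elt D.base))⁻¹ * CoprodI.of (D.elt j.1)) ^ Multiplicative.toAdd m := by
  rw [← zpowersHom_apply]
  simp only [theta, zinc]
  exact CoprodI.lift_of _ _

theorem theta_gen (j : J) :
    D.theta (D.gen j) = (CoprodI.of (D.elt D.base))⁻¹ * CoprodI.of (D.elt j) := by
  unfold gen
  split_ifs with h
  · subst h
    simp
  · rw [theta_zinc]
    exact zpow_one _

theorem theta_Y (j : J) (r : ℤˣ) :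
    D.theta (D.Y j r) = (CoprodI.of (D.tr D.base r))⁻¹ * CoprodI.of (D.tr j r) := by
  rcases Int.units_eq_one_or r with rfl | rfl
  · simp
  · simp [theta_gen]

theorem gen_induction {p : CoprodI D.Fac → Prop} (inc : ∀ j k, p (D.inc j k))
    (gen : ∀ j, p (D.gen j)) (one : p 1) (mul : ∀ a b, p a → p b → p (a * b))
    (inv : ∀ a, p a → p a⁻¹) (h : CoprodI D.Fac) : p h := by
  induction h using CoprodI.induction_on with
  | one => exact one
  | mul a b ha hb => exact mul a b ha hb
  | of i m =>
    match i, m with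
    | .inl j, m => exact inc j m
    | .inr j, m =>
      have h1 : ∀ n : ℕ, p (D.gen j ^ n) := by
        intro n
        induction n with
        | zero => simpa using one
        | succ n ih => rw [pow_succ]; exact mul _ _ ih (gen _)
      have h2 : ∀ n : ℤ, p (D.gen j ^ n) := by
        intro n
        obtain ⟨n, rfl | rfl⟩ := n.eq_nat_or_neg
        · rw [zpow_natCast]
          exact h1 n
        · rw [zpow_neg, zpow_natCast]
          exact inv _ (h1 n)
      have h3 := h2 (Multiplicative.toAdd (α := ℤ) m)
      have h4 : D.gen j = D.zinc j (Multiplicative.ofAdd 1) := by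
        unfold SignData.gen
        rw [dif_neg j.2]
      rw [h4, ← map_zpow, ← ofAdd_zsmul] at h3
      rw [smul_eq_mul, mul_one] at h3
      exact h3

/-- The comparison map. -/
def gam (x : CoprodI D.Fac × ℤˣ) : CoprodI P := CoprodI.of (D.tr D.base x.2) * D.theta x.1

theorem gam_act (g : CoprodI P) (x : CoprodI D.Fac × ℤˣ) : D.gam (D.act g x) = g * D.gam x := by
  induction g using CoprodI.induction_on generalizing x with
  | one => simp
  | mul a b ha hb => simp [ha, hb, mul_assoc]
  | of j p =>
    rw [act_of]
    simp only [gam, coc, map_mul, theta_Y, map_inv, theta_inc, kpart]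
    group

theorem act_elt (j : J) (h : CoprodI D.Fac) :
    D.act (CoprodI.of (D.elt j)) (h, 1) = (D.gen j * h, -1) := by
  have : D.kpart j (D.elt j) 1 = 1 := by
    ext
    simp [kpart, D.sgn_elt]
  simp [act_of, coc, D.sgn_elt, this]

theorem act_theta (h h' : CoprodI D.Fac) : D.act (D.theta h) (h', 1) = (h * h', 1) := by
  induction h using D.gen_induction generalizing h' with
  | one => simp
  | mul a b ha hb => simp [ha, hb, mul_assoc]
  | inv a ha =>
    rw [map_inv, map_inv, Equiv.Perm.inv_eq_iff_eq, ha]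
    simp
  | inc j k =>
    have h1 : D.sgn j k = 1 := k.2
    have : D.kpart j k 1 = k := by
      ext
      simp [kpart, h1]
    simp [theta_inc, act_of, coc, h1, this]
  | gen j =>
    rw [theta_gen, map_mul, Equiv.Perm.mul_apply, act_elt, map_inv, Equiv.Perm.inv_eq_iff_eq,
      act_elt]
    simp

/-- The map from a free product to its kernel. -/
def down (g : CoprodI P) : CoprodI D.Fac := (D.act g (1, 1)).1

theorem gam_down (g : CoprodI P) : D.gam (D.act g (1, 1)) = g := by
  rw [gam_act]
  simp [gam]

theorem down_theta (h : CoprodI D.Fac) : D.down (D.theta h) = h := by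
  simp [down, act_theta]

theorem down_of_mul (j : J) (p : P j) (g : CoprodI P) :
    D.down (CoprodI.of p * g) = D.coc j p (D.act g (1, 1)).2 * D.down g := by
  simp [down, act_of]

theorem cinv_down : CInv D.down D.theta := by
  refine ⟨CMap.of_closure coprodI_closure ?_, CMap.of_hom _, ?_, Near.of_eq D.down_theta⟩
  · intro s hs
    obtain ⟨j, p, rfl⟩ : ∃ j, ∃ p : P j, CoprodI.of p = s := by simpa using hs
    refine ⟨_, Set.finite_range (D.coc j p), fun g => ⟨(D.act g (1, 1)).2, ?_⟩⟩
    simp [down_of_mul]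
  · refine ⟨_, Set.finite_range fun r => (CoprodI.of (D.tr D.base r))⁻¹,
      fun g => ⟨(D.act g (1, 1)).2, ?_⟩⟩
    conv_rhs => enter [2]; rw [← D.gam_down g]
    simp [gam, down]

theorem matched_down (j : J) (g : CoprodI P) :
    Matched D.down (Set.range (D.Y j)) (fcoset j g)
      (fcoset (P := D.Fac) (.inl j) ((D.Y j (D.act g (1, 1)).2)⁻¹ * D.down g)) := by
  constructor
  · rintro _ ⟨p, rfl⟩
    refine ⟨D.inc j (D.kpart j p (D.act g (1, 1)).2) * _, ⟨_, rfl⟩, (D.act g (1, 1)).2 * D.sgn j p, ?_⟩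
    rw [down_of_mul, coc]
    group
  · rintro _ ⟨k, rfl⟩
    change (D.sgn j).ker at k
    change ∃ x ∈ _, D.down x * (D.inc j k * _)⁻¹ ∈ _
    refine ⟨_, ⟨(k : P j) * (D.tr j (D.act g (1, 1)).2)⁻¹, rfl⟩, 1, ?_⟩
    rw [down_of_mul, coc]
    generalize (D.act g (1, 1)).2 = r
    have hk : D.sgn j k = 1 := k.2
    have h1 : r * D.sgn j ((k : P j) * (D.tr j r)⁻¹) = 1 := by simp [hk]
    have h2 : D.kpart j ((k : P j) * (D.tr j r)⁻¹) r = k := by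
      ext
      simp only [kpart]
      rw [h1]
      simp
    rw [h1, h2]
    group

/-- A free product is coarsely equivalent to a free product of the kernels and infinite cyclic
groups, with matching cosets of factors. -/
theorem exists_matched [Finite J] : ∃ E : Set (CoprodI D.Fac), E.Finite ∧
    (∀ j g, ∃ g', Matched D.down E (fcoset j g) (fcoset (P := D.Fac) (.inl j) g')) ∧
    (∀ j g', ∃ g, Matched D.down E (fcoset j g) (fcoset (P := D.Fac) (.inl j) g')) := by
  refine ⟨⋃ j, Set.range (D.Y j), Set.finite_iUnion fun j => Set.finite_range _,
    fun j g => ⟨_, (D.matched_down j g).mono (Set.subset_iUnion _ j)⟩,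
    fun j g' => ⟨D.theta g', ?_⟩⟩
  have := (D.matched_down j (D.theta g')).mono (Set.subset_iUnion (fun j => Set.range (D.Y j)) j)
  rw [down_theta, act_theta] at this
  simpa using this

theorem exists_cinv_ker (j : J) : ∃ (f : P j → (D.sgn j).ker), CInv f (fun k => (k : P j)) := by
  refine ⟨fun p => ⟨(D.tr j (D.sgn j p))⁻¹ * p, by simp [MonoidHom.mem_ker]⟩, ?_,
    CMap.of_hom (D.sgn j).ker.subtype, ?_, Near.of_eq ?_⟩
  · intro s
    refine ⟨Set.range fun r => D.kpart j s r, Set.finite_range _, fun g => ⟨D.sgn j g, ?_⟩⟩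
    ext
    simp only [kpart, map_mul, Subgroup.coe_mul, Subgroup.coe_inv]
    rw [mul_comm (D.sgn j s)]
    group
  · exact ⟨_, Set.finite_range fun r => (D.tr j r)⁻¹, fun g => ⟨D.sgn j g, by simp⟩⟩
  · intro k
    ext
    have hk : D.sgn j k = 1 := k.2
    simp [hk]

theorem infinite_ker (j : J) [Infinite (P j)] : Infinite (D.sgn j).ker := by
  by_contra h
  rw [not_infinite_iff_finite] at h
  refine not_finite_iff_infinite.mpr ‹Infinite (P j)› ?_
  refine Finite.of_surjective (fun q : ℤˣ × (D.sgn j).ker => D.tr j q.1 * q.2) fun p =>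
    ⟨(D.sgn j p, ⟨(D.tr j (D.sgn j p))⁻¹ * p, by simp [MonoidHom.mem_ker]⟩), by simp⟩

end

end SignData

end

/-! ### Malnormality of factors and restriction to cosets -/

noncomputable section

open Monoid

open scoped Pointwise

/-- The set of points within `E` of `C`. -/
def nbhd {H : Type*} [Group H] (E C : Set H) : Set H := {h | ∃ y ∈ C, h * y⁻¹ ∈ E}

/-- Coarse embeddings. -/
structure CEmb {G H : Type*} [Group G] [Group H] (f : G → H) : Prop where
  map : CMap f
  proper : ∀ E : Set H, E.Finite → ∃ E' : Set G, E'.Finite ∧ ∀ x y, f x * (f y)⁻¹ ∈ E →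
    x * y⁻¹ ∈ E'

section
variable {X G H : Type*} [Group G] [Group H]

theorem CInv.emb {f : G → H} {f' : H → G} (h : CInv f f') : CEmb f := by
  refine ⟨h.map, fun E hE => ?_⟩
  obtain ⟨E', hE', h'⟩ := h.reflect (X := {q : G × G // f q.1 * (f q.2)⁻¹ ∈ E})
    (a := fun q => q.1.1) (b := fun q => q.1.2) ⟨E, hE, fun q => q.2⟩
  exact ⟨E', hE', fun x y hxy => h' ⟨(x, y), hxy⟩⟩

theorem CEmb.reflect {f : G → H} (hf : CEmb f) {a b : X → G}
    (h : Near (fun x => f (a x)) (fun x => f (b x))) : Near a b := by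
  obtain ⟨E, hE, h⟩ := h
  obtain ⟨E', hE', h'⟩ := hf.proper E hE
  exact ⟨E', hE', fun x => h' _ _ (h x)⟩

theorem CEmb.image_infinite {f : G → H} (hf : CEmb f) {A : Set G} (hA : A.Infinite) :
    (f '' A).Infinite := by
  intro hfin
  obtain ⟨E, hE, h⟩ := hf.proper (f '' A * (f '' A)⁻¹) (hfin.mul hfin.inv)
  obtain ⟨a, ha⟩ := hA.nonempty
  refine hA ((hE.image fun e => e * a).subset fun x hx => ⟨x * a⁻¹, h _ _ ?_, by simp⟩)
  exact Set.mul_mem_mul ⟨x, hx, rfl⟩ (Set.inv_mem_inv.mpr ⟨a, ha, rfl⟩)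

theorem CEmb.of_hom {f : G →* H} (hf : Function.Injective f) : CEmb f :=
  ⟨CMap.of_hom f, fun E hE => ⟨f ⁻¹' E, hE.preimage hf.injOn, fun x y h => by simpa using h⟩⟩

theorem CEmb.comp {K : Type*} [Group K] {k : H → K} {f : G → H} (hk : CEmb k) (hf : CEmb f) :
    CEmb fun x => k (f x) := by
  refine ⟨hk.map.comp hf.map, fun E hE => ?_⟩
  obtain ⟨E₁, hE₁, h₁⟩ := hk.proper E hE
  obtain ⟨E₂, hE₂, h₂⟩ := hf.proper E₁ hE₁
  exact ⟨E₂, hE₂, fun x y h => h₂ _ _ (h₁ _ _ h)⟩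

/-- A map near a coset of a subgroup induces a coarse embedding into the subgroup. -/
theorem CEmb.exists_lift {A B : Type*} [Group A] [Group B] {f : A → H} (hf : CEmb f)
    {ι : B →* H} (hι : Function.Injective ι) {h : H} {E : Set H} (hE : E.Finite)
    (hm : ∀ a, f a ∈ nbhd E {x | ∃ b, x = ι b * h}) :
    ∃ φ : A → B, CEmb φ ∧ ∀ a, f a * (ι (φ a) * h)⁻¹ ∈ E := by
  have : ∀ a, ∃ b, f a * (ι b * h)⁻¹ ∈ E := by
    intro a
    obtain ⟨_, ⟨b, rfl⟩, hb⟩ := hm a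
    exact ⟨b, hb⟩
  choose φ hφ using this
  have hn : Near f (fun a => ι (φ a) * h) := ⟨E, hE, hφ⟩
  refine ⟨φ, ⟨fun s => (CEmb.of_hom hι).reflect ?_, fun D hD => ?_⟩, hφ⟩
  · have h1 := ((hn.comp fun g => s * g).symm.trans (hf.map s)).trans hn
    simpa using h1.mul_right fun _ => h⁻¹
  · obtain ⟨E', hE', h'⟩ := hf.reflect (X := {q : A × A // φ q.1 * (φ q.2)⁻¹ ∈ D})
      (a := fun q => q.1.1) (b := fun q => q.1.2) (by
        refine (hn.comp _).trans (Near.trans ?_ (hn.comp _).symm)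
        refine ⟨ι '' D, hD.image _, fun q => ⟨_, q.2, ?_⟩⟩
        simp)
    exact ⟨E', hE', fun x y hxy => h' ⟨(x, y), hxy⟩⟩

theorem CEmb.exists_cinv {f : G → H} (hf : CEmb f) {E : Set H} (hE : E.Finite)
    (h : ∀ y, ∃ x, f x * y⁻¹ ∈ E) : ∃ f', CInv f f' := by
  choose f' h' using h
  have hr : Near (fun y => f (f' y)) (fun y => y) := ⟨E, hE, h'⟩
  refine ⟨f', hf.map, fun s => hf.reflect ?_, hf.reflect (hr.comp f), hr⟩
  exact ((hr.comp fun g => s * g).trans (CMap.id s)).trans hr.symm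

/-- Restriction of a coarse equivalence to matched cosets. -/
theorem CInv.exists_restrict {A B : Type*} [Group A] [Group B] {f : G → H} {f' : H → G}
    (hf : CInv f f') {ι : A →* G} (hι : Function.Injective ι) {ι' : B →* H}
    (hι' : Function.Injective ι') {g : G} {h : H} {E : Set H} (hE : E.Finite)
    (hm : Matched f E {x | ∃ a, x = ι a * g} {x | ∃ b, x = ι' b * h}) :
    ∃ (φ : A → B) (φ' : B → A), CInv φ φ' := by
  have hk : CEmb fun a => ι a * g := by
    refine ⟨fun s => ⟨{ι s}, Set.finite_singleton _, fun x => by simp⟩, fun D hD => ?_⟩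
    exact ⟨ι ⁻¹' D, hD.preimage hι.injOn, fun x y h => by simpa using h⟩
  obtain ⟨φ, hφ, hφE⟩ := (hf.emb.comp hk).exists_lift hι' hE
    (fun a => hm.1 (ι a * g) ⟨a, rfl⟩)
  obtain ⟨φ', hφ'⟩ := hφ.exists_cinv
    (E := ι' ⁻¹' (E⁻¹ * E)) ((hE.inv.mul hE).preimage hι'.injOn) (fun b => by
      obtain ⟨_, ⟨a, rfl⟩, ha⟩ := hm.2 (ι' b * h) ⟨b, rfl⟩
      refine ⟨a, ?_⟩
      have := Set.mul_mem_mul (Set.inv_mem_inv.mpr (hφE a)) ha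
      simpa [mul_assoc] using this)
  exact ⟨φ, φ', hφ'⟩

end

section
variable {J : Type} {P : J → Type}

/-- The label of the last letter. -/
def lastLab (w : List (Σ j, P j)) : Option J := w.getLast?.map Sigma.fst

@[simp] theorem lastLab_concat (w : List (Σ j, P j)) (l : Σ j, P j) :
    lastLab (w ++ [l]) = some l.1 := by simp [lastLab]

@[simp] theorem headLab_singleton (l : Σ j, P j) : headLab [l] = some l.1 := by simp [headLab]

theorem headLab_append {w w' : List (Σ j, P j)} (h : w ≠ []) :
    headLab (w ++ w') = headLab w := by
  cases w with
  | nil => exact absurd rfl h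
  | cons l w => simp [headLab]

end

section
variable {J : Type} {P : J → Type} [∀ j, Group (P j)]

theorem red_append {w w' : List (Σ j, P j)} : Red (w ++ w') ↔
    Red w ∧ Red w' ∧ ∀ j, lastLab w = some j → headLab w' ≠ some j := by
  unfold Red lastLab headLab
  rw [List.isChain_append]
  constructor
  · rintro ⟨h1, h2, h3, h4⟩
    refine ⟨⟨fun l hl => h1 l (by simp [hl]), h2⟩, ⟨fun l hl => h1 l (by simp [hl]), h3⟩, ?_⟩
    intro j hj hj'
    obtain ⟨k, hk, hkj⟩ := Option.map_eq_some_iff.mp hj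
    obtain ⟨k', hk', hkj'⟩ := Option.map_eq_some_iff.mp hj'
    exact h4 k hk k' hk' (hkj.trans hkj'.symm)
  · rintro ⟨⟨h1, h2⟩, ⟨h3, h4⟩, h5⟩
    refine ⟨fun l hl => ?_, h2, h4, fun k hk k' hk' e => ?_⟩
    · rcases List.mem_append.mp hl with h | h
      · exact h1 l h
      · exact h3 l h
    · exact h5 k.1 (Option.map_eq_some_iff.mpr ⟨k, hk, rfl⟩)
        (Option.map_eq_some_iff.mpr ⟨k', hk', e.symm⟩)

theorem red_singleton {l : Σ j, P j} : Red [l] ↔ l.2 ≠ 1 := by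
  rw [red_cons]
  simp [headLab, Red.nil]

theorem wprod_injective {w w' : List (Σ j, P j)} (h : Red w) (h' : Red w')
    (e : wprod w = wprod w') : w = w' := by
  rw [← gword_wprod h, e, gword_wprod h']

/-- Factors of free products are malnormal. -/
theorem malnormal {j j' : J} {p : P j} {q : P j'} {g : CoprodI P} (hp : p ≠ 1)
    (h : CoprodI.of p * g = g * CoprodI.of q) : j = j' ∧ ∃ r : P j', g = CoprodI.of r := by
  have hq : q ≠ 1 := by
    rintro rfl
    refine hp (CoprodI.of_injective j ?_)
    simpa using h
  obtain ⟨p0, w, hw, hw', rfl⟩ := exists_tail j g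
  set p' := p0⁻¹ * p * p0 with hp'
  have hp1 : p' ≠ 1 := by
    intro h1
    refine hp ?_
    have : p = p0 * p' * p0⁻¹ := by rw [hp']; group
    rw [this, h1]; group
  have h2 : CoprodI.of p' * wprod w = wprod w * CoprodI.of q := by
    have : CoprodI.of p' = (CoprodI.of p0)⁻¹ * CoprodI.of p * CoprodI.of p0 := by simp [hp']
    rw [this, mul_assoc, mul_assoc, h]
    group
  clear_value p'
  clear h
  have key : ∀ (w : List (Σ j, P j)) (q : P j'), q ≠ 1 → Red w → headLab w ≠ some j →
      lastLab w ≠ some j' → CoprodI.of p' * wprod w = wprod w * CoprodI.of q →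
      w = [] ∧ j = j' := by
    intro w q hq hw hw' hl e
    have e' : (⟨j, p'⟩ :: w : List (Σ j, P j)) = w ++ [⟨j', q⟩] := by
      apply wprod_injective
      · exact red_cons.mpr ⟨hp1, hw', hw⟩
      · rw [red_append]
        exact ⟨hw, red_singleton.mpr hq, fun i hi hi' => hl (by simp at hi'; rw [hi, hi'])⟩
      · simpa using e
    cases w with
    | nil =>
      simp at e'
      exact ⟨rfl, e'.1⟩
    | cons l w =>
      simp only [List.cons_append, List.cons.injEq] at e'
      rw [← e'.1] at hw'
      simp [headLab] at hw'
  by_cases hl : lastLab w = some j'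
  · rcases List.eq_nil_or_concat w with rfl | ⟨w, ⟨i, x⟩, rfl⟩
    · simp [lastLab] at hl
    · rw [List.concat_eq_append] at *
      rw [lastLab_concat, Option.some.injEq] at hl
      subst hl
      rw [red_append] at hw
      obtain ⟨h3, -, h4⟩ := hw
      have hx : x * q * x⁻¹ ≠ 1 := by
        intro h5
        apply hq
        have : q = x⁻¹ * (x * q * x⁻¹) * x := by group
        rw [this, h5]; group
      have h5 : CoprodI.of p' * wprod w = wprod w * CoprodI.of (x * q * x⁻¹) := by
        simp only [wprod_append, wprod_cons, wprod_nil, mul_one] at h2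
        simp only [map_mul, map_inv]
        have h6 := congrArg (· * (CoprodI.of x)⁻¹) h2
        simpa [mul_assoc] using h6
      obtain ⟨rfl, rfl⟩ := key w _ hx h3 (by
        by_cases h6 : w = []
        · subst h6; simp [headLab]
        · rwa [headLab_append h6] at hw')
        (fun h6 => h4 _ h6 (by simp)) h5
      simp at hw'
  · obtain ⟨rfl, rfl⟩ := key w q hq hw hw' hl h2
    exact ⟨rfl, p0, by simp⟩

/-- Neighbourhoods of distinct cosets of factors have finite intersection. -/
theorem eq_of_infinite_inter {E E' : Set (CoprodI P)} (hE : E.Finite) (hE' : E'.Finite)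
    {j j' : J} {g g' : CoprodI P}
    (h : (nbhd E (fcoset j g) ∩ nbhd E' (fcoset j' g')).Infinite) :
    j = j' ∧ fcoset j g = fcoset j' g' := by
  by_contra hne
  refine h ?_
  have hsub : nbhd E (fcoset j g) ∩ nbhd E' (fcoset j' g') ⊆ ⋃ e ∈ E, ⋃ e' ∈ E',
      {x | (∃ p : P j, x = e * (CoprodI.of p * g)) ∧
        ∃ q : P j', x = e' * (CoprodI.of q * g')} := by
    rintro x ⟨⟨_, ⟨p, rfl⟩, hx⟩, ⟨_, ⟨q, rfl⟩, hx'⟩⟩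
    refine Set.mem_biUnion hx (Set.mem_biUnion hx' ⟨⟨p, ?_⟩, ⟨q, ?_⟩⟩) <;>
    exact (inv_mul_cancel_right x _).symm
  refine (hE.biUnion fun e _ => hE'.biUnion fun e' _ => Set.Subsingleton.finite ?_).subset hsub
  rintro x ⟨⟨p, hp⟩, q, hq⟩ y ⟨⟨p', hp'⟩, q', hq'⟩
  by_contra hxy
  have hpp : p⁻¹ * p' ≠ 1 := by
    intro h1
    refine hxy ?_
    rw [hp, hp', inv_mul_eq_one.mp h1]
  have e1 : x⁻¹ * y = g⁻¹ * (CoprodI.of (p⁻¹ * p') * g) := by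
    rw [hp, hp']
    simp only [map_mul, map_inv]
    group
  have e2 : x⁻¹ * y = g'⁻¹ * (CoprodI.of (q⁻¹ * q') * g') := by
    rw [hq, hq']
    simp only [map_mul, map_inv]
    group
  have e3 : CoprodI.of (p⁻¹ * p') * (g * g'⁻¹) = (g * g'⁻¹) * CoprodI.of (q⁻¹ * q') := by
    have := e1.symm.trans e2
    rw [inv_mul_eq_iff_eq_mul] at this
    rw [← mul_assoc, this]
    group
  obtain ⟨rfl, r, hr⟩ := malnormal hpp e3
  refine hne ⟨rfl, ?_⟩
  rw [mul_inv_eq_iff_eq_mul.mp hr, fcoset_of_mul]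

theorem fcoset_infinite (j : J) [Infinite (P j)] (g : CoprodI P) : (fcoset j g).Infinite := by
  have : fcoset j g = Set.range fun p : P j => CoprodI.of p * g := by
    ext x; simp [fcoset, eq_comm]
  rw [this]
  refine Set.infinite_range_of_injective fun p q h => CoprodI.of_injective j ?_
  simpa using h

theorem self_subset_nbhd {H : Type*} [Group H] {E C : Set H} (hE : 1 ∈ E) : C ⊆ nbhd E C :=
  fun x hx => ⟨x, hx, by simpa using hE⟩

/-- A coset near another coset is equal to it. -/
theorem eq_of_fcoset_subset_nbhd {E : Set (CoprodI P)} (hE : E.Finite) {j j' : J}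
    [Infinite (P j)] {g g' : CoprodI P} (h : fcoset j g ⊆ nbhd E (fcoset j' g')) :
    j = j' ∧ fcoset j g = fcoset j' g' := by
  refine eq_of_infinite_inter (Set.finite_singleton 1) hE
    ((fcoset_infinite j g).mono (Set.subset_inter (self_subset_nbhd rfl) h))

end

end

/-! ### Coarsely embedded planes in free products -/

noncomputable section

open Monoid

open scoped Pointwise

/-- Closeness in the plane `ℤ × ℤ`. -/
def Close (R : ℤ) (x y : ℤ × ℤ) : Prop := |x.1 - y.1| ≤ R ∧ |x.2 - y.2| ≤ R

theorem eq_of_step {α : Type*} {l : ℤ → α} (h : ∀ n, l (n + 1) = l n) (m n : ℤ) : l m = l n := by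
  have h0 : ∀ n, l n = l 0 := by
    intro n
    induction n using Int.induction_on with
    | zero => rfl
    | succ n ih => rw [h, ih]
    | pred n ih => rw [← ih, ← h]; simp
  rw [h0 m, h0 n]

/-- A function that is constant along edges outside a square is constant outside the square. -/
theorem constant_outside {α : Type*} {l : ℤ × ℤ → α} {R : ℤ} {z : ℤ × ℤ}
    (h1 : ∀ x : ℤ × ℤ, ¬ Close R x z → ¬ Close R (x.1 + 1, x.2) z → l (x.1 + 1, x.2) = l x)
    (h2 : ∀ x : ℤ × ℤ, ¬ Close R x z → ¬ Close R (x.1, x.2 + 1) z → l (x.1, x.2 + 1) = l x) :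
    ∃ c, ∀ x, ¬ Close R x z → l x = c := by
  have row : ∀ n, ¬ |n - z.2| ≤ R → ∀ m m', l (m, n) = l (m', n) := fun n hn =>
    eq_of_step (l := fun m => l (m, n)) fun m =>
      h1 (m, n) (fun h => hn h.2) (fun h => hn h.2)
  have col : ∀ m, ¬ |m - z.1| ≤ R → ∀ n n', l (m, n) = l (m, n') := fun m hm =>
    eq_of_step (l := fun n => l (m, n)) fun n =>
      h2 (m, n) (fun h => hm h.1) (fun h => hm h.1)
  have far : ∀ t : ℤ, ¬ |z.1 + (|R| + 1) - z.1| ≤ R ∧ ¬ |z.2 + (|R| + 1) - z.2| ≤ R := by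
    intro t
    have := le_abs_self R
    have h3 := abs_nonneg R
    rw [add_sub_cancel_left, add_sub_cancel_left, abs_of_nonneg (by omega)]
    omega
  refine ⟨l (z.1 + (|R| + 1), z.2 + (|R| + 1)), fun x hx => ?_⟩
  unfold Close at hx
  rw [not_and_or] at hx
  rcases hx with hx | hx
  · rw [show x = (x.1, x.2) from rfl, col _ hx x.2 (z.2 + (|R| + 1)), row _ (far 0).2]
  · rw [show x = (x.1, x.2) from rfl, row _ hx x.1 (z.1 + (|R| + 1)), col _ (far 0).1]

/-- Two squares do not cover the plane. -/
theorem exists_outside (R : ℤ) (z z' : ℤ × ℤ) : ∃ x, ¬ Close R x z ∧ ¬ Close R x z' := by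
  refine ⟨(|z.1| + |z'.1| + |R| + 1, 0), ?_⟩
  have a1 := le_abs_self R
  have a2 := le_abs_self z.1
  have a3 := le_abs_self z'.1
  have a4 := abs_nonneg z.1
  have a5 := abs_nonneg z'.1
  have a6 := abs_nonneg R
  constructor
  · intro h
    have := (le_abs_self _).trans h.1
    dsimp only at this
    omega
  · intro h
    have := (le_abs_self _).trans h.1
    dsimp only at this
    omega

/-- The elements `a ^ m * b ^ n`. -/
def plane {G : Type*} [Group G] (a b : G) (x : ℤ × ℤ) : G := a ^ x.1 * b ^ x.2

/-- Commuting elements that are independent. -/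
structure Indep {G : Type*} [Group G] (a b : G) : Prop where
  comm : Commute a b
  inj : Function.Injective (plane a b)

section
variable {G H : Type*} [Group G] [Group H] {a b : G}

theorem plane_mul_inv (h : Commute a b) (x y : ℤ × ℤ) :
    plane a b x * (plane a b y)⁻¹ = plane a b (x - y) := by
  have h1 := (h.zpow_zpow y.1 (x.2 - y.2)).eq
  simp only [plane, mul_inv_rev, Prod.fst_sub, Prod.snd_sub]
  calc a ^ x.1 * b ^ x.2 * ((b ^ y.2)⁻¹ * (a ^ y.1)⁻¹)
      = a ^ x.1 * (b ^ (x.2 - y.2) * (a ^ y.1)) * ((a ^ y.1)⁻¹ * (a ^ y.1)⁻¹) := by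
        rw [zpow_sub]; group
    _ = a ^ (x.1 - y.1) * b ^ (x.2 - y.2) := by
        rw [← h1, zpow_sub]
        have h2 := (h.zpow_zpow (-y.1) (x.2 - y.2)).eq
        rw [zpow_neg] at h2
        have h3 : b ^ (x.2 - y.2) * (a ^ y.1)⁻¹ * (a ^ y.1)⁻¹ =
          (a ^ y.1)⁻¹ * (a ^ y.1)⁻¹ * b ^ (x.2 - y.2) := by
          rw [← h2, mul_assoc, ← h2, mul_assoc]
        calc _ = a ^ x.1 * a ^ y.1 * (b ^ (x.2 - y.2) * (a ^ y.1)⁻¹ * (a ^ y.1)⁻¹) := by group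
          _ = _ := by rw [h3]; group

theorem plane_succ_fst (x : ℤ × ℤ) : plane a b (x.1 + 1, x.2) = a * plane a b x := by
  simp only [plane]
  rw [add_comm, zpow_add, zpow_one, mul_assoc]

theorem plane_succ_snd (h : Commute a b) (x : ℤ × ℤ) :
    plane a b (x.1, x.2 + 1) = b * plane a b x := by
  simp only [plane]
  have h1 := (h.zpow_left x.1).eq
  rw [add_comm, zpow_add, zpow_one, ← mul_assoc, h1, mul_assoc]

theorem Indep.map {K : Type*} [Group K] (h : Indep a b) {f : G →* K}
    (hf : Function.Injective f) : Indep (f a) (f b) := by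
  refine ⟨h.comm.map f, fun x y e => h.inj (hf ?_)⟩
  simpa [plane] using e

theorem exists_radius {S : Set (ℤ × ℤ)} (hS : S.Finite) :
    ∃ R : ℤ, ∀ x ∈ S, |x.1| ≤ R ∧ |x.2| ≤ R := by
  obtain ⟨R, hR⟩ := (hS.image fun x => max |x.1| |x.2|).bddAbove
  refine ⟨R, fun x hx => ?_⟩
  have := hR ⟨x, hx, rfl⟩
  exact max_le_iff.mp this

theorem CEmb.plane_radius {f : G → H} (hf : CEmb f) (hab : Indep a b) {E : Set H}
    (hE : E.Finite) : ∃ R : ℤ, ∀ g x y,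
      f (plane a b x * g) * (f (plane a b y * g))⁻¹ ∈ E → Close R x y := by
  obtain ⟨E', hE', h'⟩ := hf.proper E hE
  obtain ⟨R, hR⟩ := exists_radius (hE'.preimage hab.inj.injOn)
  refine ⟨R, fun g x y hxy => hR (x - y) ?_⟩
  have := h' _ _ hxy
  simpa [← plane_mul_inv hab.comm] using this

theorem CEmb.plane_bounded {f : G → H} (hf : CEmb f) (hab : Indep a b) (R : ℤ) :
    ∃ E : Set H, E.Finite ∧ ∀ g x y, Close R x y →
      f (plane a b x * g) * (f (plane a b y * g))⁻¹ ∈ E := by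
  have hfin : (plane a b '' (Set.Icc (-R) R ×ˢ Set.Icc (-R) R)).Finite :=
    ((Set.finite_Icc _ _).prod (Set.finite_Icc _ _)).image _
  obtain ⟨E, hE, h⟩ := hf.map.exists_finite hfin
  refine ⟨E, hE, fun g x y hxy => h _ _ ⟨x - y, ⟨?_, ?_⟩, ?_⟩⟩
  · exact abs_le.mp hxy.1
  · exact abs_le.mp hxy.2
  · rw [← plane_mul_inv hab.comm]
    group

theorem CEmb.exists_step {f : G → H} (hf : CEmb f) (hab : Commute a b) :
    ∃ F : Set H, F.Finite ∧ ∀ g x,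
      (∃ s ∈ F, f (plane a b (x.1 + 1, x.2) * g) = s * f (plane a b x * g)) ∧
      (∃ s ∈ F, f (plane a b (x.1, x.2 + 1) * g) = s * f (plane a b x * g)) := by
  obtain ⟨F, hF, h⟩ := hf.map a
  obtain ⟨F', hF', h'⟩ := hf.map b
  refine ⟨F ∪ F', hF.union hF', fun g x => ⟨⟨_, Or.inl (h (plane a b x * g)), ?_⟩,
    ⟨_, Or.inr (h' (plane a b x * g)), ?_⟩⟩⟩
  · rw [plane_succ_fst]; simp [mul_assoc]
  · rw [plane_succ_snd hab]; simp [mul_assoc]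

/-- A function on a group that is almost invariant is essentially constant on the translates of a
coarsely embedded plane. -/
theorem CEmb.plane_constant {α : Type*} {f : G → H} (hf : CEmb f) (hab : Indep a b) {l : H → α}
    (hl : ∀ s, {z | l (s * z) ≠ l z}.Finite) : ∃ (R : ℤ) (E : Set H), E.Finite ∧ 1 ∈ E ∧
    ∀ g c, ∃ k z, ∀ x, l (f (plane a b x * g) * c⁻¹) = k ∨
      (Close R x z ∧ f (plane a b x * g) * c⁻¹ ∈ E) := by
  obtain ⟨F, hF, hs⟩ := hf.exists_step hab.comm
  have hE₀ : (⋃ s ∈ F, {z | l (s * z) ≠ l z}).Finite := hF.biUnion fun s _ => hl s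
  set E₀ := ⋃ s ∈ F, {z | l (s * z) ≠ l z} with hE₀def
  obtain ⟨R, hR⟩ := hf.plane_radius hab (hE₀.mul hE₀.inv)
  obtain ⟨E₁, hE₁, h₁⟩ := hf.plane_bounded hab R
  refine ⟨R, E₁ * E₀ ∪ {1}, (hE₁.mul hE₀).union (Set.finite_singleton 1), by simp, fun g c => ?_⟩
  have step : ∀ s ∈ F, ∀ z, z ∉ E₀ → l (s * z) = l z := by
    intro s hs z hz
    by_contra h
    exact hz (Set.mem_biUnion hs h)
  have key : ∀ (R' : ℤ) z, (∀ x, f (plane a b x * g) * c⁻¹ ∈ E₀ → Close R' x z) →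
      ∃ k, ∀ x, ¬ Close R' x z → l (f (plane a b x * g) * c⁻¹) = k := by
    intro R' z hz
    refine constant_outside (l := fun x => l (f (plane a b x * g) * c⁻¹)) ?_ ?_
    · intro x hx _
      obtain ⟨s, hs, e⟩ := (hs g x).1
      rw [e, mul_assoc]
      exact step s hs _ fun h => hx (hz x h)
    · intro x hx _
      obtain ⟨s, hs, e⟩ := (hs g x).2
      rw [e, mul_assoc]
      exact step s hs _ fun h => hx (hz x h)
  by_cases hex : ∃ z, f (plane a b z * g) * c⁻¹ ∈ E₀
  · obtain ⟨z, hz⟩ := hex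
    obtain ⟨k, hk⟩ := key R z fun x hx => hR g x z (by
      have := Set.mul_mem_mul hx (Set.inv_mem_inv.mpr hz)
      simpa using this)
    refine ⟨k, z, fun x => ?_⟩
    by_cases hx : Close R x z
    · refine Or.inr ⟨hx, Or.inl ?_⟩
      have := Set.mul_mem_mul (h₁ g x z hx) hz
      simpa [mul_assoc] using this
    · exact Or.inl (hk x hx)
  · push Not at hex
    obtain ⟨k, hk⟩ := key (-1) (0, 0) fun x hx => absurd hx (hex x)
    refine ⟨k, (0, 0), fun x => Or.inl (hk x fun h => ?_)⟩
    have := (abs_nonneg _).trans h.1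
    omega

/-- The plane does not embed coarsely in the line. -/
theorem CEmb.not_line {f : G → Multiplicative ℤ} (hf : CEmb f) (hab : Indep a b) : False := by
  have hl : ∀ s : Multiplicative ℤ, {z : Multiplicative ℤ |
      (decide (0 < (s * z).toAdd)) ≠ (decide (0 < z.toAdd))}.Finite := by
    intro s
    refine ((Set.finite_Icc (-|s.toAdd|) |s.toAdd|).preimage
      (Multiplicative.toAdd.injective.injOn)).subset fun z hz => ?_
    have h1 := le_abs_self s.toAdd
    have h2 := neg_abs_le s.toAdd
    simp only [Set.mem_ofPred_eq, toAdd_mul, ne_eq, decide_eq_decide] at hz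
    simp only [Set.mem_preimage, Set.mem_Icc]
    omega
  obtain ⟨R, E, hE, h1E, h⟩ := hf.plane_constant hab (l := fun z => decide (0 < z.toAdd)) hl
  set φ : ℤ × ℤ → ℤ := fun x => (f (plane a b x * 1)).toAdd with hφ
  have hfin : ∀ D : Set ℤ, D.Finite → ∃ R' : ℤ, ∀ x, φ x ∈ D → Close R' x (0, 0) := by
    intro D hD
    have hD' : (Multiplicative.ofAdd '' D).Finite := hD.image _
    obtain ⟨R', hR'⟩ := hf.plane_radius hab
      (hD'.mul (Set.finite_singleton (f (plane a b (0, 0) * 1))⁻¹))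
    refine ⟨R', fun x hx => hR' 1 x (0, 0) ?_⟩
    exact Set.mul_mem_mul ⟨_, hx, rfl⟩ rfl
  have side : ∀ x₀, ∃ z, (∀ x, ¬ Close R x z → φ x₀ ≤ φ x) ∨ (∀ x, ¬ Close R x z → φ x ≤ φ x₀) := by
    intro x₀
    obtain ⟨k, z, hk⟩ := h 1 (f (plane a b x₀ * 1))
    refine ⟨z, ?_⟩
    have hk' : ∀ x, ¬ Close R x z → decide (0 < φ x - φ x₀) = k := by
      intro x hx
      rcases hk x with h | h
      · rw [← h, toAdd_mul, toAdd_inv, hφ]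
        rfl
      · exact absurd h.1 hx
    cases k with
    | true =>
      left
      intro x hx
      have := hk' x hx
      simp at this
      exact this.le
    | false =>
      right
      intro x hx
      have := hk' x hx
      simp at this
      exact this
  have far : ∀ (R' : ℤ) (z z' z'' : ℤ × ℤ), ∃ x, ¬ Close R' x z ∧ ¬ Close R' x z' ∧
      ¬ Close R' x z'' := by
    intro R' z z' z''
    obtain ⟨x, hx, hx'⟩ := exists_outside (|R'| + |z.1 - z'.1| + |z.2 - z'.2|) z z''
    have b1 := le_abs_self R'
    have b2 := abs_nonneg (z.1 - z'.1)
    have b3 := abs_nonneg (z.2 - z'.2)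
    have b0 := abs_nonneg R'
    refine ⟨x, fun h => hx ⟨h.1.trans (by omega), h.2.trans (by omega)⟩, fun h => hx ?_,
      fun h => hx' ⟨h.1.trans (by omega), h.2.trans (by omega)⟩⟩
    have h1 := h.1
    have h2 := h.2
    have c1 := abs_sub_le x.1 z'.1 z.1
    have c2 := abs_sub_le x.2 z'.2 z.2
    rw [abs_sub_comm z'.1] at c1
    rw [abs_sub_comm z'.2] at c2
    exact ⟨by omega, by omega⟩
  have fin_between : ∀ (p q : ℤ) (z z' : ℤ × ℤ),
      ¬ ∀ x, ¬ Close R x z → ¬ Close R x z' → p ≤ φ x ∧ φ x ≤ q := by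
    intro p q z z' hpq
    obtain ⟨R', hR'⟩ := hfin (Set.Icc p q) (Set.finite_Icc p q)
    obtain ⟨x, h1, h2, h3⟩ := far (max R R') z z' (0, 0)
    have m1 := le_max_left R R'
    have m2 := le_max_right R R'
    refine h3 ?_
    have := hR' x (hpq x (fun h => h1 ⟨h.1.trans m1, h.2.trans m1⟩)
      (fun h => h2 ⟨h.1.trans m1, h.2.trans m1⟩))
    exact ⟨this.1.trans m2, this.2.trans m2⟩
  have key : ∀ ψ : ℤ × ℤ → ℤ, (∀ x₀, ∃ z, (∀ x, ¬ Close R x z → ψ x₀ ≤ ψ x) ∨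
      (∀ x, ¬ Close R x z → ψ x ≤ ψ x₀)) → (∀ (p q : ℤ) (z z' : ℤ × ℤ),
      ¬ ∀ x, ¬ Close R x z → ¬ Close R x z' → p ≤ ψ x ∧ ψ x ≤ q) →
      ¬ ∃ z, ∀ x, ¬ Close R x z → ψ (0, 0) ≤ ψ x := by
    rintro ψ side fin ⟨z, hz⟩
    have b1 := le_abs_self R
    have h1 := fin (ψ (0, 0)) (max (ψ (0, 0)) (ψ (2 * |R| + 1, 0))) z z
    push Not at h1
    obtain ⟨x₁, hx₁, -, hx₁'⟩ := h1
    have h2 := hx₁' (hz x₁ hx₁)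
    obtain ⟨z₁, hz₁ | hz₁⟩ := side x₁
    · have h3 : Close R (0, 0) z₁ := by
        by_contra h
        exact absurd (hz₁ _ h) (not_le.mpr ((le_max_left _ _).trans_lt h2))
      have h4 : Close R (2 * |R| + 1, 0) z₁ := by
        by_contra h
        exact absurd (hz₁ _ h) (not_le.mpr ((le_max_right _ _).trans_lt h2))
      have h5 := abs_le.mp h3.1
      have h6 := abs_le.mp h4.1
      dsimp only at h5 h6
      omega
    · exact fin _ _ z z₁ fun x hx hx' => ⟨hz x hx, hz₁ x hx'⟩
  obtain ⟨z, hz | hz⟩ := side (0, 0)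
  · exact key φ side fin_between ⟨z, hz⟩
  · refine key (fun x => - φ x) (fun x₀ => ?_) (fun p q z z' h => ?_) ⟨z, fun x hx => ?_⟩
    · obtain ⟨z, hz | hz⟩ := side x₀
      · exact ⟨z, Or.inr fun x hx => neg_le_neg (hz x hx)⟩
      · exact ⟨z, Or.inl fun x hx => neg_le_neg (hz x hx)⟩
    · refine fin_between (-q) (-p) z z' fun x hx hx' => ?_
      have := h x hx hx'
      omega
    · exact neg_le_neg (hz x hx)

end

section
variable {J : Type} {P : J → Type} [∀ j, Group (P j)]

/-- The label of the last letter is almost invariant. -/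
theorem lastLab_almost_invariant (s : CoprodI P) :
    {z | lastLab (gword (s * z)) ≠ lastLab (gword z)}.Finite := by
  induction s using CoprodI.induction_on with
  | one => simp
  | mul s t hs ht =>
    refine (ht.union (hs.preimage (mul_right_injective t).injOn)).subset fun z hz => ?_
    by_contra hne
    simp only [Set.mem_union, Set.mem_ofPred_eq, Set.mem_preimage, not_or, not_not] at hne
    exact hz (by rw [mul_assoc, hne.2, hne.1])
  | of j p =>
    refine (Set.toFinite {1, CoprodI.of p⁻¹}).subset fun z hz => ?_
    by_contra hne
    simp only [Set.mem_insert_iff, Set.mem_singleton_iff, not_or] at hne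
    refine hz ?_
    obtain ⟨q, w, hw, hw', rfl⟩ := exists_tail j z
    rw [← mul_assoc, ← map_mul]
    have hgw : ∀ r : P j, r ≠ 1 → gword (CoprodI.of r * wprod w) = ⟨j, r⟩ :: w := fun r hr =>
      gword_wprod (w := ⟨j, r⟩ :: w) (red_cons.mpr ⟨hr, hw', hw⟩)
    cases w with
    | nil =>
      have hq : q ≠ 1 := by
        rintro rfl
        simp at hne
      have hpq : p * q ≠ 1 := by
        intro h
        refine hne.2 ?_
        rw [eq_inv_of_mul_eq_one_right h]
        simp
      rw [hgw _ hq, hgw _ hpq]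
      rfl
    | cons l w =>
      have hlast : ∀ r : P j, lastLab (gword (CoprodI.of r * wprod (l :: w))) =
          lastLab (l :: w) := by
        intro r
        by_cases hr : r = 1
        · rw [hr, map_one, one_mul, gword_wprod hw]
        · rw [hgw r hr]
          simp [lastLab]
      rw [hlast, hlast]

end

end

/-! ### Planes and one-ended subgroups are near cosets of factors -/

noncomputable section

open Monoid

open scoped Pointwise

theorem lastLab_eq_some {J : Type} {P : J → Type} {w : List (Σ j, P j)} {j : J} (h : lastLab w = some j) :
    ∃ (w' : List (Σ j, P j)) (p : P j), w = w' ++ [⟨j, p⟩] := by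
  rcases List.eq_nil_or_concat w with rfl | ⟨w', ⟨i, p⟩, rfl⟩
  · simp [lastLab] at h
  · rw [List.concat_eq_append, lastLab_concat, Option.some.injEq] at h
    subst h
    exact ⟨w', p, by simp⟩

theorem lastLab_eq_none {J : Type} {P : J → Type} {w : List (Σ j, P j)} (h : lastLab w = none) : w = [] := by
  simpa [lastLab] using h

section
variable {J : Type} {P : J → Type} [∀ j, Group (P j)] {G : Type*} [Group G] {a b : G}

theorem gword_append {w u : List (Σ j, P j)} {g : CoprodI P} (h : Red (w ++ u))
    (e : g * (wprod u)⁻¹ = wprod w) : gword g = w ++ u := by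
  rw [mul_inv_eq_iff_eq_mul.mp e, ← wprod_append, gword_wprod h]

/-- A coarsely embedded plane in a free product is near a coset of a factor. -/
theorem CEmb.exists_coset_plane {f : G → CoprodI P} (hf : CEmb f) (hab : Indep a b) :
    ∃ E : Set (CoprodI P), E.Finite ∧ ∀ g, ∃ j c, ∀ x,
      f (plane a b x * g) ∈ nbhd E (fcoset j c) := by
  obtain ⟨R, E, hE, h1E, h⟩ := hf.plane_constant hab (l := fun z => lastLab (gword z))
    lastLab_almost_invariant
  refine ⟨E, hE, fun g => ?_⟩
  set φ : ℤ × ℤ → CoprodI P := fun x => f (plane a b x * g) with hφ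
  let U : ℕ → Prop := fun n => ∃ (u : List (Σ j, P j)) (z : ℤ × ℤ), u.length = n ∧ Red u ∧
    ∀ x, ¬ Close R x z → u <:+ gword (φ x)
  have hU0 : U 0 := ⟨[], (0, 0), rfl, Red.nil, fun x _ => List.nil_suffix⟩
  obtain ⟨N, hN⟩ : ∃ N, ∀ n, U n → n ≤ N := by
    refine ⟨max (gword (φ (0, 0))).length (gword (φ (2 * |R| + 1, 0))).length, ?_⟩
    rintro n ⟨u, z, rfl, -, hu⟩
    have b1 := le_abs_self R
    rw [le_max_iff]
    by_contra hcon
    rw [not_or] at hcon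
    have h3 : Close R (0, 0) z := by
      by_contra h
      exact hcon.1 (hu _ h).length_le
    have h4 : Close R (2 * |R| + 1, 0) z := by
      by_contra h
      exact hcon.2 (hu _ h).length_le
    have h5 := abs_le.mp h3.1
    have h6 := abs_le.mp h4.1
    dsimp only at h5 h6
    omega
  classical
  obtain ⟨n, ⟨u, z, hun, hu, huz⟩, hmax⟩ : ∃ n, U n ∧ ∀ m, U m → m ≤ n :=
    ⟨Nat.findGreatest U N, Nat.findGreatest_spec (Nat.zero_le N) hU0,
      fun m hm => Nat.le_findGreatest (hN m hm) hm⟩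
  obtain ⟨k, z', hk⟩ := h g (wprod u)
  have hout : ∀ x, ¬ Close R x z' → lastLab (gword (φ x * (wprod u)⁻¹)) = k := fun x hx =>
    (hk x).resolve_right fun h => hx h.1
  cases k with
  | none =>
    exfalso
    obtain ⟨R', hR'⟩ := hf.plane_radius hab (Set.finite_singleton (1 : CoprodI P))
    have heq : ∀ x, ¬ Close R x z' → φ x = wprod u := by
      intro x hx
      have h1 := lastLab_eq_none (hout x hx)
      rw [← mul_inv_eq_one, ← wprod_gword (φ x * (wprod u)⁻¹), h1, wprod_nil]
    obtain ⟨x, hx, -⟩ := exists_outside (max R R') z' z'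
    obtain ⟨y, hy, hy'⟩ := exists_outside (max R R') z' x
    have m1 := le_max_left R R'
    have m2 := le_max_right R R'
    have := hR' g y x (by
      have e1 := heq x fun h => hx ⟨h.1.trans m1, h.2.trans m1⟩
      have e2 := heq y fun h => hy ⟨h.1.trans m1, h.2.trans m1⟩
      simp only [hφ] at e1 e2
      rw [e1, e2]
      simp)
    exact hy' ⟨this.1.trans m2, this.2.trans m2⟩
  | some j =>
    refine ⟨j, wprod u, fun x => ?_⟩
    rcases hk x with hx | hx
    swap
    · exact ⟨wprod u, ⟨1, by simp⟩, hx.2⟩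
    have hhead : headLab u ≠ some j := by
      obtain ⟨y, hy, hy'⟩ := exists_outside R z z'
      obtain ⟨t, ht⟩ := huz y hy
      have hred : Red (t ++ u) := ht ▸ red_gword _
      have h1 : φ y * (wprod u)⁻¹ = wprod t := by
        rw [← wprod_gword (φ y), ← ht, wprod_append]
        simp
      have h2 := hout y hy'
      rw [h1, gword_wprod (red_append.mp hred).1] at h2
      exact (red_append.mp hred).2.2 j h2
    obtain ⟨w, p, hw⟩ := lastLab_eq_some hx
    have hwp : φ x * (wprod u)⁻¹ = wprod w * CoprodI.of p := by
      rw [← wprod_gword (φ x * (wprod u)⁻¹)]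
      show wprod (gword (f (plane a b x * g) * (wprod u)⁻¹)) = _
      rw [hw]
      simp
    have hredw : Red (w ++ [⟨j, p⟩]) := hw ▸ red_gword _
    have hred' : Red (⟨j, p⟩ :: u : List (Σ j, P j)) :=
      red_cons.mpr ⟨red_singleton.mp (red_append.mp hredw).2.1, hhead, hu⟩
    by_cases hwE : wprod w ∈ E
    · refine ⟨_, ⟨p, rfl⟩, ?_⟩
      have : f (plane a b x * g) * (CoprodI.of p * wprod u)⁻¹ = wprod w := by
        rw [mul_inv_rev, ← mul_assoc]
        exact mul_inv_eq_iff_eq_mul.mpr hwp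
      rwa [this]
    · exfalso
      obtain ⟨k', z'', hk'⟩ := h g (wprod (⟨j, p⟩ :: u))
      have e1 : f (plane a b x * g) * (wprod (⟨j, p⟩ :: u))⁻¹ = wprod w := by
        rw [wprod_cons, mul_inv_rev, ← mul_assoc]
        exact mul_inv_eq_iff_eq_mul.mpr hwp
      have hlast : lastLab w = k' := by
        rcases hk' x with h | h
        · rw [e1] at h
          rwa [gword_wprod (red_append.mp hredw).1] at h
        · rw [e1] at h
          exact absurd h.2 hwE
      refine absurd (hmax (n + 1) ⟨⟨j, p⟩ :: u, z'', by simp [hun], hred', fun y hy => ?_⟩)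
        (by omega)
      have hy' := (hk' y).resolve_right fun h => hy h.1
      have hjk : k' ≠ some j := by
        intro h
        exact (red_append.mp hredw).2.2 j (hlast.trans h) (by simp)
      refine ⟨gword (φ y * (wprod (⟨j, p⟩ :: u))⁻¹), ?_⟩
      refine (gword_append ?_ (wprod_gword _).symm).symm
      rw [red_append]
      refine ⟨red_gword _, hred', fun i hi hi' => hjk ?_⟩
      exact hy'.symm.trans (hi.trans (hi'.symm.trans rfl))

/-- The image of a coset of a subgroup generated by a connected family of independent
commuting elements is near a coset of a factor. -/
theorem CEmb.exists_coset_connected [∀ j, Infinite (P j)] {f : G → CoprodI P} (hf : CEmb f)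
    {T : Type*} [Finite T] [Nontrivial T] {Δ : SimpleGraph T} (hΔ : Δ.Preconnected) (γ : T → G)
    (hγ : ∀ s t, Δ.Adj s t → Indep (γ s) (γ t)) :
    ∃ E : Set (CoprodI P), E.Finite ∧ ∀ g, ∃ j c, ∀ x ∈ Subgroup.closure (Set.range γ),
      f (x * g) ∈ nbhd E (fcoset j c) := by
  have key : ∀ st : {st : T × T // Δ.Adj st.1 st.2}, ∃ E : Set (CoprodI P), E.Finite ∧
      ∀ g, ∃ j c, ∀ x, f (plane (γ st.1.1) (γ st.1.2) x * g) ∈ nbhd E (fcoset j c) := fun st =>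
    hf.exists_coset_plane (hγ _ _ st.2)
  choose E hE hE' using key
  have hEfin : (⋃ st, E st).Finite := Set.finite_iUnion hE
  refine ⟨⋃ st, E st, hEfin, fun g => ?_⟩
  let Good : T → G → Set (CoprodI P) → Prop := fun t g C => (∃ j c, C = fcoset j c) ∧
    ∀ m : ℤ, f (γ t ^ m * g) ∈ nbhd (⋃ st, E st) C
  have flat : ∀ s t, Δ.Adj s t → ∀ g, ∃ C, (∃ j c, C = fcoset j c) ∧
      ∀ x, f (plane (γ s) (γ t) x * g) ∈ nbhd (⋃ st, E st) C := by
    intro s t hst g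
    obtain ⟨j, c, h⟩ := hE' ⟨(s, t), hst⟩ g
    refine ⟨_, ⟨j, c, rfl⟩, fun x => ?_⟩
    obtain ⟨y, hy, hy'⟩ := h x
    exact ⟨y, hy, Set.mem_iUnion.mpr ⟨_, hy'⟩⟩
  have nbr : ∀ s, ∃ t, Δ.Adj s t := hΔ.exists_adj_of_nontrivial
  have inj : ∀ s g, Function.Injective fun m : ℤ => γ s ^ m * g := by
    intro s g m n e
    obtain ⟨t, ht⟩ := nbr s
    have : ((m, 0) : ℤ × ℤ) = (n, 0) := (hγ s t ht).inj (by simpa [plane] using e)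
    exact (Prod.mk.inj this).1
  have uniq : ∀ s g C C', Good s g C → Good s g C' → C = C' := by
    rintro s g _ _ ⟨⟨j, c, rfl⟩, h⟩ ⟨⟨j', c', rfl⟩, h'⟩
    refine (eq_of_infinite_inter hEfin hEfin ?_).2
    refine (hf.image_infinite (Set.infinite_range_of_injective (inj s g))).mono ?_
    rintro _ ⟨_, ⟨m, rfl⟩, rfl⟩
    exact ⟨h m, h' m⟩
  have adj : ∀ s t, Δ.Adj s t → ∀ g C, Good s g C → Good t g C := by
    intro s t hst g C hC
    obtain ⟨F, hF, hF'⟩ := flat s t hst g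
    have : Good s g F := ⟨hF, fun m => by simpa [plane] using hF' (m, 0)⟩
    rw [uniq s g C F hC this]
    exact ⟨hF, fun m => by simpa [plane] using hF' (0, m)⟩
  have all : ∀ s t g C, Good s g C → Good t g C := by
    intro s t g C hC
    obtain ⟨p⟩ := hΔ s t
    induction p with
    | nil => exact hC
    | cons hst _ ih => exact ih (adj _ _ hst g C hC)
  have shift : ∀ s (n : ℤ) g C, Good s g C → Good s (γ s ^ n * g) C := by
    intro s n g C hC
    refine ⟨hC.1, fun m => ?_⟩
    rw [← mul_assoc, ← zpow_add]
    exact hC.2 _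
  obtain ⟨s₀⟩ : Nonempty T := inferInstance
  obtain ⟨t₀, ht₀⟩ := nbr s₀
  obtain ⟨C, ⟨j, c, rfl⟩, hC⟩ := flat s₀ t₀ ht₀ g
  have h0 : Good s₀ g (fcoset j c) :=
    ⟨⟨j, c, rfl⟩, fun m => by simpa [plane] using hC (m, 0)⟩
  refine ⟨j, c, fun x hx => ?_⟩
  have : ∀ g, Good s₀ g (fcoset j c) → Good s₀ (x * g) (fcoset j c) := by
    induction hx using Subgroup.closure_induction'' with
    | one => simp
    | mem y hy =>
      obtain ⟨s, rfl⟩ := hy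
      intro g hg
      have := shift s 1 g _ (all s₀ s g _ hg)
      rw [zpow_one] at this
      exact all s s₀ _ _ this
    | inv_mem y hy =>
      obtain ⟨s, rfl⟩ := hy
      intro g hg
      have := shift s (-1) g _ (all s₀ s g _ hg)
      rw [zpow_neg_one] at this
      exact all s s₀ _ _ this
    | mul y z _ _ hy hz =>
      intro g hg
      rw [mul_assoc]
      exact hy _ (hz _ hg)
  simpa using (this g h0).2 0

end

end

/-! ### Word metrics and coarse equivalences -/

noncomputable section

open scoped Pointwise

section
variable {G : Type*} [Group G] {S : Set G}

theorem wordDist_le {g h : G} {l : List G} (hl : ∀ x ∈ l, x ∈ S ∨ x⁻¹ ∈ S) (e : g * l.prod = h) :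
    wordDist S g h ≤ l.length :=
  csInf_le ⟨0, by rintro _ ⟨l, -, rfl⟩; positivity⟩ ⟨l, ⟨hl, e⟩, rfl⟩

theorem exists_list (hS : Subgroup.closure S = ⊤) (g : G) :
    ∃ l : List G, (∀ x ∈ l, x ∈ S ∨ x⁻¹ ∈ S) ∧ l.prod = g := by
  have hg : g ∈ (Subgroup.closure S).toSubmonoid := by simp [hS]
  rw [Subgroup.closure_toSubmonoid] at hg
  obtain ⟨l, hl, e⟩ := Submonoid.exists_list_of_mem_closure hg
  exact ⟨l, fun x hx => by simpa using hl x hx, e⟩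

theorem exists_wordDist_eq (hS : Subgroup.closure S = ⊤) (g h : G) :
    ∃ l : List G, (∀ x ∈ l, x ∈ S ∨ x⁻¹ ∈ S) ∧ g * l.prod = h ∧ wordDist S g h = l.length := by
  classical
  have hex : ∃ n, ∃ l : List G, (∀ x ∈ l, x ∈ S ∨ x⁻¹ ∈ S) ∧ g * l.prod = h ∧ l.length = n := by
    obtain ⟨l, hl, e⟩ := exists_list hS (g⁻¹ * h)
    exact ⟨_, l, hl, by simp [e], rfl⟩
  obtain ⟨l, hl, e, hn⟩ := Nat.find_spec hex
  refine ⟨l, hl, e, le_antisymm (wordDist_le hl e) ?_⟩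
  refine le_csInf ⟨_, l, ⟨hl, e⟩, rfl⟩ ?_
  rintro _ ⟨l', ⟨hl', e'⟩, rfl⟩
  have := Nat.find_min' hex ⟨l', hl', e', rfl⟩
  dsimp only
  rw [hn]
  exact_mod_cast this

theorem wordDist_nonneg (g h : G) : 0 ≤ wordDist S g h :=
  Real.sInf_nonneg (by rintro _ ⟨l, -, rfl⟩; positivity)

theorem wordDist_triangle (hS : Subgroup.closure S = ⊤) (g h k : G) :
    wordDist S g k ≤ wordDist S g h + wordDist S h k := by
  obtain ⟨l, hl, e, h1⟩ := exists_wordDist_eq hS g h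
  obtain ⟨l', hl', e', h2⟩ := exists_wordDist_eq hS h k
  rw [h1, h2]
  have := wordDist_le (S := S) (g := g) (h := k) (l := l ++ l')
    (fun x hx => (List.mem_append.mp hx).elim (hl x) (hl' x))
    (by rw [List.prod_append, ← mul_assoc, e, e'])
  simpa using this

/-- Balls are finite. -/
theorem finite_ball (hfin : S.Finite) (hS : Subgroup.closure S = ⊤) (r : ℝ) :
    ∃ E : Set G, E.Finite ∧ ∀ g h, wordDist S g h ≤ r → g⁻¹ * h ∈ E := by
  have hT : (S ∪ S⁻¹).Finite := hfin.union hfin.inv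
  have := hT.to_subtype
  refine ⟨(fun l : List ↥(S ∪ S⁻¹) => (l.map Subtype.val).prod) '' {l | l.length ≤ ⌊r⌋₊},
    (List.finite_length_le _ _).image _, fun g h hgh => ?_⟩
  obtain ⟨l, hl, e, h1⟩ := exists_wordDist_eq hS g h
  refine ⟨l.attach.map fun x => ⟨x.1, hl x.1 x.2⟩, ?_, ?_⟩
  · rw [h1] at hgh
    simpa using Nat.le_floor hgh
  · simp only [List.map_map]
    rw [← e, inv_mul_cancel_left]
    congr 1
    exact List.attach_map_subtype_val l

/-- Finite sets are bounded. -/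
theorem exists_bound (hS : Subgroup.closure S = ⊤) {E : Set G} (hE : E.Finite) :
    ∃ r : ℝ, 0 ≤ r ∧ ∀ g h, g⁻¹ * h ∈ E → wordDist S g h ≤ r := by
  choose l hl e using exists_list hS
  obtain ⟨r, hr⟩ := (hE.image fun g => ((l g).length : ℝ)).bddAbove
  refine ⟨max r 0, le_max_right _ _, fun g h hgh => ?_⟩
  refine (wordDist_le (hl (g⁻¹ * h)) ?_).trans ((hr ⟨_, hgh, rfl⟩).trans (le_max_left _ _))
  rw [e, mul_inv_cancel_left]

variable {H : Type*} [Group H] {T : Set H}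

/-- Conjugation of a map by inversion. -/
def conjInv (f : G → H) (g : G) : H := (f g⁻¹)⁻¹

theorem IsQIWith.cemb (hSf : S.Finite) (hS : Subgroup.closure S = ⊤) (hTf : T.Finite)
    (hT : Subgroup.closure T = ⊤) {K A : ℝ} {φ : G → H}
    (h : IsQIWith K A (wordDist S) (wordDist T) φ) :
    ∃ f', CInv (conjInv φ) f' := by
  obtain ⟨hK, hA, hd, hs⟩ := h
  have hemb : CEmb (conjInv φ) := by
    refine ⟨fun s => ?_, fun E hE => ?_⟩
    · obtain ⟨r, -, hr⟩ := exists_bound hS (Set.finite_singleton s)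
      obtain ⟨E, hE, h⟩ := finite_ball hTf hT (K * r + A)
      refine ⟨E, hE, fun g => ?_⟩
      simp only [conjInv, inv_inv]
      refine h _ _ ((hd _ _).2.trans ?_)
      have := hr (s * g)⁻¹ g⁻¹ (by simp)
      have := mul_le_mul_of_nonneg_left this (by linarith : 0 ≤ K)
      linarith
    · obtain ⟨r, -, hr⟩ := exists_bound hT hE
      obtain ⟨E', hE', h⟩ := finite_ball hSf hS (K * (r + A))
      refine ⟨E', hE', fun x y hxy => ?_⟩
      simp only [conjInv, inv_inv] at hxy
      have h1 := hr _ _ hxy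
      have h2 := (hd x⁻¹ y⁻¹).1
      have h3 : wordDist S x⁻¹ y⁻¹ / K ≤ r + A := by linarith
      rw [div_le_iff₀ (by linarith)] at h3
      have := h x⁻¹ y⁻¹ (by linarith)
      simpa using this
  obtain ⟨E, hE, h⟩ := finite_ball hTf hT A
  refine hemb.exists_cinv hE fun y => ?_
  obtain ⟨x, hx⟩ := hs y⁻¹
  refine ⟨x⁻¹, ?_⟩
  have := h _ _ hx
  simpa [conjInv] using this

theorem CMap.lipschitz (hSf : S.Finite) (hS : Subgroup.closure S = ⊤)
    (hT : Subgroup.closure T = ⊤) {f : G → H} (hf : CMap f) :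
    ∃ r : ℝ, 0 ≤ r ∧ ∀ g h, wordDist T (conjInv f g) (conjInv f h) ≤ r * wordDist S g h := by
  obtain ⟨E, hE, hE'⟩ := hf.exists_finite (hSf.union hSf.inv)
  obtain ⟨r, hr, h⟩ := exists_bound hT hE
  refine ⟨r, hr, fun g k => ?_⟩
  obtain ⟨l, hl, e, h1⟩ := exists_wordDist_eq hS g k
  rw [h1]
  clear h1
  induction l generalizing g with
  | nil =>
    simp only [List.prod_nil, mul_one] at e
    subst e
    simpa using wordDist_le (S := T) (g := conjInv f g) (l := []) (by simp) (by simp)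
  | cons x l ih =>
    have h2 := ih (g * x) (fun y hy => hl y (by simp [hy])) (by simpa [mul_assoc] using e)
    have h3 : wordDist T (conjInv f g) (conjInv f (g * x)) ≤ r := by
      apply h
      have := hE' g⁻¹ (g * x)⁻¹ (by simpa using hl x (by simp))
      simpa [conjInv] using this
    have h4 := wordDist_triangle hT (conjInv f g) (conjInv f (g * x)) (conjInv f k)
    push_cast [List.length_cons]
    linarith

theorem CInv.isQIWith (hSf : S.Finite) (hS : Subgroup.closure S = ⊤) (hTf : T.Finite)
    (hT : Subgroup.closure T = ⊤) {f : G → H} {f' : H → G} (h : CInv f f') :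
    ∃ K A₀ : ℝ, ∀ A, A₀ ≤ A → IsQIWith K A (wordDist S) (wordDist T) (conjInv f) := by
  obtain ⟨r, hr, h1⟩ := h.map.lipschitz hSf hS hT
  obtain ⟨r', hr', h2⟩ := h.map'.lipschitz hTf hT hS
  obtain ⟨E, hE, hl⟩ := h.left
  obtain ⟨E', hE', hr₁⟩ := h.right
  obtain ⟨c, hc, h3⟩ := exists_bound hS (hE.union hE.inv)
  obtain ⟨c', hc', h4⟩ := exists_bound hT hE'
  have hl' : ∀ g, wordDist S g (conjInv f' (conjInv f g)) ≤ c ∧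
      wordDist S (conjInv f' (conjInv f g)) g ≤ c := by
    intro g
    have := hl g⁻¹
    constructor
    · apply h3
      right
      simpa [conjInv] using this
    · apply h3
      left
      simpa [conjInv] using this
  refine ⟨max r r' + 1, 2 * c + c', fun A hA => ⟨?_, by linarith, fun g k => ⟨?_, ?_⟩, fun y => ?_⟩⟩
  · linarith [le_max_left r r']
  · have h5 := wordDist_triangle hS g (conjInv f' (conjInv f g)) k
    have h6 := wordDist_triangle hS (conjInv f' (conjInv f g)) (conjInv f' (conjInv f k)) k
    have h7 := h2 (conjInv f g) (conjInv f k)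
    have h8 := (hl' g).1
    have h9 := (hl' k).2
    have hK : 1 ≤ max r r' + 1 := by linarith [le_max_left r r']
    have hd := wordDist_nonneg (S := T) (conjInv f g) (conjInv f k)
    rw [sub_le_iff_le_add, div_le_iff₀ (by linarith)]
    have h10 : r' * wordDist T (conjInv f g) (conjInv f k) ≤
        (max r r' + 1) * wordDist T (conjInv f g) (conjInv f k) :=
      mul_le_mul_of_nonneg_right (by linarith [le_max_right r r']) hd
    have h11 : A ≤ A * (max r r' + 1) := le_mul_of_one_le_right (by linarith) hK
    linarith
  · refine (h1 g k).trans ?_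
    have := mul_le_mul_of_nonneg_right (by linarith [le_max_left r r'] : r ≤ max r r' + 1)
      (wordDist_nonneg (S := S) g k)
    linarith
  · refine ⟨conjInv f' y, (h4 _ _ ?_).trans (by linarith)⟩
    have := hr₁ y⁻¹
    simpa [conjInv] using this

/-- Quasi-isometries of word metrics in terms of coarse equivalences. -/
theorem exists_isQI_iff (hSf : S.Finite) (hS : Subgroup.closure S = ⊤) (hTf : T.Finite)
    (hT : Subgroup.closure T = ⊤) :
    (∃ φ : G → H, IsQI (wordDist S) (wordDist T) φ) ↔ ∃ (f : G → H) (f' : H → G), CInv f f' := by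
  constructor
  · rintro ⟨φ, K, A, h⟩
    obtain ⟨f', hf⟩ := h.cemb hSf hS hTf hT
    exact ⟨_, f', hf⟩
  · rintro ⟨f, f', h⟩
    obtain ⟨K, A, hA⟩ := h.isQIWith hSf hS hTf hT
    exact ⟨conjInv f, K, A, hA A le_rfl⟩

end

end

/-! ### Maximal biconnected subgraphs -/

noncomputable section

variable {V : Type} {Γ : SimpleGraph V}

theorem reachable_induce_mono {A B : Set V} (h : A ⊆ B) (hA : (Γ.induce A).Preconnected) {x y : V}
    (hx : x ∈ A) (hy : y ∈ A) : (Γ.induce B).Reachable ⟨x, h hx⟩ ⟨y, h hy⟩ :=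
  (hA ⟨x, hx⟩ ⟨y, hy⟩).map (Γ.induceHomOfLE h).toHom

theorem preconnected_induce_of_hub {B : Set V} {u : V}
    (h : ∀ x ∈ B, ∃ A ⊆ B, (Γ.induce A).Preconnected ∧ x ∈ A ∧ u ∈ A) :
    (Γ.induce B).Preconnected := by
  rintro ⟨x, hx⟩ ⟨y, hy⟩
  obtain ⟨A, hA, hc, hxA, huA⟩ := h x hx
  obtain ⟨A', hA', hc', hyA, huA'⟩ := h y hy
  exact (reachable_induce_mono hA hc hxA huA).trans (reachable_induce_mono hA' hc' huA' hyA)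

theorem preconnected_induce_singleton (u : V) : (Γ.induce {u}).Preconnected := by
  rintro ⟨x, rfl⟩ ⟨y, rfl⟩
  rfl

theorem biconn_pair {a b : V} (h : Γ.Adj a b) : Biconn Γ {a, b} := by
  refine ⟨SimpleGraph.induce_pair_connected_of_adj h, fun x hx => ?_⟩
  rintro ⟨y, hy, hyx⟩ ⟨z, hz, hzx⟩
  have : y = z := by
    rcases hx with rfl | rfl <;> rcases hy with rfl | rfl <;> rcases hz with rfl | rfl <;>
      simp_all
  subst this
  rfl

theorem Biconn.union {S T : Set V} (hS : Biconn Γ S) (hT : Biconn Γ T) {a b : V} (hab : a ≠ b)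
    (haS : a ∈ S) (haT : a ∈ T) (hbS : b ∈ S) (hbT : b ∈ T) : Biconn Γ (S ∪ T) := by
  refine ⟨SimpleGraph.induce_union_connected hS.1.preconnected hT.1.preconnected
    ⟨a, haS, haT⟩, fun x _ => ?_⟩
  have key : ∀ {S : Set V}, Biconn Γ S → (Γ.induce (S \ {x})).Preconnected := by
    intro S hS
    by_cases hx : x ∈ S
    · exact hS.2 x hx
    · rw [Set.sdiff_singleton_eq_self hx]
      exact hS.1.preconnected
  rw [Set.union_sdiff_distrib]
  refine (SimpleGraph.induce_union_connected (key hS) (key hT) ?_).preconnected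
  by_cases hx : x = a
  · exact ⟨b, ⟨hbS, by simpa [hx] using hab.symm⟩, hbT, by simpa [hx] using hab.symm⟩
  · exact ⟨a, ⟨haS, by simpa using Ne.symm hx⟩, haT, by simpa using Ne.symm hx⟩

/-- A cycle is biconnected. -/
theorem biconn_cycle {a b u : V} (p : Γ.Walk a b) (hp : p.IsPath) (hu : u ∉ p.support)
    (ha : Γ.Adj u a) (hb : Γ.Adj u b) : Biconn Γ (insert u {x | x ∈ p.support}) := by
  classical
  have hub : ∀ {c d : V} (q : Γ.Walk c d) {y : V}, y ∈ q.support → Γ.Adj u y →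
      (Γ.induce (({u, y} : Set V) ∪ {x | x ∈ q.support})).Preconnected := fun q y hy hadj =>
    (SimpleGraph.induce_union_connected (SimpleGraph.induce_pair_connected_of_adj hadj).preconnected
      q.connected_induce_support.preconnected ⟨y, by simp, hy⟩).preconnected
  have hall : (insert u {x | x ∈ p.support} : Set V) = ({u, a} : Set V) ∪ {x | x ∈ p.support} := by
    ext x
    have := p.start_mem_support
    simp only [Set.mem_insert_iff, Set.mem_union, Set.mem_singleton_iff, Set.mem_ofPred_eq]
    constructor
    · tauto
    · rintro ((rfl | rfl) | h) <;> tauto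
  refine ⟨?_, fun x hx => ?_⟩
  · have := hub p p.start_mem_support ha
    rw [← hall] at this
    have : Nonempty ↥(insert u {x | x ∈ p.support} : Set V) := ⟨u, by simp⟩
    exact ⟨by assumption⟩
  · rcases hx with rfl | hx
    · have : (insert x {y | y ∈ p.support} : Set V) \ {x} = {y | y ∈ p.support} := by
        ext y
        simp only [Set.mem_sdiff, Set.mem_insert_iff, Set.mem_ofPred_eq, Set.mem_singleton_iff]
        constructor
        · tauto
        · intro h
          exact ⟨Or.inr h, fun e => hu (e ▸ h)⟩
      rw [this]
      exact p.connected_induce_support.preconnected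
    · have hx : x ∈ p.support := hx
      have hux : u ≠ x := fun e => hu (e ▸ hx)
      refine preconnected_induce_of_hub (u := u) ?_
      rintro y ⟨hy, hyx⟩
      have hyx : y ≠ x := hyx
      rcases hy with rfl | hy
      · exact ⟨{y}, by simpa using hux, preconnected_induce_singleton y, rfl, rfl⟩
      · have hy : y ∈ p.support := hy
        by_cases hxt : x ∈ (p.takeUntil y hy).support
        · have hxd : x ∉ (p.dropUntil y hy).support := by
            intro hxd
            have h1 := hp.support_nodup
            rw [← p.take_spec hy, SimpleGraph.Walk.support_append] at h1
            refine List.disjoint_of_nodup_append h1 hxt ?_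
            rw [SimpleGraph.Walk.mem_support_iff] at hxd
            exact hxd.resolve_left (Ne.symm hyx)
          refine ⟨_, ?_, hub (p.dropUntil y hy) (SimpleGraph.Walk.end_mem_support _) hb,
            Or.inr (SimpleGraph.Walk.start_mem_support _), Or.inl (by simp)⟩
          rintro z ((rfl | rfl) | hz)
          · exact ⟨by simp, hux⟩
          · exact ⟨Or.inr p.end_mem_support,
              fun e => hxd (e ▸ SimpleGraph.Walk.end_mem_support _)⟩
          · exact ⟨Or.inr (p.support_dropUntil_subset_support hy hz), fun e => hxd (e ▸ hz)⟩
        · refine ⟨_, ?_, hub (p.takeUntil y hy) (SimpleGraph.Walk.start_mem_support _) ha,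
            Or.inr (SimpleGraph.Walk.end_mem_support _), Or.inl (by simp)⟩
          rintro z ((rfl | rfl) | hz)
          · exact ⟨by simp, hux⟩
          · exact ⟨Or.inr p.start_mem_support,
              fun e => hxt (e ▸ SimpleGraph.Walk.start_mem_support _)⟩
          · exact ⟨Or.inr (p.support_takeUntil_subset_support hy hz), fun e => hxt (e ▸ hz)⟩

theorem Biconn.exists_maxBiconn [Finite V] {S : Set V} (hS : Biconn Γ S) :
    ∃ T, MaxBiconn Γ T ∧ S ⊆ T := by
  obtain ⟨T, hST, hT⟩ := Finite.exists_le_maximal (p := Biconn Γ) hS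
  exact ⟨T, ⟨hT.prop, fun T' hT' h => Set.Subset.antisymm h (hT.le_of_ge hT' h)⟩, hST⟩

theorem MaxBiconn.eq_of_two {S T : Set V} (hS : MaxBiconn Γ S) (hT : MaxBiconn Γ T) {a b : V}
    (hab : a ≠ b) (haS : a ∈ S) (haT : a ∈ T) (hbS : b ∈ S) (hbT : b ∈ T) : S = T := by
  have h := hS.1.union hT.1 hab haS haT hbS hbT
  rw [hS.2 _ h Set.subset_union_left]
  exact (hT.2 _ h Set.subset_union_right).symm

theorem MaxBiconn.subset_of_two {S T : Set V} (hS : MaxBiconn Γ S) (hT : Biconn Γ T) {a b : V}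
    (hab : a ≠ b) (haS : a ∈ S) (haT : a ∈ T) (hbS : b ∈ S) (hbT : b ∈ T) : T ⊆ S := by
  rw [hS.2 _ (hS.1.union hT hab haS haT hbS hbT) Set.subset_union_left]
  exact Set.subset_union_right

theorem exists_block [Finite V] {a b : V} (h : Γ.Adj a b) :
    ∃ S, MaxBiconn Γ S ∧ a ∈ S ∧ b ∈ S := by
  obtain ⟨S, hS, hs⟩ := (biconn_pair h).exists_maxBiconn
  exact ⟨S, hS, hs (by simp), hs (by simp)⟩

/-- Adjacent neighbours of a vertex lie in the same block. -/
theorem MaxBiconn.mem_of_triangle {S : Set V} (hS : MaxBiconn Γ S) {v a b : V} (hv : v ∈ S)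
    (ha : a ∈ S) (hva : Γ.Adj v a) (hvb : Γ.Adj v b) (hab : Γ.Adj a b) : b ∈ S := by
  have hp : (SimpleGraph.Walk.cons hab .nil).IsPath := by
    simpa [SimpleGraph.Walk.isPath_def] using hab.ne
  have := biconn_cycle (u := v) (.cons hab .nil) hp (by simp [hva.ne, hvb.ne]) hva hvb
  exact hS.subset_of_two this hva.ne hv (by simp) ha (by simp) (by simp)

theorem CutVertex.exists_adj (hΓ : Γ.Connected) {v : V} (hv : CutVertex Γ v) :
    ∃ u, Γ.Adj v u := by
  have : Nontrivial V := by
    by_contra h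
    rw [not_nontrivial_iff_subsingleton] at h
    exact hv fun x => absurd (Subsingleton.elim _ _) x.2
  exact hΓ.preconnected.exists_adj_of_nontrivial v

theorem MaxBiconn.lkIn_nonempty (hΓ : Γ.Connected) [Finite V] {S : Set V} (hS : MaxBiconn Γ S)
    {v : V} (hvS : v ∈ S) (hv : CutVertex Γ v) : (lkIn Γ S v).Nonempty := by
  by_cases h : ∃ x ∈ S, x ≠ v
  · obtain ⟨x, hx, hxv⟩ := h
    have : Nontrivial ↥S := ⟨⟨x, hx⟩, ⟨v, hvS⟩, by simpa using hxv⟩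
    obtain ⟨y, hy⟩ := hS.1.1.preconnected.exists_adj_of_nontrivial ⟨v, hvS⟩
    exact ⟨y, y.2, hy⟩
  · push Not at h
    obtain ⟨u, hu⟩ := hv.exists_adj hΓ
    obtain ⟨T, hT, hvT, huT⟩ := exists_block hu
    have := hS.2 T hT.1 (fun x hx => (h x hx) ▸ hvT)
    exact ⟨u, this ▸ huT, hu⟩

theorem exists_adj_reachable (hΓ : Γ.Connected) {v z : V} (hz : z ≠ v) :
    ∃ u, ∃ h : Γ.Adj v u, (Γ.induce {u : V | u ≠ v}).Reachable ⟨z, hz⟩ ⟨u, h.ne.symm⟩ := by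
  obtain ⟨p⟩ := hΓ.preconnected z v
  induction p with
  | nil => exact absurd rfl hz
  | cons h p ih =>
    rename_i a b c
    by_cases hb : b = c
    · subst hb
      exact ⟨a, h.symm, .rfl⟩
    · obtain ⟨u, hu, hr⟩ := ih hb
      refine ⟨u, hu, SimpleGraph.Reachable.trans ?_ hr⟩
      exact SimpleGraph.Adj.reachable (by simpa using h)

theorem CutVertex.exists_ne_block (hΓ : Γ.Connected) [Finite V] {v : V} (hv : CutVertex Γ v) :
    ∃ S T, MaxBiconn Γ S ∧ MaxBiconn Γ T ∧ v ∈ S ∧ v ∈ T ∧ S ≠ T := by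
  by_contra hcon
  push Not at hcon
  refine hv ?_
  obtain ⟨u₀, hu₀⟩ := hv.exists_adj hΓ
  obtain ⟨S, hS, hvS, -⟩ := exists_block hu₀
  have hsub : ∀ u, Γ.Adj v u → u ∈ S := by
    intro u hu
    obtain ⟨T, hT, hvT, huT⟩ := exists_block hu
    rw [hcon S T hS hT hvS hvT]
    exact huT
  rintro ⟨x, hx⟩ ⟨y, hy⟩
  obtain ⟨a, ha, hxa⟩ := exists_adj_reachable hΓ hx
  obtain ⟨b, hb, hyb⟩ := exists_adj_reachable hΓ hy
  refine hxa.trans (SimpleGraph.Reachable.trans ?_ hyb.symm)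
  exact reachable_induce_mono (A := S \ {v}) (fun z hz => hz.2) (hS.1.2 v hvS)
    ⟨hsub a ha, ha.ne.symm⟩ ⟨hsub b hb, hb.ne.symm⟩

theorem exists_block_of_not_cutVertex [Finite V] {u a b : V} (hu : ¬ CutVertex Γ u)
    (ha : Γ.Adj u a) (hb : Γ.Adj u b) : ∃ S, MaxBiconn Γ S ∧ u ∈ S ∧ a ∈ S ∧ b ∈ S := by
  classical
  have hp : (Γ.induce {x : V | x ≠ u}).Preconnected := by
    by_contra h
    exact hu h
  obtain ⟨q⟩ := hp ⟨a, ha.ne.symm⟩ ⟨b, hb.ne.symm⟩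
  obtain ⟨p, hp⟩ := q.toPath
  set e := SimpleGraph.Embedding.induce (G := Γ) {x : V | x ≠ u}
  have hp' : (p.map e.toHom).IsPath := hp.map e.injective
  have hus : u ∉ (p.map e.toHom).support := by
    rw [SimpleGraph.Walk.support_map, List.mem_map]
    rintro ⟨x, -, hx⟩
    exact x.2 hx
  have := biconn_cycle (u := u) _ hp' hus ha hb
  obtain ⟨S, hS, hs⟩ := this.exists_maxBiconn
  exact ⟨S, hS, hs (by simp), hs (Or.inr (SimpleGraph.Walk.start_mem_support _)),
    hs (Or.inr (SimpleGraph.Walk.end_mem_support _))⟩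

theorem MaxBiconn.mem_of_subset_starSet {S : Set V} (hS : MaxBiconn Γ S) {x : V}
    (h : S ⊆ starSet Γ x) : x ∈ S := by
  by_contra hx
  have hadj : ∀ y ∈ S, Γ.Adj x y := fun y hy =>
    (h hy).resolve_left (fun e => hx (e ▸ hy))
  have hb : Biconn Γ (insert x S) := by
    have cone : ∀ {B : Set V}, B ⊆ S → (Γ.induce (insert x B)).Connected := by
      intro B hB
      have : Nonempty ↥(insert x B) := ⟨x, by simp⟩
      refine ⟨preconnected_induce_of_hub (u := x) ?_⟩
      rintro y (rfl | hy)
      · exact ⟨{y}, by simp, preconnected_induce_singleton _, rfl, rfl⟩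
      · refine ⟨{x, y}, ?_, (SimpleGraph.induce_pair_connected_of_adj
          (hadj y (hB hy))).preconnected, by simp, by simp⟩
        rintro z (rfl | rfl)
        · simp
        · exact Or.inr hy
    refine ⟨cone le_rfl, ?_⟩
    rintro y (rfl | hy)
    · rw [Set.insert_sdiff_self_of_notMem hx]
      exact hS.1.1.preconnected
    · rw [Set.insert_sdiff_of_notMem _ (fun e : x ∈ ({y} : Set V) => hx (e ▸ hy))]
      exact (cone Set.sdiff_subset).preconnected
  rw [hS.2 _ hb (Set.subset_insert _ _)] at hx
  exact hx (by simp)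

theorem MaxBiconn.subset_starSet {S : Set V} (hS : MaxBiconn Γ S) (hS1 : S ∉ C1 Γ) {v : V}
    (hvS : v ∈ S) (hv : CutVertex Γ v) :
    S ⊆ starSet Γ v ∧ ∀ x ∈ S, CutVertex Γ x → x = v := by
  have h : ¬ ((∃ x ∈ S, ∃ y ∈ S, x ≠ y ∧ CutVertex Γ x ∧ CutVertex Γ y) ∨
     (∀ x : V, CutVertex Γ x → ¬ S ⊆ starSet Γ x)) := fun h => hS1 ⟨hS, h⟩
  push Not at h
  obtain ⟨h1, x, hx, hxS⟩ := h
  have h2 : ∀ x ∈ S, CutVertex Γ x → x = v := fun x hxS hx => by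
    by_contra hne
    exact h1 x hxS v hvS hne hx hv
  have := h2 x (hS.mem_of_subset_starSet hxS) hx
  exact ⟨this ▸ hxS, h2⟩

theorem MaxBiconn.lkIn_preconnected {S : Set V} (hS : MaxBiconn Γ S) (hS1 : S ∉ C1 Γ) {v : V}
    (hvS : v ∈ S) (hv : CutVertex Γ v) : (Γ.induce (lkIn Γ S v)).Preconnected := by
  have : lkIn Γ S v = S \ {v} := by
    ext x
    constructor
    · rintro ⟨hx, hadj⟩
      exact ⟨hx, hadj.ne.symm⟩
    · rintro ⟨hx, hne⟩
      exact ⟨hx, ((hS.subset_starSet hS1 hvS hv).1 hx).resolve_left hne⟩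
  rw [this]
  exact hS.1.2 v hvS

theorem CutVertex.exists_mem_C1 (hΓ : Γ.Connected) [Finite V] {v : V} (hv : CutVertex Γ v)
    (hstar : starSet Γ v ≠ Set.univ) : ∃ S ∈ C1 Γ, v ∈ S := by
  by_contra hcon
  push Not at hcon
  refine hstar (Set.eq_univ_of_forall fun z => ?_)
  obtain ⟨p⟩ := hΓ.preconnected z v
  induction p with
  | nil => exact Or.inl rfl
  | cons h p ih =>
    rename_i a b c
    rcases ih hv hstar hcon with hb | hb
    · subst hb
      exact Or.inr h.symm
    · have hb : Γ.Adj c b := hb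
      obtain ⟨S, hS, hcS, hbS⟩ := exists_block hb
      have hS1 : S ∉ C1 Γ := fun h => hcon S h hcS
      have hnc : ¬ CutVertex Γ b := fun hcut =>
        hb.ne ((hS.subset_starSet hS1 hcS hv).2 b hbS hcut).symm
      obtain ⟨T, hT, hbT, haT, hcT⟩ := exists_block_of_not_cutVertex hnc h.symm hb.symm
      exact (hT.subset_starSet (fun h => hcon T h hcT) hcT hv).1 haT

end

/-! ### Cylinders as products of a cyclic group with a free product -/

noncomputable section

open Monoid
open scoped Pointwise

/-- A coarse equivalence of products which coarsely preserves the fibres induces a coarse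
equivalence of the second factors. -/
theorem CInv.snd {A G H : Type} [Group A] [Group G] [Group H] {F : A × G → A × H}
    {F' : A × H → A × G} (h : CInv F F')
    (hF : Near (fun x => (F x).2) (fun x => (F (1, x.2)).2))
    (hF' : Near (fun x => (F' x).2) (fun x => (F' (1, x.2)).2)) :
    CInv (fun k => (F (1, k)).2) (fun k => (F' (1, k)).2) := by
  have key : ∀ {G H : Type} [Group G] [Group H] {F : A × G → A × H} {F' : A × H → A × G},
      CInv F F' → Near (fun x => (F' x).2) (fun x => (F' (1, x.2)).2) →
      CMap (fun k => (F (1, k)).2) ∧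
        Near (fun k => (F' (1, (F (1, k)).2)).2) (fun k => k) := by
    intro G H _ _ F F' h hF'
    refine ⟨fun s => ?_, ?_⟩
    · have h1 := (h.map (1, s)).comp (fun k : G => (1, k))
      simpa using (CMap.of_hom (MonoidHom.snd A H)).near h1
    · refine (hF'.symm.comp (fun k : G => F (1, k))).trans ?_
      exact (CMap.of_hom (MonoidHom.snd A G)).near (h.left.comp (fun k : G => (1, k)))
  have h1 := key h hF'
  have h2 := key h.symm hF
  exact ⟨h1.1, h2.1, h1.2, h2.2⟩

theorem CInv.prod_id {G H : Type} [Group G] [Group H] (A : Type) [Group A] {f : G → H}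
    {f' : H → G} (h : CInv f f') :
    CInv (fun x : A × G => (x.1, f x.2)) (fun x : A × H => (x.1, f' x.2)) := by
  have near : ∀ {X K : Type} [Group K] {a : X → A} {s : A} {b b' : X → K}, Near b b' →
      Near (fun x => (s * a x, b x)) (fun x => (a x, b' x)) := by
    rintro X K _ a s b b' ⟨E, hE, h⟩
    exact ⟨{s} ×ˢ E, (Set.finite_singleton s).prod hE, fun x => ⟨by simp, h x⟩⟩
  have near' : ∀ {X K : Type} [Group K] {a : X → A} {b b' : X → K}, Near b b' →
      Near (fun x => (a x, b x)) (fun x => (a x, b' x)) := by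
    intro X K _ a b b' h
    simpa using near (s := 1) (a := a) h
  exact ⟨fun s => near ((h.map s.2).comp Prod.snd), fun s => near ((h.map' s.2).comp Prod.snd),
    near' (h.left.comp Prod.snd), near' (h.right.comp Prod.snd)⟩

section
variable {J : Type} {P : J → Type} [∀ j, Group (P j)]

/-- The cosets of the factors with labels in `p`. -/
def cosets (P : J → Type) [∀ j, Group (P j)] (p : Set J) : Set (Set (CoprodI P)) :=
  {C | ∃ j ∈ p, ∃ g, C = fcoset j g}

variable {C : Type} [Group C]

/-- The fibre over `k`. -/
def fiber (e : C ≃* Multiplicative ℤ × CoprodI P) (k : CoprodI P) : Set C := {x | (e x).2 = k}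

/-- The family of fibres over a coset. -/
def fiberFam (e : C ≃* Multiplicative ℤ × CoprodI P) (D : Set (CoprodI P)) : Set (Set C) :=
  {c | ∃ k ∈ D, c = fiber e k⁻¹}

/-- The peripheral structure given by the cosets of the factors with labels in `p`. -/
def fiberPeriph (e : C ≃* Multiplicative ℤ × CoprodI P) (p : Set J) : Set (Set (Set C)) :=
  fiberFam e '' cosets P p

theorem fiber_injective (e : C ≃* Multiplicative ℤ × CoprodI P) :
    Function.Injective (fiber e) := by
  intro k k' h
  have : e.symm (1, k) ∈ fiber e k := by simp [fiber]
  rw [h] at this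
  simpa [fiber] using this

theorem fiberFam_injective (e : C ≃* Multiplicative ℤ × CoprodI P) :
    Function.Injective (fiberFam e) := by
  have : ∀ D, D = {k | fiber e k⁻¹ ∈ fiberFam e D} := by
    intro D
    ext k
    constructor
    · intro h
      exact ⟨k, h, rfl⟩
    · rintro ⟨k', h, e'⟩
      have := fiber_injective e e'
      rw [inv_inj] at this
      exact this ▸ h
  intro D D' h
  rw [this D, this D', h]

end

theorem Matched.unique {J J' : Type} {P : J → Type} {Q : J' → Type} [∀ j, Group (P j)]
    [∀ j, Group (Q j)] [∀ j, Infinite (Q j)] {f : CoprodI P → CoprodI Q} {E : Set (CoprodI Q)}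
    (hE : E.Finite) {D : Set (CoprodI P)} {q : Set J'} {D₁ D₂ : Set (CoprodI Q)}
    (h₁ : D₁ ∈ cosets Q q) (h₂ : D₂ ∈ cosets Q q)
    (hm₁ : Matched f E D D₁) (hm₂ : Matched f E D D₂) : D₁ = D₂ := by
  obtain ⟨j, -, g, rfl⟩ := h₁
  obtain ⟨j', -, g', rfl⟩ := h₂
  refine (eq_of_fcoset_subset_nbhd (E := E⁻¹ * E) (hE.inv.mul hE) fun y hy => ?_).2
  obtain ⟨x, hx, h1⟩ := hm₁.2 y hy
  obtain ⟨z, hz, h2⟩ := hm₂.1 x hx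
  refine ⟨z, hz, ?_⟩
  have := Set.mul_mem_mul (Set.inv_mem_inv.mpr h1) h2
  simpa [mul_assoc] using this

section
variable {J J' : Type} {P : J → Type} {Q : J' → Type} [∀ j, Group (P j)] [∀ j, Group (Q j)]
  {C D : Type} [Group C] [Group D]
  {e : C ≃* Multiplicative ℤ × CoprodI P} {e' : D ≃* Multiplicative ℤ × CoprodI Q}
  {S : Set C} {T : Set D} {p : Set J} {q : Set J'}

theorem PairEq.isRelQI [∀ j, Infinite (P j)] [∀ j, Infinite (Q j)] (hSf : S.Finite) (hS : Subgroup.closure S = ⊤) (hTf : T.Finite)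
    (hT : Subgroup.closure T = ⊤) (h : PairEq (cosets P p) (cosets Q q)) :
    IsRelQI (wordDist S) (wordDist T) (fiberPeriph e p) (fiberPeriph e' q) := by
  classical
  obtain ⟨f, f', hf, E, hE, h1, h2⟩ := h
  obtain ⟨E', hE', hsymm⟩ := hf.exists_matched_symm hE
  have hF := ((CInv.of_mulEquiv e).trans (hf.prod_id (Multiplicative ℤ))).trans
    (CInv.of_mulEquiv e').symm
  obtain ⟨K, A₀, hA⟩ := hF.isQIWith hSf hS hTf hT
  obtain ⟨r, -, hr⟩ := exists_bound hT (hE.image fun k => e'.symm (1, k))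
  set φ := conjInv fun g => e'.symm ((e g).1, f (e g).2)
  have hφ : ∀ x, e' (φ x) = ((e x).1, (f (e x).2⁻¹)⁻¹) := fun x => by simp [φ, conjInv]
  have hhaus : ∀ k h, f k * h⁻¹ ∈ E →
      HausLE (wordDist T) (φ '' fiber e k⁻¹) (fiber e' h⁻¹) (max A₀ r) := by
    intro k h hkh
    have key : ∀ x y, (e x).2 = k⁻¹ → (e' y).2 = h⁻¹ → (e x).1 = (e' y).1 →
        wordDist T (φ x) y ≤ max A₀ r := by
      intro x y hx hy hxy
      refine (hr _ _ ⟨_, hkh, ?_⟩).trans (le_max_right _ _)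
      apply e'.injective
      rw [map_mul, map_inv, hφ, hx, MulEquiv.apply_symm_apply]
      ext <;> simp [hxy, hy]
    constructor
    · rintro _ ⟨x, hx, rfl⟩
      exact ⟨e'.symm ((e x).1, h⁻¹), by simp [fiber], key _ _ hx (by simp) (by simp)⟩
    · intro y hy
      refine ⟨_, ⟨e.symm ((e' y).1, k⁻¹), by simp [fiber], rfl⟩, key _ _ (by simp) hy (by simp)⟩
  choose! m hm hm' using h1
  have hinj : Set.InjOn m (cosets P p) := by
    intro D₁ hD₁ D₂ hD₂ h12
    exact Matched.unique hE' hD₁ hD₂ (hsymm _ _ (hm' _ hD₁)) (h12 ▸ hsymm _ _ (hm' _ hD₂))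
  have hsurj : Set.SurjOn m (cosets P p) (cosets Q q) := by
    intro D hD
    obtain ⟨D', hD', hDD⟩ := h2 D hD
    exact ⟨D', hD', Matched.unique hE (hm _ hD') hD (hm' _ hD') hDD⟩
  have hinv : ∀ D, Function.invFun (fiberFam e) (fiberFam e D) = D :=
    Function.leftInverse_invFun (fiberFam_injective e)
  refine ⟨K, max A₀ r, φ, fun F => fiberFam e' (m (Function.invFun (fiberFam e) F)),
    hA _ (le_max_left _ _), ⟨?_, ?_, ?_⟩, ?_⟩
  · rintro _ ⟨D, hD, rfl⟩
    simp only [hinv]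
    exact ⟨_, hm D hD, rfl⟩
  · rintro _ ⟨D, hD, rfl⟩ _ ⟨D', hD', rfl⟩ h
    simp only [hinv] at h
    rw [hinj hD hD' (fiberFam_injective e' h)]
  · rintro _ ⟨D, hD, rfl⟩
    obtain ⟨D', hD', rfl⟩ := hsurj hD
    exact ⟨_, ⟨D', hD', rfl⟩, by simp only [hinv]⟩
  · rintro _ ⟨D, hD, rfl⟩
    simp only [hinv]
    constructor
    · rintro _ ⟨k, hk, rfl⟩
      obtain ⟨h, hh, hkh⟩ := (hm' D hD).1 k hk
      exact ⟨_, ⟨h, hh, rfl⟩, hhaus _ _ hkh⟩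
    · rintro _ ⟨h, hh, rfl⟩
      obtain ⟨k, hk, hkh⟩ := (hm' D hD).2 h hh
      exact ⟨_, ⟨k, hk, rfl⟩, hhaus _ _ hkh⟩

theorem IsRelQI.pairEq (hSf : S.Finite) (hS : Subgroup.closure S = ⊤) (hTf : T.Finite)
    (hT : Subgroup.closure T = ⊤) (hp : p.Nonempty) (hq : q.Nonempty)
    (h : IsRelQI (wordDist S) (wordDist T) (fiberPeriph e p) (fiberPeriph e' q)) :
    PairEq (cosets P p) (cosets Q q) := by
  obtain ⟨K, A, φ, fs, hqi, ⟨hmaps, -, hsurj⟩, hfs⟩ := h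
  obtain ⟨j₀, hj₀⟩ := hp
  obtain ⟨j₁, hj₁⟩ := hq
  obtain ⟨φ', hφ⟩ := hqi.cemb hSf hS hTf hT
  obtain ⟨B, hB, hball⟩ := finite_ball hTf hT A
  have hF := ((CInv.of_mulEquiv e).symm.trans hφ).trans (CInv.of_mulEquiv e')
  set F := fun x => e' (conjInv φ (e.symm x)) with hFdef
  set F' := fun x => e (φ' (e'.symm x)) with hF'def
  set N : Set (Multiplicative ℤ × CoprodI Q) := e' '' B
  have hN : N.Finite := hB.image _
  have hmem : ∀ k : CoprodI P, ∀ j, k ∈ fcoset j k := fun k j => ⟨1, by simp⟩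
  have hmem' : ∀ k : CoprodI Q, ∀ j, k ∈ fcoset j k := fun k j => ⟨1, by simp⟩
  have key : ∀ k h, HausLE (wordDist T) (φ '' fiber e k⁻¹) (fiber e' h⁻¹) A →
      (∀ n, ∃ m, F (n, k) * (m, h)⁻¹ ∈ N) ∧ (∀ m, ∃ n, F (n, k) * (m, h)⁻¹ ∈ N) := by
    rintro k h ⟨h1, h2⟩
    have aux : ∀ x y, (e x).2 = k⁻¹ → (e' y).2 = h⁻¹ → wordDist T (φ x) y ≤ A →
        F ((e x).1⁻¹, k) * ((e' y).1⁻¹, h)⁻¹ ∈ N := by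
      intro x y hx hy hxy
      refine ⟨_, hball _ _ hxy, ?_⟩
      have : e.symm ((e x).1⁻¹, k) = x⁻¹ := by
        rw [MulEquiv.symm_apply_eq, map_inv]
        ext <;> simp [hx]
      simp only [hFdef, this, conjInv, inv_inv, map_mul, map_inv]
      congr 1
      ext <;> simp [hy]
    constructor
    · intro n
      obtain ⟨y, hy, hxy⟩ := h1 _ ⟨e.symm (n⁻¹, k⁻¹), by simp [fiber], rfl⟩
      have := aux _ y (by simp) hy hxy
      simp only [MulEquiv.apply_symm_apply, inv_inv] at this
      exact ⟨_, this⟩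
    · intro m
      obtain ⟨_, ⟨x, hx, rfl⟩, hxy⟩ := h2 (e'.symm (m⁻¹, h⁻¹)) (by simp [fiber])
      have := aux x _ hx (by simp) hxy
      simp only [MulEquiv.apply_symm_apply, inv_inv] at this
      exact ⟨_, this⟩
  set N₂ : Set (CoprodI Q) := Prod.snd '' N
  have hN₂ : N₂.Finite := hN.image _
  have hnear : ∀ k h, HausLE (wordDist T) (φ '' fiber e k⁻¹) (fiber e' h⁻¹) A →
      ∀ n, (F (n, k)).2 * h⁻¹ ∈ N₂ := by
    intro k h hkh n
    obtain ⟨m, hm⟩ := (key k h hkh).1 n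
    exact ⟨_, hm, by simp⟩
  have hex : ∀ k, ∃ h, HausLE (wordDist T) (φ '' fiber e k⁻¹) (fiber e' h⁻¹) A := by
    intro k
    have hk : fiberFam e (fcoset j₀ k) ∈ fiberPeriph e p := ⟨_, ⟨j₀, hj₀, k, rfl⟩, rfl⟩
    obtain ⟨b, hb, hkb⟩ := (hfs _ hk).1 _ ⟨k, hmem k j₀, rfl⟩
    obtain ⟨D, hD, hfsD⟩ := hmaps hk
    rw [← hfsD] at hb
    obtain ⟨h, -, rfl⟩ := hb
    exact ⟨h, hkb⟩
  have hex' : ∀ h, ∃ k, HausLE (wordDist T) (φ '' fiber e k⁻¹) (fiber e' h⁻¹) A := by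
    intro h
    have hh : fiberFam e' (fcoset j₁ h) ∈ fiberPeriph e' q := ⟨_, ⟨j₁, hj₁, h, rfl⟩, rfl⟩
    obtain ⟨X, hX, hXh⟩ := hsurj hh
    obtain ⟨a, ha, hab⟩ := (hfs _ hX).2 (fiber e' h⁻¹) (hXh ▸ ⟨h, hmem' h j₁, rfl⟩)
    obtain ⟨D, hD, rfl⟩ := hX
    obtain ⟨k, -, rfl⟩ := ha
    exact ⟨k, hab⟩
  have hF1 : Near (fun x => (F x).2) (fun x => (F (1, x.2)).2) := by
    refine ⟨N₂ * N₂⁻¹, hN₂.mul hN₂.inv, fun x => ?_⟩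
    obtain ⟨h, hh⟩ := hex x.2
    have := Set.mul_mem_mul (hnear _ _ hh x.1) (Set.inv_mem_inv.mpr (hnear _ _ hh 1))
    simpa [mul_assoc] using this
  have hF2 : Near (fun x => (F' x).2) (fun x => (F' (1, x.2)).2) := by
    obtain ⟨N', hN', h1⟩ := hF.map'.exists_finite hN
    obtain ⟨N'', hN'', h2⟩ := hF.left
    have h3 : ∀ m h k, HausLE (wordDist T) (φ '' fiber e k⁻¹) (fiber e' h⁻¹) A →
        (F' (m, h)).2 * k⁻¹ ∈ Prod.snd '' (N'⁻¹ * N'') := by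
      intro m h k hkh
      obtain ⟨n, hn⟩ := (key k h hkh).2 m
      refine ⟨_, Set.mul_mem_mul (Set.inv_mem_inv.mpr (h1 _ _ hn)) (h2 (n, k)), ?_⟩
      simp
    have hfin : (Prod.snd '' (N'⁻¹ * N'')).Finite := (hN'.inv.mul hN'').image _
    refine ⟨_, hfin.mul hfin.inv, fun x => ?_⟩
    obtain ⟨k, hk⟩ := hex' x.2
    have := Set.mul_mem_mul (h3 x.1 _ _ hk) (Set.inv_mem_inv.mpr (h3 1 _ _ hk))
    simpa [mul_assoc] using this
  have hmatch : ∀ D ∈ cosets P p, ∀ D', fs (fiberFam e D) = fiberFam e' D' →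
      Matched (fun k => (F (1, k)).2) N₂ D D' := by
    intro D hD D' hDD
    have := hfs _ ⟨D, hD, rfl⟩
    rw [hDD] at this
    constructor
    · intro k hk
      obtain ⟨_, ⟨h, hh, rfl⟩, hkh⟩ := this.1 _ ⟨k, hk, rfl⟩
      exact ⟨h, hh, hnear _ _ hkh 1⟩
    · intro h hh
      obtain ⟨_, ⟨k, hk, rfl⟩, hkh⟩ := this.2 _ ⟨h, hh, rfl⟩
      exact ⟨k, hk, hnear _ _ hkh 1⟩
  refine ⟨_, _, hF.snd hF1 hF2, N₂, hN₂, fun D hD => ?_, fun D' hD' => ?_⟩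
  · obtain ⟨D', hD', h⟩ := hmaps ⟨D, hD, rfl⟩
    exact ⟨D', hD', hmatch D hD D' h.symm⟩
  · obtain ⟨_, ⟨D, hD, rfl⟩, h⟩ := hsurj ⟨D', hD', rfl⟩
    exact ⟨D, hD, hmatch D hD D' h⟩

end

end

/-! ### Right-angled Artin groups and their cylinders -/

noncomputable section

open Monoid

variable {V : Type} {Γ : SimpleGraph V}

theorem raagGen_commute {x y : V} (h : Γ.Adj x y) : Commute (raagGen Γ x) (raagGen Γ y) := by
  have : (PresentedGroup.mk (raagRels Γ)) (FreeGroup.of x * FreeGroup.of y * (FreeGroup.of x)⁻¹ *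
      (FreeGroup.of y)⁻¹) = 1 :=
    PresentedGroup.one_of_mem ⟨x, y, h, rfl⟩
  simp only [map_mul, map_inv] at this
  have h2 : raagGen Γ x * raagGen Γ y * (raagGen Γ x)⁻¹ * (raagGen Γ y)⁻¹ = 1 := this
  rw [mul_inv_eq_one, mul_inv_eq_iff_eq_mul] at h2
  exact h2

/-- The homomorphism from a right-angled Artin group determined by its values on vertices. -/
def raagLift {G : Type*} [Group G] (f : V → G) (h : ∀ x y, Γ.Adj x y → Commute (f x) (f y)) :
    Raag Γ →* G :=
  PresentedGroup.toGroup (f := f) (by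
    rintro _ ⟨x, y, hxy, rfl⟩
    simp only [map_mul, map_inv, FreeGroup.lift_apply_of]
    rw [(h x y hxy).eq]
    group)

@[simp] theorem raagLift_gen {G : Type*} [Group G] (f : V → G)
    (h : ∀ x y, Γ.Adj x y → Commute (f x) (f y)) (x : V) : raagLift f h (raagGen Γ x) = f x :=
  PresentedGroup.toGroup.of _

/-- The generators of `subRaag Γ T`. -/
def genIn (Γ : SimpleGraph V) {T : Set V} {u : V} (hu : u ∈ T) : subRaag Γ T :=
  ⟨raagGen Γ u, Subgroup.subset_closure ⟨u, hu, rfl⟩⟩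

/-- The set of generators of `subRaag Γ T`. -/
def gens (Γ : SimpleGraph V) (T : Set V) : Set (subRaag Γ T) :=
  {x : ↥(subRaag Γ T) | ∃ u ∈ T, (x : Raag Γ) = raagGen Γ u}

theorem gens_eq_range (Γ : SimpleGraph V) (T : Set V) :
    gens Γ T = Set.range fun u : T => genIn Γ u.2 := by
  ext x
  constructor
  · rintro ⟨u, hu, e⟩
    exact ⟨⟨u, hu⟩, Subtype.ext e.symm⟩
  · rintro ⟨u, rfl⟩
    exact ⟨u, u.2, rfl⟩

theorem finite_gens [Finite V] (T : Set V) : (gens Γ T).Finite := by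
  rw [gens_eq_range]
  exact Set.finite_range _

theorem closure_gens (T : Set V) : Subgroup.closure (gens Γ T) = ⊤ := by
  have : gens Γ T = Subtype.val ⁻¹' (raagGen Γ '' T) := by
    ext x
    constructor
    · rintro ⟨u, hu, e⟩
      exact ⟨u, hu, e.symm⟩
    · rintro ⟨u, hu, e⟩
      exact ⟨u, hu, e.symm⟩
  rw [this]
  exact Subgroup.closure_closure_coe_preimage

theorem subRaag_hom_ext {T : Set V} {G : Type*} [Group G] {f g : subRaag Γ T →* G}
    (h : ∀ u (hu : u ∈ T), f (genIn Γ hu) = g (genIn Γ hu)) : f = g := by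
  refine MonoidHom.eq_of_eqOn_dense (closure_gens T) ?_
  rw [gens_eq_range]
  rintro _ ⟨u, rfl⟩
  exact h u u.2

theorem genIn_commute {T : Set V} {x y : V} (hx : x ∈ T) (hy : y ∈ T) (h : Γ.Adj x y) :
    Commute (genIn Γ hx) (genIn Γ hy) := Subtype.ext (raagGen_commute h)

theorem factorQI_iff {W : Type} [Finite V] [Finite W] {Λ : SimpleGraph W} {T : Set V} {T' : Set W} :
    FactorQI Γ Λ T T' ↔
      ∃ (f : subRaag Γ T → subRaag Λ T') (f' : subRaag Λ T' → subRaag Γ T), CInv f f' :=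
  exists_isQI_iff (finite_gens T) (closure_gens T) (finite_gens T') (closure_gens T')

theorem subRaag_infinite {T : Set V} (hT : T.Nonempty) : Infinite (subRaag Γ T) := by
  obtain ⟨u, hu⟩ := hT
  let d : Raag Γ →* Multiplicative ℤ := raagLift (fun _ => Multiplicative.ofAdd 1) fun _ _ _ => Commute.all _ _
  refine Infinite.of_injective (fun n : ℤ => genIn Γ hu ^ n) fun n m h => ?_
  have h2 := congrArg (fun x : subRaag Γ T => d x) h
  simpa [d, genIn, ← ofAdd_zsmul] using h2

/-- The homomorphism sending every generator to `-1`. -/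
def genSign (Γ : SimpleGraph V) (T : Set V) : subRaag Γ T →* ℤˣ :=
  (raagLift (fun _ => -1) fun _ _ _ => Commute.all _ _).comp (subRaag Γ T).subtype

theorem genSign_genIn {T : Set V} {u : V} (hu : u ∈ T) : genSign Γ T (genIn Γ hu) = -1 := by
  rw [genSign, MonoidHom.comp_apply, Subgroup.subtype_apply, genIn, raagLift_gen]

theorem indep_genIn {T : Set V} {x y : V} (hx : x ∈ T) (hy : y ∈ T) (h : Γ.Adj x y) :
    Indep (genIn Γ hx) (genIn Γ hy) := by
  classical
  refine ⟨genIn_commute hx hy h, fun a b hab => ?_⟩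
  let d : Raag Γ →* Multiplicative ℤ × Multiplicative ℤ :=
    raagLift (fun u => if u = x then (Multiplicative.ofAdd 1, 1) else
      if u = y then (1, Multiplicative.ofAdd 1) else 1) fun _ _ _ => Commute.all _ _
  have h2 := congrArg (fun x : subRaag Γ T => d x) hab
  have h3 : d (raagGen Γ x) = (Multiplicative.ofAdd 1, 1) := by simp [d]
  have h4 : d (raagGen Γ y) = (1, Multiplicative.ofAdd 1) := by simp [d, h.ne.symm]
  simp only [plane, genIn, Subgroup.coe_mul, Subgroup.coe_zpow, map_mul, map_zpow, h3, h4] at h2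
  have h5 := congrArg Prod.fst h2
  have h6 := congrArg Prod.snd h2
  simp only [Prod.pow_mk, Prod.mk_mul_mk, one_zpow, mul_one, one_mul, ← ofAdd_zsmul] at h5 h6
  exact Prod.ext (by simpa using h5) (by simpa using h6)

theorem exists_equiv_int {T : Set V} {u : V} (hT : T = {u}) :
    Nonempty (subRaag Γ T ≃* Multiplicative ℤ) := by
  have hu : u ∈ T := hT ▸ rfl
  let d : Raag Γ →* Multiplicative ℤ := raagLift (fun _ => Multiplicative.ofAdd 1) fun _ _ _ => Commute.all _ _
  refine ⟨MonoidHom.toMulEquiv (d.comp (subRaag Γ T).subtype) (zpowersHom _ (genIn Γ hu)) ?_ ?_⟩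
  · refine subRaag_hom_ext fun x hx => ?_
    obtain rfl : x = u := by
      rw [hT] at hx
      exact hx
    simp [d, genIn]
  · ext
    simp [d, genIn]

/-- The blocks containing `v`. -/
abbrev BlockAt (Γ : SimpleGraph V) (v : V) : Type := {S : Set V // MaxBiconn Γ S ∧ v ∈ S}

/-- The factor corresponding to a block. -/
abbrev BlockGroup (Γ : SimpleGraph V) (v : V) (j : BlockAt Γ v) : Type := subRaag Γ (lkIn Γ j.1 v)

theorem mem_starSet_of_mem_lkIn {S : Set V} {u v : V} (h : u ∈ lkIn Γ S v) : u ∈ starSet Γ v :=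
  Or.inr h.2

theorem self_mem_starSet (v : V) : v ∈ starSet Γ v := Or.inl rfl

theorem of_genIn_congr {v : V} {j j' : BlockAt Γ v} (e : j = j') {u : V} (hu : u ∈ lkIn Γ j.1 v)
    (hu' : u ∈ lkIn Γ j'.1 v) :
    CoprodI.of (M := BlockGroup Γ v) (i := j) (genIn Γ hu) =
      CoprodI.of (M := BlockGroup Γ v) (i := j') (genIn Γ hu') := by
  subst e
  rfl

/-- The inclusion of a factor into the cylinder. -/
def factorIncl (Γ : SimpleGraph V) (v : V) (j : BlockAt Γ v) : BlockGroup Γ v j →* subRaag Γ (starSet Γ v) :=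
  Subgroup.inclusion (Subgroup.closure_mono (Set.image_mono fun _ => mem_starSet_of_mem_lkIn))

theorem genIn_commute_factorIncl {v : V} (j : BlockAt Γ v) (p : BlockGroup Γ v j) :
    Commute (genIn Γ (self_mem_starSet v)) (factorIncl Γ v j p) := by
  have : p ∈ (Subgroup.centralizer {genIn Γ (self_mem_starSet v)}).comap (factorIncl Γ v j) := by
    have h : Subgroup.closure (gens Γ (lkIn Γ j.1 v)) ≤
        (Subgroup.centralizer {genIn Γ (self_mem_starSet v)}).comap (factorIncl Γ v j) := by
      rw [Subgroup.closure_le, gens_eq_range]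
      rintro _ ⟨u, rfl⟩
      rintro _ rfl
      exact (genIn_commute (self_mem_starSet v) (mem_starSet_of_mem_lkIn u.2) u.2.2).eq
    rw [closure_gens] at h
    exact h trivial
  exact this _ rfl

section
variable [Finite V] {v : V}

/-- The block containing an edge at `v`. -/
def blockOf (Γ : SimpleGraph V) (v : V) {u : V} (h : Γ.Adj v u) : BlockAt Γ v :=
  ⟨(exists_block h).choose, (exists_block h).choose_spec.1, (exists_block h).choose_spec.2.1⟩

theorem mem_blockOf {u : V} (h : Γ.Adj v u) : u ∈ lkIn Γ (blockOf Γ v h).1 v :=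
  ⟨(exists_block h).choose_spec.2.2, h⟩

theorem blockOf_eq {j : BlockAt Γ v} {u : V} (hu : u ∈ lkIn Γ j.1 v) : blockOf Γ v hu.2 = j :=
  Subtype.ext ((blockOf Γ v hu.2).2.1.eq_of_two j.2.1 hu.2.ne (blockOf Γ v hu.2).2.2 j.2.2
    (mem_blockOf hu.2).1 hu.1)

open Classical in
/-- The projection of the cylinder to the free product of the blocks, on vertices. -/
def linkVal (Γ : SimpleGraph V) (v u : V) : CoprodI (BlockGroup Γ v) :=
  if h : Γ.Adj v u then CoprodI.of (M := BlockGroup Γ v) (i := blockOf Γ v h) (genIn Γ (mem_blockOf h)) else 1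

theorem linkVal_of_mem {j : BlockAt Γ v} {u : V} (hu : u ∈ lkIn Γ j.1 v) :
    linkVal Γ v u = CoprodI.of (M := BlockGroup Γ v) (i := j) (genIn Γ hu) := by
  rw [linkVal, dif_pos hu.2]
  exact of_genIn_congr (blockOf_eq hu) _ _

theorem linkVal_of_not_adj {u : V} (hu : ¬ Γ.Adj v u) : linkVal Γ v u = 1 := by
  rw [linkVal, dif_neg hu]

theorem linkVal_commute {x y : V} (h : Γ.Adj x y) : Commute (linkVal Γ v x) (linkVal Γ v y) := by
  by_cases hx : Γ.Adj v x
  · by_cases hy : Γ.Adj v y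
    · have hx' := mem_blockOf hx
      have hy' : y ∈ lkIn Γ (blockOf Γ v hx).1 v :=
        ⟨(blockOf Γ v hx).2.1.mem_of_triangle (blockOf Γ v hx).2.2 hx'.1 hx hy h, hy⟩
      rw [linkVal_of_mem hx', linkVal_of_mem hy']
      exact (genIn_commute hx' hy' h).map _
    · rw [linkVal_of_not_adj hy]
      exact Commute.one_right _
  · rw [linkVal_of_not_adj hx]
    exact Commute.one_left _

open Classical in
/-- The projection of a right-angled Artin group to `ℤ × (free product of the blocks)`. -/
def toProd (Γ : SimpleGraph V) (v : V) : Raag Γ →* Multiplicative ℤ × CoprodI (BlockGroup Γ v) :=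
  MonoidHom.prod (raagLift (fun u => if u = v then Multiplicative.ofAdd 1 else 1)
    fun _ _ _ => Commute.all _ _) (raagLift (linkVal Γ v) fun _ _ => linkVal_commute)

theorem toProd_self : toProd Γ v (raagGen Γ v) = (Multiplicative.ofAdd 1, 1) := by
  simp [toProd, linkVal_of_not_adj]

theorem toProd_of_mem {j : BlockAt Γ v} {u : V} (hu : u ∈ lkIn Γ j.1 v) :
    toProd Γ v (raagGen Γ u) = (1, CoprodI.of (M := BlockGroup Γ v) (i := j) (genIn Γ hu)) := by
  simp [toProd, linkVal_of_mem hu, hu.2.ne.symm]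

theorem toProd_factor (j : BlockAt Γ v) (p : BlockGroup Γ v j) :
    toProd Γ v p = (1, CoprodI.of (M := BlockGroup Γ v) p) := by
  have : (toProd Γ v).comp (subRaag Γ (lkIn Γ j.1 v)).subtype =
      (MonoidHom.inr _ _).comp (CoprodI.of (M := BlockGroup Γ v) (i := j)) :=
    subRaag_hom_ext fun u hu => by
      simpa [genIn] using toProd_of_mem hu
  exact DFunLike.congr_fun this p

theorem toProd_lift_factorIncl (k : CoprodI (BlockGroup Γ v)) :
    toProd Γ v (CoprodI.lift (factorIncl Γ v) k : subRaag Γ (starSet Γ v)) = (1, k) := by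
  induction k using CoprodI.induction_on with
  | one => simp; rfl
  | of j p =>
    rw [CoprodI.lift_of]
    exact toProd_factor j p
  | mul x y hx hy => rw [map_mul, Subgroup.coe_mul, map_mul, hx, hy]; simp

/-- The homomorphism from `ℤ × (free product of the blocks)` to the cylinder. -/
def ofProd (Γ : SimpleGraph V) (v : V) :
    Multiplicative ℤ × CoprodI (BlockGroup Γ v) →* subRaag Γ (starSet Γ v) :=
  MonoidHom.noncommCoprod (zpowersHom _ (genIn Γ (self_mem_starSet v)))
    (CoprodI.lift (factorIncl Γ v)) (by
      intro n k
      rw [zpowersHom_apply]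
      refine Commute.zpow_left ?_ _
      induction k using CoprodI.induction_on with
      | one => simp
      | of j p => simpa using genIn_commute_factorIncl j p
      | mul x y hx hy => rw [map_mul]; exact hx.mul_right hy)

/-- The cylinder is the product of a cyclic group and the free product of the blocks. -/
def cylEquiv (Γ : SimpleGraph V) (v : V) :
    subRaag Γ (starSet Γ v) ≃* Multiplicative ℤ × CoprodI (BlockGroup Γ v) :=
  MonoidHom.toMulEquiv ((toProd Γ v).comp (subRaag Γ (starSet Γ v)).subtype) (ofProd Γ v)
    (subRaag_hom_ext fun u hu => by
      rcases hu with rfl | hu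
      · have := toProd_self (Γ := Γ) (v := u)
        simp [genIn, this, ofProd]
      · have := toProd_of_mem (mem_blockOf hu)
        simp only [MonoidHom.comp_apply, Subgroup.subtype_apply, genIn, this, ofProd]
        simp [factorIncl]
        rfl)
    (by
      refine MonoidHom.ext fun x => ?_
      have h := toProd_lift_factorIncl (Γ := Γ) (v := v) x.2
      simp only [MonoidHom.comp_apply, Subgroup.subtype_apply, ofProd, MonoidHom.noncommCoprod_apply,
        zpowersHom_apply, map_mul, map_zpow, genIn, toProd_self, h]
      ext <;> simp [← ofAdd_zsmul])

theorem eq_mul_zpow_iff (a x : subRaag Γ (starSet Γ v)) :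
    (∃ n : ℤ, (x : Raag Γ) = a * raagGen Γ v ^ n) ↔ (cylEquiv Γ v x).2 = (cylEquiv Γ v a).2 := by
  have h1 : cylEquiv Γ v (genIn Γ (self_mem_starSet v)) = (Multiplicative.ofAdd 1, 1) :=
    toProd_self
  have h2 : (∃ n : ℤ, (x : Raag Γ) = a * raagGen Γ v ^ n) ↔
      ∃ n : ℤ, x = a * genIn Γ (self_mem_starSet v) ^ n :=
    exists_congr fun n => (Subtype.ext_iff (a1 := x)
      (a2 := a * genIn Γ (self_mem_starSet v) ^ n)).symm
  rw [h2]
  constructor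
  · rintro ⟨n, rfl⟩
    simp [h1]
  · intro hx
    refine ⟨Multiplicative.toAdd ((cylEquiv Γ v a).1⁻¹ * (cylEquiv Γ v x).1), ?_⟩
    apply (cylEquiv Γ v).injective
    rw [map_mul, map_zpow, h1]
    ext
    · simp [← ofAdd_zsmul]
    · simp [hx]

theorem cylCoset_eq (a : subRaag Γ (starSet Γ v)) :
    cylCoset Γ v a = fiber (cylEquiv Γ v) (cylEquiv Γ v a).2 :=
  Set.ext fun x => eq_mul_zpow_iff a x

theorem cylPeriph_eq : cylPeriph Γ v = fiberPeriph (cylEquiv Γ v) {j | j.1 ∈ C1 Γ} := by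
  have key : ∀ (j : BlockAt Γ v) (g : subRaag Γ (starSet Γ v)),
      {c | ∃ h ∈ subRaag Γ (lkIn Γ j.1 v), c = cylCoset Γ v (g * h)} =
        fiberFam (cylEquiv Γ v) (fcoset j ((cylEquiv Γ v g).2)⁻¹) := by
    intro j g
    have h1 : ∀ p : BlockGroup Γ v j, cylCoset Γ v ((g : Raag Γ) * p) =
        fiber (cylEquiv Γ v) (CoprodI.of p⁻¹ * ((cylEquiv Γ v g).2)⁻¹)⁻¹ := by
      intro p
      have h2 : (cylEquiv Γ v (factorIncl Γ v j p)).2 = CoprodI.of p :=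
        congrArg Prod.snd (toProd_factor j p)
      refine (cylCoset_eq (g * factorIncl Γ v j p)).trans ?_
      rw [map_mul, Prod.snd_mul, h2]
      simp
      rfl
    ext c
    constructor
    · rintro ⟨h, hh, rfl⟩
      exact ⟨_, ⟨_, rfl⟩, h1 ⟨h, hh⟩⟩
    · rintro ⟨_, ⟨p, rfl⟩, rfl⟩
      refine ⟨_, (p⁻¹).2, ?_⟩
      rw [h1, inv_inv]
  ext F
  constructor
  · rintro ⟨S, hS, hv, g, hg, rfl⟩
    exact ⟨_, ⟨⟨S, hS.1, hv⟩, hS, _, rfl⟩, (key ⟨S, hS.1, hv⟩ ⟨g, hg⟩).symm⟩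
  · rintro ⟨_, ⟨j, hj, g, rfl⟩, rfl⟩
    refine ⟨j.1, hj, j.2.2, ((cylEquiv Γ v).symm (1, g⁻¹) : subRaag Γ (starSet Γ v)), Subtype.prop _, ?_⟩
    rw [key]
    simp
    rfl

end

end

/-! ### Coarse equivalence of free products relative to factors of given classes -/

noncomputable section

open Monoid

/-- Coarse equivalence of groups. -/
def CEq (G H : Type*) [Group G] [Group H] : Prop := ∃ (f : G → H) (f' : H → G), CInv f f'

section
variable {G H K : Type*} [Group G] [Group H] [Group K]

theorem CEq.refl : CEq G G := ⟨_, _, CInv.id⟩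

theorem CEq.symm (h : CEq G H) : CEq H G :=
  let ⟨_, _, h⟩ := h
  ⟨_, _, h.symm⟩

theorem CEq.trans (h : CEq G H) (h' : CEq H K) : CEq G K :=
  let ⟨_, _, h⟩ := h
  let ⟨_, _, h'⟩ := h'
  ⟨_, _, h.trans h'⟩

theorem CEq.of_mulEquiv (e : G ≃* H) : CEq G H := ⟨_, _, CInv.of_mulEquiv e⟩

end

section
variable {J : Type} {P : J → Type} [∀ j, Group (P j)]

theorem SignData.infinite_fac [∀ j, Infinite (P j)] (D : SignData P) :
    ∀ i, Infinite (D.Fac i)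
  | .inl j => D.infinite_ker j
  | .inr _ => inferInstanceAs (Infinite ℤ)

theorem SignData.ceq_fac (D : SignData P) (j : J) : CEq (P j) (D.Fac (.inl j)) :=
  let ⟨_, hf⟩ := D.exists_cinv_ker j
  ⟨_, _, hf⟩

end

section
variable {J J' I : Type} {P : J → Type} {Q : J' → Type} [∀ j, Group (P j)] [∀ j, Group (Q j)]
  [Finite J] [Finite J'] [Nontrivial J] [Nontrivial J'] [∀ j, Infinite (P j)] [∀ j, Infinite (Q j)]

theorem pairEq_cosets (k : J → I) (k' : J' → I) (h : ∀ j, ∃ j', k j = k' j' ∧ CEq (P j) (Q j'))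
    (h' : ∀ j', ∃ j, k j = k' j' ∧ CEq (P j) (Q j')) (i : I) :
    PairEq (cosets P {j | k j = i}) (cosets Q {j | k' j = i}) := by
  obtain ⟨f, f', E, hf, hE, h1, h2⟩ := exists_cinv_coprodI (P := P) (Q := Q)
    (fun j => (k j, {j' | CEq (P j) (Q j')})) (fun j' => (k' j', {j'' | CEq (Q j') (Q j'')}))
    (by
      have key : ∀ j j', k j = k' j' → CEq (P j) (Q j') →
          (k j, {j' | CEq (P j) (Q j')}) = (k' j', {j'' | CEq (Q j') (Q j'')}) := by
        intro j j' e hc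
        rw [e]
        congr 1
        ext j''
        exact ⟨fun h => hc.symm.trans h, fun h => hc.trans h⟩
      ext x
      constructor
      · rintro ⟨j, rfl⟩
        obtain ⟨j', e, hc⟩ := h j
        exact ⟨j', (key j j' e hc).symm⟩
      · rintro ⟨j', rfl⟩
        obtain ⟨j, e, hc⟩ := h' j'
        exact ⟨j, key j j' e hc⟩)
    (by
      intro j j' e
      have : j' ∈ {j' | CEq (P j) (Q j')} := by
        rw [(Prod.mk.inj e).2]
        exact CEq.refl
      exact this)
  refine ⟨f, f', hf, E, hE, ?_, ?_⟩
  · rintro _ ⟨j, rfl, g, rfl⟩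
    obtain ⟨j', g', e, hm⟩ := h1 j g
    exact ⟨_, ⟨j', (Prod.mk.inj e).1.symm, g', rfl⟩, hm⟩
  · rintro _ ⟨j', rfl, g', rfl⟩
    obtain ⟨j, g, e, hm⟩ := h2 j' g'
    exact ⟨_, ⟨j, (Prod.mk.inj e).1, g, rfl⟩, hm⟩

/-- Free products with the same noncyclic factors up to coarse equivalence are coarsely equivalent,
even relative to classes of noncyclic factors. -/
theorem pairEq_cosets_of_ne_cyclic (D : SignData P) (D' : SignData Q) (k : J → I) (k' : J' → I)
    (z : I) (hz : ∀ j, k j = z → CEq (P j) (Multiplicative ℤ))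
    (hz' : ∀ j, k' j = z → CEq (Q j) (Multiplicative ℤ))
    (h : ∀ j, k j ≠ z → ∃ j', k j = k' j' ∧ CEq (P j) (Q j'))
    (h' : ∀ j', k' j' ≠ z → ∃ j, k j = k' j' ∧ CEq (P j) (Q j')) {i : I} (hi : i ≠ z) :
    PairEq (cosets P {j | k j = i}) (cosets Q {j | k' j = i}) := by
  have down : ∀ {J : Type} {P : J → Type} [∀ j, Group (P j)] [Finite J] (D : SignData P) (k : J → I),
      PairEq (cosets P {j | k j = i}) (cosets D.Fac {l | Sum.elim k (fun _ => z) l = i}) := by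
    intro J P _ _ D k
    obtain ⟨E, hE, h1, h2⟩ := D.exists_matched
    refine ⟨_, _, D.cinv_down, E, hE, ?_, ?_⟩
    · rintro _ ⟨j, hj, g, rfl⟩
      obtain ⟨g', hm⟩ := h1 j g
      exact ⟨_, ⟨.inl j, hj, g', rfl⟩, hm⟩
    · rintro _ ⟨l, hl, g', rfl⟩
      rcases l with j | j
      · obtain ⟨g, hm⟩ := h2 j g'
        exact ⟨_, ⟨j, hl, g, rfl⟩, hm⟩
      · exact absurd hl.symm hi
  refine (down D k).trans (PairEq.trans ?_ (down D' k').symm)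
  have := D.infinite_fac
  have := D'.infinite_fac
  have : Nontrivial (J ⊕ {j // j ≠ D.base}) := Sum.inl_injective.nontrivial
  have : Nontrivial (J' ⊕ {j // j ≠ D'.base}) := Sum.inl_injective.nontrivial
  obtain ⟨b, hb⟩ := exists_ne D.base
  obtain ⟨b', hb'⟩ := exists_ne D'.base
  refine pairEq_cosets _ _ ?_ ?_ i
  · rintro (j | j)
    · by_cases hj : k j = z
      · exact ⟨.inr ⟨b', hb'⟩, hj, (D.ceq_fac j).symm.trans (hz j hj)⟩
      · obtain ⟨j', e, hc⟩ := h j hj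
        exact ⟨.inl j', e, ((D.ceq_fac j).symm.trans hc).trans (D'.ceq_fac j')⟩
    · exact ⟨.inr ⟨b', hb'⟩, rfl, CEq.refl (G := Multiplicative ℤ)⟩
  · rintro (j' | j')
    · by_cases hj : k' j' = z
      · exact ⟨.inr ⟨b, hb⟩, hj.symm, ((hz' j' hj).symm.trans (D'.ceq_fac j'))⟩
      · obtain ⟨j, e, hc⟩ := h' j' hj
        exact ⟨.inl j, e, ((D.ceq_fac j).symm.trans hc).trans (D'.ceq_fac j')⟩
    · exact ⟨.inr ⟨b, hb⟩, rfl, CEq.refl (G := Multiplicative ℤ)⟩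

end

end

/-! ### Relative quasi-isometries of cylinders -/

noncomputable section

open Monoid

variable {V W : Type} {Γ : SimpleGraph V} {Λ : SimpleGraph W} {v : V} {w : W}

theorem CutVertex.nontrivial_blockAt [Finite V] (hΓ : Γ.Connected) (hv : CutVertex Γ v) :
    Nontrivial (BlockAt Γ v) :=
  let ⟨S, T, hS, hT, hvS, hvT, hne⟩ := hv.exists_ne_block hΓ
  ⟨⟨S, hS, hvS⟩, ⟨T, hT, hvT⟩, fun e => hne (congrArg Subtype.val e)⟩

theorem CutVertex.infinite_blockGroup [Finite V] (hΓ : Γ.Connected) (hv : CutVertex Γ v)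
    (j : BlockAt Γ v) : Infinite (BlockGroup Γ v j) :=
  subRaag_infinite (j.2.1.lkIn_nonempty hΓ j.2.2 hv)

theorem factorQI_iff_ceq [Finite V] [Finite W] (j : BlockAt Γ v) (j' : BlockAt Λ w) :
    FactorQI Γ Λ (lkIn Γ j.1 v) (lkIn Λ j'.1 w) ↔ CEq (BlockGroup Γ v j) (BlockGroup Λ w j') :=
  factorQI_iff

/-- The blocks at `v` whose factors are peripheral. -/
def periphBlocks (Γ : SimpleGraph V) (v : V) : Set (BlockAt Γ v) := {j | j.1 ∈ C1 Γ}

theorem isRelQI_cyl_iff [Finite V] [Finite W] (hΓ : Γ.Connected) (hΛ : Λ.Connected)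
    (hv : CutVertex Γ v) (hw : CutVertex Λ w) (hstar : starSet Γ v ≠ Set.univ)
    (hstar' : starSet Λ w ≠ Set.univ) :
    IsRelQI (cylDist Γ v) (cylDist Λ w) (cylPeriph Γ v) (cylPeriph Λ w) ↔
      PairEq (cosets (BlockGroup Γ v) (periphBlocks Γ v))
        (cosets (BlockGroup Λ w) (periphBlocks Λ w)) := by
  have := hv.infinite_blockGroup hΓ
  have := hw.infinite_blockGroup hΛ
  rw [cylPeriph_eq, cylPeriph_eq]
  change IsRelQI (wordDist (gens Γ (starSet Γ v))) (wordDist (gens Λ (starSet Λ w))) _ _ ↔ _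
  obtain ⟨S, hS, hvS⟩ := hv.exists_mem_C1 hΓ hstar
  obtain ⟨T, hT, hwT⟩ := hw.exists_mem_C1 hΛ hstar'
  exact ⟨IsRelQI.pairEq (finite_gens _) (closure_gens _) (finite_gens _) (closure_gens _)
      ⟨⟨S, hS.1, hvS⟩, hS⟩ ⟨⟨T, hT.1, hwT⟩, hT⟩,
    PairEq.isRelQI (finite_gens _) (closure_gens _) (finite_gens _) (closure_gens _)⟩

/-- Restriction of a coarse equivalence of free products to matched cosets of factors. -/
theorem CInv.ceq_of_matched {J J' : Type} {P : J → Type} {Q : J' → Type} [∀ j, Group (P j)]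
    [∀ j, Group (Q j)] {f : CoprodI P → CoprodI Q} {f' : CoprodI Q → CoprodI P} (hf : CInv f f')
    {E : Set (CoprodI Q)} (hE : E.Finite) {j : J} {j' : J'} {g : CoprodI P} {g' : CoprodI Q}
    (hm : Matched f E (fcoset j g) (fcoset j' g')) : CEq (P j) (Q j') :=
  hf.exists_restrict (ι := CoprodI.of) (CoprodI.of_injective j) (ι' := CoprodI.of)
    (CoprodI.of_injective j') hE hm

theorem exists_periph_ceq (h : PairEq (cosets (BlockGroup Γ v) (periphBlocks Γ v))
    (cosets (BlockGroup Λ w) (periphBlocks Λ w))) (j : BlockAt Γ v) (hj : j ∈ periphBlocks Γ v) :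
    ∃ j' ∈ periphBlocks Λ w, CEq (BlockGroup Γ v j) (BlockGroup Λ w j') := by
  obtain ⟨f, f', hf, E, hE, hm, -⟩ := h
  obtain ⟨_, ⟨j', hj', g', rfl⟩, hm⟩ := hm _ ⟨j, hj, 1, rfl⟩
  exact ⟨j', hj', hf.ceq_of_matched hE hm⟩

/-- The blocks at `v` with one-ended nonperipheral factors. -/
def oneEndedBlocks (Γ : SimpleGraph V) (v : V) : Set (BlockAt Γ v) :=
  {j | j.1 ∉ C1 Γ ∧ 2 ≤ (lkIn Γ j.1 v).ncard}

theorem nontrivial_of_mem_oneEndedBlocks {j : BlockAt Γ v} (hj : j ∈ oneEndedBlocks Γ v) :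
    Nontrivial (lkIn Γ j.1 v) := by
  obtain ⟨a, b, ha, hb, hab⟩ := (Set.one_lt_ncard_iff (Set.finite_of_ncard_pos (by
    have := hj.2
    omega))).mp hj.2
  exact ⟨⟨a, ha⟩, ⟨b, hb⟩, fun e => hab (congrArg Subtype.val e)⟩

/-- One-ended nonperipheral factors are mapped near factors. -/
theorem CEmb.exists_fcoset [Finite V] [Finite W] (hΛ : Λ.Connected) (hv : CutVertex Γ v)
    (hw : CutVertex Λ w) {f : CoprodI (BlockGroup Γ v) → CoprodI (BlockGroup Λ w)} (hf : CEmb f)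
    {j : BlockAt Γ v} (hj : j ∈ oneEndedBlocks Γ v) (g : CoprodI (BlockGroup Γ v)) :
    ∃ E : Set (CoprodI (BlockGroup Λ w)), E.Finite ∧ ∃ (j' : BlockAt Λ w) (g' : _),
      ∀ x ∈ fcoset j g, f x ∈ nbhd E (fcoset j' g') := by
  have := hw.infinite_blockGroup hΛ
  have := nontrivial_of_mem_oneEndedBlocks hj
  obtain ⟨E, hE, h⟩ := hf.exists_coset_connected (j.2.1.lkIn_preconnected hj.1 j.2.2 hv)
    (fun u => CoprodI.of (M := BlockGroup Γ v) (i := j) (genIn Γ u.2))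
    (fun s t hst => (indep_genIn s.2 t.2 hst).map (CoprodI.of_injective j))
  obtain ⟨j', g', h⟩ := h g
  refine ⟨E, hE, j', g', ?_⟩
  rintro _ ⟨p, rfl⟩
  refine h _ ?_
  have hp : p ∈ Subgroup.closure (gens Γ (lkIn Γ j.1 v)) := by
    rw [closure_gens]
    trivial
  have hp' := Subgroup.mem_map_of_mem (CoprodI.of (M := BlockGroup Γ v) (i := j)) hp
  rw [MonoidHom.map_closure, gens_eq_range, ← Set.range_comp] at hp'
  exact hp'

/-- One-ended nonperipheral factors admit no coarse embedding into a cyclic group. -/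
theorem not_cEmb_cyclic (hv : CutVertex Γ v) {j : BlockAt Γ v} (hj : j ∈ oneEndedBlocks Γ v)
    {f : BlockGroup Γ v j → Multiplicative ℤ} (hf : CEmb f) : False := by
  have := nontrivial_of_mem_oneEndedBlocks hj
  obtain ⟨a, _⟩ := exists_pair_ne (lkIn Γ j.1 v)
  obtain ⟨b, hab⟩ := (j.2.1.lkIn_preconnected hj.1 j.2.2 hv).exists_adj_of_nontrivial a
  exact hf.not_line (indep_genIn a.2 b.2 hab)

theorem blockGroup_equiv_int [Finite V] (hΓ : Γ.Connected) (hv : CutVertex Γ v) {j : BlockAt Γ v}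
    (hj : ¬ 2 ≤ (lkIn Γ j.1 v).ncard) : Nonempty (BlockGroup Γ v j ≃* Multiplicative ℤ) := by
  have h1 : (lkIn Γ j.1 v).ncard ≠ 0 :=
    (Set.ncard_pos (Set.toFinite _)).mpr (j.2.1.lkIn_nonempty hΓ j.2.2 hv) |>.ne'
  obtain ⟨u, hu⟩ := Set.ncard_eq_one.mp (show (lkIn Γ j.1 v).ncard = 1 by omega)
  exact exists_equiv_int hu

theorem exists_oneEnded_ceq [Finite V] [Finite W] (hΓ : Γ.Connected) (hΛ : Λ.Connected)
    (hv : CutVertex Γ v) (hw : CutVertex Λ w)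
    (h : PairEq (cosets (BlockGroup Γ v) (periphBlocks Γ v))
      (cosets (BlockGroup Λ w) (periphBlocks Λ w))) {j : BlockAt Γ v}
    (hj : j ∈ oneEndedBlocks Γ v) :
    ∃ j' ∈ oneEndedBlocks Λ w, CEq (BlockGroup Γ v j) (BlockGroup Λ w j') := by
  have := hv.infinite_blockGroup hΓ
  obtain ⟨f, f', hf, hm⟩ := h
  obtain ⟨E, hE, j', g', h1⟩ := hf.emb.exists_fcoset hΛ hv hw hj 1
  choose y hy hyE using h1
  have key : ∀ {D : Set (CoprodI (BlockGroup Γ v))} {F : Set (CoprodI (BlockGroup Γ v))},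
      F.Finite → (∀ y ∈ fcoset j' g', f' y ∈ nbhd F D) →
      ∃ F' : Set (CoprodI (BlockGroup Γ v)), F'.Finite ∧ fcoset j 1 ⊆ nbhd F' D := by
    intro D F hF hD
    choose z hz hzF using hD
    have h2 : Near (fun x : fcoset j (1 : CoprodI (BlockGroup Γ v)) => (x : CoprodI (BlockGroup Γ v)))
        (fun x => z (y x x.2) (hy x x.2)) :=
      ((hf.left.comp fun x : fcoset j (1 : CoprodI (BlockGroup Γ v)) => x.1).symm.trans
        (hf.map'.near ⟨E, hE, fun x => hyE x.1 x.2⟩)).trans ⟨F, hF, fun x => hzF _ _⟩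
    obtain ⟨F', hF', h2⟩ := h2
    exact ⟨F', hF', fun x hx => ⟨_, hz _ _, h2 ⟨x, hx⟩⟩⟩
  have hper : j'.1 ∉ C1 Λ := by
    intro hj'
    obtain ⟨E', hE', h3, -⟩ := hm.symm hf
    obtain ⟨_, ⟨i, hi, c, rfl⟩, h3⟩ := h3 _ ⟨j', hj', g', rfl⟩
    obtain ⟨F', hF', h4⟩ := key hE' h3.1
    obtain ⟨rfl, -⟩ := eq_of_fcoset_subset_nbhd hF' h4
    exact hj.1 hi
  have hcard : 2 ≤ (lkIn Λ j'.1 w).ncard := by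
    by_contra hcard
    obtain ⟨e⟩ := blockGroup_equiv_int hΛ hw hcard
    have hof : CEmb fun p : BlockGroup Γ v j => f (CoprodI.of p) :=
      hf.emb.comp (CEmb.of_hom (CoprodI.of_injective j))
    obtain ⟨φ, hφ, -⟩ := hof.exists_lift (ι := CoprodI.of) (CoprodI.of_injective j') hE
      (h := g') fun p => ⟨_, hy (CoprodI.of p) ⟨p, by simp⟩, hyE _ _⟩
    exact not_cEmb_cyclic hv hj ((CEmb.of_hom (f := e.toMonoidHom) e.injective).comp hφ)
  refine ⟨j', ⟨hper, hcard⟩, ?_⟩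
  obtain ⟨F, hF, i, c, h5⟩ := hf.symm.emb.exists_fcoset hΓ hw hv ⟨hper, hcard⟩ g'
  obtain ⟨F', hF', h6⟩ := key hF h5
  obtain ⟨rfl, h7⟩ := eq_of_fcoset_subset_nbhd hF' h6
  rw [← h7] at h5
  choose z hz hzF using h5
  obtain ⟨E', hE', h8⟩ := (hf.map.near ⟨F, hF, fun x : fcoset j' g' => hzF x.1 x.2⟩).symm.trans
    (hf.right.comp fun x : fcoset j' g' => x.1)
  refine hf.ceq_of_matched (g := 1) (g' := g') (hE.union hE') ⟨fun x hx => ?_, fun x hx => ?_⟩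
  · exact ⟨_, hy x hx, Or.inl (hyE x hx)⟩
  · exact ⟨_, hz x hx, Or.inr (h8 ⟨x, hx⟩)⟩

/-- The sign data of the free product of the blocks. -/
def blockSignData [Finite V] (hΓ : Γ.Connected) (hv : CutVertex Γ v) : SignData (BlockGroup Γ v) where
  sgn j := genSign Γ (lkIn Γ j.1 v)
  elt j := genIn Γ (j.2.1.lkIn_nonempty hΓ j.2.2 hv).some_mem
  sgn_elt _ := genSign_genIn _
  base := (hv.nontrivial_blockAt hΓ).to_nonempty.some

open Classical in
/-- The class of a block at `v`: peripheral, one-ended nonperipheral, or cyclic nonperipheral. -/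
def blockClass (Γ : SimpleGraph V) (v : V) (j : BlockAt Γ v) : Fin 3 :=
  if j ∈ periphBlocks Γ v then 0 else if j ∈ oneEndedBlocks Γ v then 1 else 2

theorem blockClass_eq_zero {j : BlockAt Γ v} : blockClass Γ v j = 0 ↔ j ∈ periphBlocks Γ v := by
  unfold blockClass
  split_ifs <;> simp_all

theorem blockClass_eq_one {j : BlockAt Γ v} : blockClass Γ v j = 1 ↔ j ∈ oneEndedBlocks Γ v := by
  unfold blockClass
  split_ifs with h1 h2
  · simp only [Fin.isValue, zero_ne_one, false_iff]
    exact fun h => h.1 h1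
  · simp [h2]
  · simp [h2]

theorem ceq_int_of_blockClass [Finite V] (hΓ : Γ.Connected) (hv : CutVertex Γ v) {j : BlockAt Γ v}
    (hj : blockClass Γ v j = 2) : CEq (BlockGroup Γ v j) (Multiplicative ℤ) := by
  have h0 : j ∉ periphBlocks Γ v := fun h => by
    rw [← blockClass_eq_zero, hj] at h
    exact absurd h (by decide)
  have h1 : j ∉ oneEndedBlocks Γ v := fun h => by
    rw [← blockClass_eq_one, hj] at h
    exact absurd h (by decide)
  obtain ⟨e⟩ := blockGroup_equiv_int hΓ hv fun h => h1 ⟨h0, h⟩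
  exact CEq.of_mulEquiv e

theorem exists_blockClass_ceq {P : BlockAt Γ v → BlockAt Λ w → Prop}
    (h0 : ∀ j ∈ periphBlocks Γ v, ∃ j' ∈ periphBlocks Λ w, P j j')
    (h1 : ∀ j ∈ oneEndedBlocks Γ v, ∃ j' ∈ oneEndedBlocks Λ w, P j j') (j : BlockAt Γ v)
    (hj : blockClass Γ v j ≠ 2) : ∃ j', blockClass Γ v j = blockClass Λ w j' ∧ P j j' := by
  rcases (by omega : blockClass Γ v j = 0 ∨ blockClass Γ v j = 1) with e | e
  · obtain ⟨j', hj', hP⟩ := h0 j (blockClass_eq_zero.mp e)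
    exact ⟨j', e.trans (blockClass_eq_zero.mpr hj').symm, hP⟩
  · obtain ⟨j', hj', hP⟩ := h1 j (blockClass_eq_one.mp e)
    exact ⟨j', e.trans (blockClass_eq_one.mpr hj').symm, hP⟩

theorem pairEq_blocks [Finite V] [Finite W] (hΓ : Γ.Connected) (hΛ : Λ.Connected)
    (hv : CutVertex Γ v) (hw : CutVertex Λ w)
    (h1 : ∀ j ∈ periphBlocks Γ v, ∃ j' ∈ periphBlocks Λ w,
      CEq (BlockGroup Γ v j) (BlockGroup Λ w j'))
    (h2 : ∀ j' ∈ periphBlocks Λ w, ∃ j ∈ periphBlocks Γ v,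
      CEq (BlockGroup Γ v j) (BlockGroup Λ w j'))
    (h3 : ∀ j ∈ oneEndedBlocks Γ v, ∃ j' ∈ oneEndedBlocks Λ w,
      CEq (BlockGroup Γ v j) (BlockGroup Λ w j'))
    (h4 : ∀ j' ∈ oneEndedBlocks Λ w, ∃ j ∈ oneEndedBlocks Γ v,
      CEq (BlockGroup Γ v j) (BlockGroup Λ w j')) :
    PairEq (cosets (BlockGroup Γ v) (periphBlocks Γ v))
      (cosets (BlockGroup Λ w) (periphBlocks Λ w)) := by
  have := hv.infinite_blockGroup hΓ
  have := hw.infinite_blockGroup hΛ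
  have := hv.nontrivial_blockAt hΓ
  have := hw.nontrivial_blockAt hΛ
  have h := pairEq_cosets_of_ne_cyclic (blockSignData hΓ hv) (blockSignData hΛ hw)
    (blockClass Γ v) (blockClass Λ w) 2 (fun _ => ceq_int_of_blockClass hΓ hv)
    (fun _ => ceq_int_of_blockClass hΛ hw) (exists_blockClass_ceq h1 h3)
    (fun j' hj' => (exists_blockClass_ceq (P := fun j' j => CEq (BlockGroup Γ v j) (BlockGroup Λ w j'))
      h2 h4 j' hj').imp fun _ h => ⟨h.1.symm, h.2⟩) (i := 0) (by decide)
  simpa only [blockClass_eq_zero, Set.ofPred_mem_eq] using h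

end

/-- Two cylindrical vertex groups are relatively quasi-isometric if and
only if they have the same quasi-isometry types of peripheral factors and the same
quasi-isometry types of one-ended non-peripheral factors. -/
theorem stmt3 {V W : Type} [Fintype V] [Fintype W]
    (Γ : SimpleGraph V) (Λ : SimpleGraph W)
    (hΓconn : Γ.Connected) (hΛconn : Λ.Connected)
    (v : V) (w : W) (hv : CutVertex Γ v) (hw : CutVertex Λ w)
    (hstarΓ : ∀ u : V, starSet Γ u ≠ Set.univ)
    (hstarΛ : ∀ u : W, starSet Λ u ≠ Set.univ) :
    IsRelQI (cylDist Γ v) (cylDist Λ w) (cylPeriph Γ v) (cylPeriph Λ w) ↔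
    ((∀ S ∈ C1 Γ, v ∈ S →
        ∃ T ∈ C1 Λ, w ∈ T ∧ FactorQI Γ Λ (lkIn Γ S v) (lkIn Λ T w)) ∧
     (∀ T ∈ C1 Λ, w ∈ T →
        ∃ S ∈ C1 Γ, v ∈ S ∧ FactorQI Γ Λ (lkIn Γ S v) (lkIn Λ T w)) ∧
     (∀ S : Set V, MaxBiconn Γ S → S ∉ C1 Γ → v ∈ S → 2 ≤ (lkIn Γ S v).ncard →
        ∃ T : Set W, MaxBiconn Λ T ∧ T ∉ C1 Λ ∧ w ∈ T ∧ 2 ≤ (lkIn Λ T w).ncard ∧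
          FactorQI Γ Λ (lkIn Γ S v) (lkIn Λ T w)) ∧
     (∀ T : Set W, MaxBiconn Λ T → T ∉ C1 Λ → w ∈ T → 2 ≤ (lkIn Λ T w).ncard →
        ∃ S : Set V, MaxBiconn Γ S ∧ S ∉ C1 Γ ∧ v ∈ S ∧ 2 ≤ (lkIn Γ S v).ncard ∧
          FactorQI Γ Λ (lkIn Γ S v) (lkIn Λ T w))) := by
  rw [isRelQI_cyl_iff hΓconn hΛconn hv hw (hstarΓ v) (hstarΛ w)]
  constructor
  · intro h
    refine ⟨fun S hS hvS => ?_, fun T hT hwT => ?_, fun S hS hS1 hvS h2 => ?_,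
      fun T hT hT1 hwT h2 => ?_⟩
    · obtain ⟨T, hT, hc⟩ := exists_periph_ceq h ⟨S, hS.1, hvS⟩ hS
      exact ⟨T.1, hT, T.2.2, (factorQI_iff_ceq ⟨S, hS.1, hvS⟩ T).mpr hc⟩
    · obtain ⟨S, hS, hc⟩ := exists_periph_ceq h.symm ⟨T, hT.1, hwT⟩ hT
      exact ⟨S.1, hS, S.2.2, (factorQI_iff_ceq S ⟨T, hT.1, hwT⟩).mpr hc.symm⟩
    · obtain ⟨T, hT, hc⟩ := exists_oneEnded_ceq hΓconn hΛconn hv hw h (j := ⟨S, hS, hvS⟩) ⟨hS1, h2⟩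
      exact ⟨T.1, T.2.1, hT.1, T.2.2, hT.2, (factorQI_iff_ceq ⟨S, hS, hvS⟩ T).mpr hc⟩
    · obtain ⟨S, hS, hc⟩ :=
        exists_oneEnded_ceq hΛconn hΓconn hw hv h.symm (j := ⟨T, hT, hwT⟩) ⟨hT1, h2⟩
      exact ⟨S.1, S.2.1, hS.1, S.2.2, hS.2, (factorQI_iff_ceq S ⟨T, hT, hwT⟩).mpr hc.symm⟩
  · rintro ⟨h1, h2, h3, h4⟩
    refine pairEq_blocks hΓconn hΛconn hv hw (fun j hj => ?_) (fun j' hj' => ?_)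
      (fun j hj => ?_) (fun j' hj' => ?_)
    · obtain ⟨T, hT, hwT, hq⟩ := h1 j.1 hj j.2.2
      exact ⟨⟨T, hT.1, hwT⟩, hT, (factorQI_iff_ceq j ⟨T, hT.1, hwT⟩).mp hq⟩
    · obtain ⟨S, hS, hvS, hq⟩ := h2 j'.1 hj' j'.2.2
      exact ⟨⟨S, hS.1, hvS⟩, hS, (factorQI_iff_ceq ⟨S, hS.1, hvS⟩ j').mp hq⟩
    · obtain ⟨T, hT, hT1, hwT, hn, hq⟩ := h3 j.1 j.2.1 hj.1 j.2.2 hj.2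
      exact ⟨⟨T, hT, hwT⟩, ⟨hT1, hn⟩, (factorQI_iff_ceq j ⟨T, hT, hwT⟩).mp hq⟩
    · obtain ⟨S, hS, hS1, hvS, hn, hq⟩ := h4 j'.1 j'.2.1 hj'.1 j'.2.2 hj'.2
      exact ⟨⟨S, hS, hvS⟩, ⟨hS1, hn⟩, (factorQI_iff_ceq ⟨S, hS, hvS⟩ j').mp hq⟩

end
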